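/- arXiv:1502.06838 — 3 statements merged into one kernel-verified Lean document; each statement's English description precedes it below -/
import Mathlib

section
/- Let Λ be a finite-dimensional algebra of finite global dimension over an algebraically closed field k, and let ν = DΛ ⊗_Λ − be the Nakayama (Serre) functor on D^b(mod Λ). If F ∈ D^b(mod Λ) is a nonzero object with ν F ≅ F[d] for some integer d (i.e. F is a d-Calabi–Yau object), then d ≥ 0. The same conclusion holds for a nonzero d-Calabi–Yau object of K^b(proj Λ) when Λ is an Iwanaga–Gorenstein algebra. -/
/-!
STATEMENT 0: Let Λ be a finite-dimensional algebra of finite global dimension over an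
algebraically closed field k, and let ν be the Nakayama (= Serre) functor on D^b(mod Λ).
If F ∈ D^b(mod Λ) is nonzero with ν F ≅ F[d] for some d ∈ ℤ, then d ≥ 0.  The same holds
for a nonzero d-Calabi–Yau object of K^b(proj Λ) when Λ is Iwanaga–Gorenstein.

We model D^b(mod Λ) (resp. K^b(proj Λ)) as the objects of the derived category
`DerivedCategory (ModuleCat.{0} Λ)` having bounded finitely generated cohomology
(resp. isomorphic to a bounded complex of finitely generated projectives), and the
Nakayama functor ν as a functor satisfying Serre duality relative to this class of
objects (the Serre functor is unique up to isomorphism, and for the categories at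
hand it is given by the Nakayama functor DΛ ⊗_Λ −).
-/

open CategoryTheory Limits

noncomputable section

/-- Serre duality data for an endofunctor `S`, relative to a class `B` of objects of a
`k`-linear category: a natural perfect pairing `Hom(X,Y) ≅ Hom(Y, S X)^*` for `X, Y ∈ B`. -/
structure SerreDualityOn (k : Type) [Field k] {D : Type*} [Category D]
    [Preadditive D] [CategoryTheory.Linear k D] (B : Set D) (S : D ⥤ D) where
  /-- the duality isomorphism -/
  φ : ∀ (X Y : D), X ∈ B → Y ∈ B → ((X ⟶ Y) ≃ₗ[k] Module.Dual k (Y ⟶ S.obj X))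
  natY : ∀ (X Y Y' : D) (hX : X ∈ B) (hY : Y ∈ B) (hY' : Y' ∈ B)
      (g : Y ⟶ Y') (f : X ⟶ Y) (h : Y' ⟶ S.obj X),
      φ X Y' hX hY' (f ≫ g) h = φ X Y hX hY f (g ≫ h)
  natX : ∀ (X X' Y : D) (hX : X ∈ B) (hX' : X' ∈ B) (hY : Y ∈ B)
      (e : X ⟶ X') (f : X' ⟶ Y) (h : Y ⟶ S.obj X),
      φ X Y hX hY (e ≫ f) h = φ X' Y hX' hY f (h ≫ S.map e)

/-- `Λ` has finite global dimension: `Ext^i` vanishes uniformly for large `i`. -/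
def HasFiniteGlobalDimension (Λ : Type) [Ring Λ] : Prop :=
  ∃ n : ℕ, ∀ (M N : ModuleCat.{0} Λ) (i : ℕ), n < i →
    Subsingleton (((_root_.Ext ℤ (ModuleCat.{0} Λ) i).obj (Opposite.op M)).obj N)

/-- `Λ` is Iwanaga–Gorenstein: `Λ` has finite injective dimension as a left and as a
right module over itself (expressed by vanishing of `Ext^i(−, Λ)` for `i` large). -/
def IsIwanagaGorenstein (Λ : Type) [Ring Λ] : Prop :=
  (∃ n : ℕ, ∀ (M : ModuleCat.{0} Λ) (i : ℕ), n < i →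
      Subsingleton (((_root_.Ext ℤ (ModuleCat.{0} Λ) i).obj (Opposite.op M)).obj
        (ModuleCat.of Λ Λ))) ∧
  (∃ n : ℕ, ∀ (M : ModuleCat.{0} Λᵐᵒᵖ) (i : ℕ), n < i →
      Subsingleton (((_root_.Ext ℤ (ModuleCat.{0} Λᵐᵒᵖ) i).obj (Opposite.op M)).obj
        (ModuleCat.of Λᵐᵒᵖ Λᵐᵒᵖ)))

/-- An object of the derived category of `Λ`-modules lies in `D^b(mod Λ)`:
bounded, finitely generated cohomology. -/
def IsBoundedFG (Λ : Type) [Ring Λ] [HasDerivedCategory (ModuleCat.{0} Λ)]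
    (X : DerivedCategory (ModuleCat.{0} Λ)) : Prop :=
  {n : ℤ | ¬ IsZero ((DerivedCategory.homologyFunctor (ModuleCat.{0} Λ) n).obj X)}.Finite ∧
  ∀ n : ℤ, Module.Finite Λ ((DerivedCategory.homologyFunctor (ModuleCat.{0} Λ) n).obj X)

/-- An object of the derived category of `Λ`-modules is perfect, i.e. lies in
`K^b(proj Λ)`: it is isomorphic to a bounded complex of finitely generated projectives. -/
def IsPerfectObj (Λ : Type) [Ring Λ] [HasDerivedCategory (ModuleCat.{0} Λ)]
    (X : DerivedCategory (ModuleCat.{0} Λ)) : Prop :=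
  ∃ (P : CochainComplex (ModuleCat.{0} Λ) ℤ) (a b : ℤ),
    (∀ n : ℤ, Projective (P.X n)) ∧ (∀ n : ℤ, Module.Finite Λ (P.X n)) ∧
    (∀ n : ℤ, (n < a ∨ b < n) → IsZero (P.X n)) ∧
    Nonempty (DerivedCategory.Q.obj P ≅ X)

namespace CYAux

open HomologicalComplex

variable (Λ : Type) [Ring Λ] [HasDerivedCategory (ModuleCat.{0} Λ)]

/-- The free module of rank one placed in cohomological degree `n`. -/
abbrev freeAt (n : ℤ) : CochainComplex (ModuleCat.{0} Λ) ℤ :=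
  (HomologicalComplex.single (ModuleCat.{0} Λ) (ComplexShape.up ℤ) n).obj (ModuleCat.of Λ Λ)

variable {Λ}

lemma isZero_of_homology (X : DerivedCategory (ModuleCat.{0} Λ))
    (h : ∀ n : ℤ, IsZero ((DerivedCategory.homologyFunctor (ModuleCat.{0} Λ) n).obj X)) :
    IsZero X := by
  have h0 : IsIso (0 : X ⟶ X) := by
    rw [DerivedCategory.isIso_iff]
    intro n
    exact ⟨0, (h n).eq_of_src _ _, (h n).eq_of_src _ _⟩
  rw [IsZero.iff_id_eq_zero]
  rw [← cancel_mono (0 : X ⟶ X)]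
  simp

lemma isZero_Q_homology (K : CochainComplex (ModuleCat.{0} Λ) ℤ) (n : ℤ)
    (h : IsZero (K.homology n)) :
    IsZero ((DerivedCategory.homologyFunctor (ModuleCat.{0} Λ) n).obj
      (DerivedCategory.Q.obj K)) :=
  h.of_iso ((DerivedCategory.homologyFunctorFactors (ModuleCat.{0} Λ) n).app K)

lemma exists_ne_zero (X : DerivedCategory (ModuleCat.{0} Λ)) (n : ℤ)
    (h : ¬ IsZero ((DerivedCategory.homologyFunctor (ModuleCat.{0} Λ) n).obj X)) :
    ∃ f : DerivedCategory.Q.obj (freeAt Λ n) ⟶ X, f ≠ 0 := by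
  let K := DerivedCategory.Q.objPreimage X
  let e : DerivedCategory.Q.obj K ≅ X := DerivedCategory.Q.objObjPreimageIso X
  have hK : K.homologyπ n ≠ 0 := by
    intro h0
    apply h
    refine IsZero.of_iso ?_ ((DerivedCategory.homologyFunctor _ n).mapIso e.symm)
    apply isZero_Q_homology
    rw [IsZero.iff_id_eq_zero, ← cancel_epi (K.homologyπ n), h0]
    simp
  obtain ⟨x, hx⟩ : ∃ x : K.cycles n, (K.homologyπ n).hom x ≠ 0 := by
    by_contra! hc
    apply hK
    ext x
    exact hc x
  let φ : ModuleCat.of Λ Λ ⟶ K.cycles n := ModuleCat.ofHom (LinearMap.toSpanSingleton Λ (K.cycles n) x)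
  have hφ : φ ≫ K.homologyπ n ≠ 0 := by
    intro h0
    apply hx
    have := congrArg (fun (g : ModuleCat.of Λ Λ ⟶ K.homology n) => g.hom (1 : Λ)) h0
    have h2 : (K.homologyπ n).hom ((1 : Λ) • x) = 0 := this
    rwa [one_smul] at h2
  let f : freeAt Λ n ⟶ K := mkHomFromSingle (φ ≫ K.iCycles n) (by intro k hk; simp)
  have hf : homologyMap f n ≠ 0 := by
    intro h0
    apply hφ
    have h1 : (singleObjCyclesSelfIso (ComplexShape.up ℤ) n (ModuleCat.of Λ Λ)).inv ≫
        cyclesMap f n = φ := by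
      rw [← cancel_mono (K.iCycles n), Category.assoc, cyclesMap_i,
        singleObjCyclesSelfIso_inv_iCycles_assoc, mkHomFromSingle_f]
      simp
    rw [← h1, Category.assoc, ← homologyπ_naturality, h0]
    simp
  refine ⟨DerivedCategory.Q.map f ≫ e.hom, fun h0 => hf ?_⟩
  have hQ : DerivedCategory.Q.map f = 0 := by
    rw [← cancel_mono e.hom, h0, zero_comp]
  have := DerivedCategory.homologyFunctorFactors_hom_naturality f n
  rw [hQ, Functor.map_zero, zero_comp] at this
  exact (cancel_epi ((DerivedCategory.homologyFunctorFactors (ModuleCat.{0} Λ) n).hom.app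
    (freeAt Λ n))).1 (this.symm.trans comp_zero.symm)

lemma freeAt_perfect (n : ℤ) : IsPerfectObj Λ (DerivedCategory.Q.obj (freeAt Λ n)) := by
  have hz : ∀ i : ℤ, i ≠ n → IsZero ((freeAt Λ n).X i) := fun i hi =>
    isZero_single_obj_X _ _ _ _ hi
  refine ⟨freeAt Λ n, n, n, ?_, ?_, ?_, ⟨Iso.refl _⟩⟩
  · intro i
    by_cases hi : i = n
    · subst hi
      have : Projective (ModuleCat.of Λ Λ) :=
        ModuleCat.projective_of_free (ι := Unit) (Module.Basis.singleton Unit Λ)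
      exact Projective.of_iso (singleObjXSelf (ComplexShape.up ℤ) i (ModuleCat.of Λ Λ)).symm this
    · exact (hz i hi).projective
  · intro i
    by_cases hi : i = n
    · subst hi
      exact Module.Finite.equiv
        (singleObjXSelf (ComplexShape.up ℤ) i (ModuleCat.of Λ Λ)).symm.toLinearEquiv
    · have := ModuleCat.subsingleton_of_isZero (hz i hi)
      infer_instance
  · intro i hi
    exact hz i (by omega)

lemma freeAt_boundedFG (n : ℤ) : IsBoundedFG Λ (DerivedCategory.Q.obj (freeAt Λ n)) := by
  have hz : ∀ i : ℤ, i ≠ n → IsZero ((DerivedCategory.homologyFunctor (ModuleCat.{0} Λ) i).obj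
      (DerivedCategory.Q.obj (freeAt Λ n))) := fun i hi =>
    isZero_Q_homology _ _ (isZero_single_obj_homology _ _ _ _ hi)
  refine ⟨(Set.finite_singleton n).subset ?_, ?_⟩
  · intro i hi
    by_contra hne
    exact hi (hz i hne)
  · intro i
    by_cases hi : i = n
    · subst hi
      exact Module.Finite.equiv
        ((DerivedCategory.homologyFunctorFactors (ModuleCat.{0} Λ) i).app (freeAt Λ i) ≪≫
          singleObjHomologySelfIso (ComplexShape.up ℤ) i (ModuleCat.of Λ Λ)).symm.toLinearEquiv
    · have := ModuleCat.subsingleton_of_isZero (hz i hi)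
      infer_instance

lemma perfect_finite (X : DerivedCategory (ModuleCat.{0} Λ)) (h : IsPerfectObj Λ X) :
    {n : ℤ | ¬ IsZero
      ((DerivedCategory.homologyFunctor (ModuleCat.{0} Λ) n).obj X)}.Finite := by
  obtain ⟨P, a, b, -, -, hP, ⟨e⟩⟩ := h
  refine (Set.finite_Icc a b).subset ?_
  intro n hn
  by_contra hc
  apply hn
  refine IsZero.of_iso ?_ ((DerivedCategory.homologyFunctor _ n).mapIso e.symm)
  apply isZero_Q_homology
  rw [← exactAt_iff_isZero_homology]
  apply ShortComplex.exact_of_isZero_X₂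
  apply hP
  simp only [Set.mem_Icc] at hc
  omega

lemma main (k : Type) [Field k]
    [CategoryTheory.Linear k (DerivedCategory (ModuleCat.{0} Λ))]
    (ν : DerivedCategory (ModuleCat.{0} Λ) ⥤ DerivedCategory (ModuleCat.{0} Λ))
    (F : DerivedCategory (ModuleCat.{0} Λ)) (d : ℤ)
    (hF : ¬ IsZero F) (e : ν.obj F ≅ F⟦d⟧)
    (B : Set (DerivedCategory (ModuleCat.{0} Λ))) (hFB : F ∈ B)
    (hB : ∀ n : ℤ, DerivedCategory.Q.obj (freeAt Λ n) ∈ B)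
    (hfin : {n : ℤ | ¬ IsZero
      ((DerivedCategory.homologyFunctor (ModuleCat.{0} Λ) n).obj F)}.Finite)
    (S : SerreDualityOn k B ν) : 0 ≤ d := by
  by_contra! hd
  have hne : {n : ℤ | ¬ IsZero
      ((DerivedCategory.homologyFunctor (ModuleCat.{0} Λ) n).obj F)}.Nonempty := by
    by_contra hc
    apply hF
    apply isZero_of_homology
    intro n
    by_contra hn
    exact hc ⟨n, hn⟩
  obtain ⟨m, hm, hmax⟩ := hfin.exists_maximal hne
  have hLE : F.IsLE m := by
    rw [DerivedCategory.isLE_iff]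
    intro i hi
    by_contra hc
    have := hmax hc hi.le
    omega
  have hGE : (DerivedCategory.Q.obj (freeAt Λ (m - d))).IsGE (m - d) := by
    rw [DerivedCategory.isGE_iff]
    intro i hi
    exact isZero_Q_homology _ _ (isZero_single_obj_homology _ _ _ _ (by omega))
  obtain ⟨f, hf⟩ := exists_ne_zero (F⟦d⟧) (m - d) (fun hz => hm (hz.of_iso
    (((DerivedCategory.homologyFunctor (ModuleCat.{0} Λ) 0).shiftIso d (m - d) m
      (by omega)).app F).symm))
  have hsub : ∀ g : F ⟶ DerivedCategory.Q.obj (freeAt Λ (m - d)), g = 0 := fun g =>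
    DerivedCategory.TStructure.t.zero g m (m - d) (by omega)
  apply hf
  have h0 : f ≫ e.inv = 0 := by
    rw [← Module.forall_dual_apply_eq_zero_iff k]
    intro ψ
    obtain ⟨g, rfl⟩ := (S.φ F _ hFB (hB (m - d))).surjective ψ
    rw [hsub g, map_zero, LinearMap.zero_apply]
  rw [← cancel_mono e.inv, h0, zero_comp]

end CYAux

theorem statement_0 (k : Type) [Field k] [IsAlgClosed k]
    (Λ : Type) [Ring Λ] [Algebra k Λ] [FiniteDimensional k Λ]
    [HasDerivedCategory (ModuleCat.{0} Λ)]
    [CategoryTheory.Linear k (DerivedCategory (ModuleCat.{0} Λ))]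
    (ν : DerivedCategory (ModuleCat.{0} Λ) ⥤ DerivedCategory (ModuleCat.{0} Λ))
    (F : DerivedCategory (ModuleCat.{0} Λ)) (d : ℤ)
    (hF : ¬ IsZero F)
    (hCY : Nonempty (ν.obj F ≅ F⟦d⟧))
    (h : (HasFiniteGlobalDimension Λ ∧ IsBoundedFG Λ F ∧
            Nonempty (SerreDualityOn k {X | IsBoundedFG Λ X} ν)) ∨
         (IsIwanagaGorenstein Λ ∧ IsPerfectObj Λ F ∧
            Nonempty (SerreDualityOn k {X | IsPerfectObj Λ X} ν))) :
    0 ≤ d := by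
  obtain ⟨e⟩ := hCY
  rcases h with ⟨-, hB, ⟨S⟩⟩ | ⟨-, hB, ⟨S⟩⟩
  · exact CYAux.main k ν F d hF e _ hB CYAux.freeAt_boundedFG hB.1 S
  · exact CYAux.main k ν F d hF e _ hB CYAux.freeAt_perfect (CYAux.perfect_finite F hB) S

end
end

section
/- Let Λ be a finite-dimensional algebra over an algebraically closed field k. An object M ∈ D^b(mod Λ) is a perfect complex (i.e. lies in the thick subcategory generated by Λ, equivalently is isomorphic to a bounded complex of finitely generated projective modules) if and only if M is homologically finite, i.e. for every D' ∈ D^b(mod Λ) one has Hom(M, D'[i]) ≠ 0 for only finitely many integers i. -/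
/-!
STATEMENT 2: For a finite-dimensional algebra Λ over an algebraically closed field k,
an object M ∈ D^b(mod Λ) is a perfect complex (isomorphic to a bounded complex of
finitely generated projective modules) if and only if M is homologically finite, i.e.
for every D' ∈ D^b(mod Λ) one has Hom(M, D'[i]) ≠ 0 for only finitely many i ∈ ℤ.

D^b(mod Λ) is modelled as the class of objects of the derived category
`DerivedCategory (ModuleCat Λ)` with bounded, finitely generated cohomology.
-/

open CategoryTheory Limits

noncomputable section

open Pretriangulated DerivedCategory

universe w

set_option linter.unusedSectionVars false

section Helpers

variable {Λ : Type} [Ring Λ] [HasDerivedCategory.{w} (ModuleCat.{0} Λ)]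

def PerfIn (X : DerivedCategory (ModuleCat.{0} Λ)) (a b : ℤ) : Prop :=
  ∃ (P : CochainComplex (ModuleCat.{0} Λ) ℤ),
    (∀ n : ℤ, Projective (P.X n)) ∧ (∀ n : ℤ, Module.Finite Λ (P.X n)) ∧
    (∀ n : ℤ, (n < a ∨ b < n) → IsZero (P.X n)) ∧
    Nonempty (DerivedCategory.Q.obj P ≅ X)

lemma isPerfectObj_iff (X : DerivedCategory (ModuleCat.{0} Λ)) :
    IsPerfectObj Λ X ↔ ∃ a b, PerfIn X a b := by
  constructor
  · rintro ⟨P, a, b, h⟩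
    exact ⟨a, b, P, h⟩
  · rintro ⟨a, b, P, h⟩
    exact ⟨P, a, b, h⟩

lemma Q_lift {P K : CochainComplex (ModuleCat.{0} Λ) ℤ} [P.IsKProjective]
    (f : Q.obj P ⟶ Q.obj K) : ∃ g : P ⟶ K, Q.map g = f := by
  obtain ⟨g, hg⟩ := (CochainComplex.IsKProjective.Qh_map_bijective P
    ((HomotopyCategory.quotient _ _).obj K)).surjective
    ((quotientCompQhIso _).hom.app P ≫ f ≫ (quotientCompQhIso _).inv.app K)
  obtain ⟨g, rfl⟩ := (HomotopyCategory.quotient _ _).map_surjective g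
  refine ⟨g, ?_⟩
  have := quotientCompQhIso_hom_naturality g
  rw [hg] at this
  rw [← cancel_epi ((quotientCompQhIso (ModuleCat.{0} Λ)).hom.app P), ← this]
  simp

lemma isKProjective_of {P : CochainComplex (ModuleCat.{0} Λ) ℤ} {b : ℤ}
    (h1 : ∀ n : ℤ, Projective (P.X n)) (h3 : ∀ n : ℤ, b < n → IsZero (P.X n)) :
    P.IsKProjective := by
  have : P.IsStrictlyLE b := by
    rw [CochainComplex.isStrictlyLE_iff]
    intro i hi
    exact h3 i hi
  exact CochainComplex.isKProjective_of_projective P b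

lemma PerfIn.hom_zero {X Y : DerivedCategory (ModuleCat.{0} Λ)} {a b c : ℤ} (hX : PerfIn X a b)
    (hY : Y.IsLE c) (hc : c < a) (f : X ⟶ Y) : f = 0 := by
  obtain ⟨P, h1, h2, h3, ⟨e⟩⟩ := hX
  obtain ⟨K, hK, ⟨e'⟩⟩ := exists_iso_Q_obj_of_isLE Y c
  have := isKProjective_of h1 (fun n hn => h3 n (Or.inr hn))
  obtain ⟨g, hg⟩ := Q_lift (e.hom ≫ f ≫ e'.hom)
  have : g = 0 := by
    ext1 n
    by_cases hn : n < a
    · exact (h3 n (Or.inl hn)).eq_of_src _ _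
    · exact (K.isZero_of_isStrictlyLE c n (by lia)).eq_of_tgt _ _
  rw [← cancel_epi e.hom, ← cancel_mono e'.hom, Category.assoc, ← hg, this]
  simp

lemma PerfIn.of_iso {X Y : DerivedCategory (ModuleCat.{0} Λ)} {a b : ℤ} (hX : PerfIn X a b)
    (e : X ≅ Y) : PerfIn Y a b := by
  obtain ⟨P, h1, h2, h3, ⟨e'⟩⟩ := hX
  exact ⟨P, h1, h2, h3, ⟨e' ≪≫ e⟩⟩

lemma PerfIn.shift {X : DerivedCategory (ModuleCat.{0} Λ)} {a b : ℤ} (hX : PerfIn X a b)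
    (n a' b' : ℤ) (ha : a' + n = a) (hb : b' + n = b) :
    PerfIn (X⟦n⟧) a' b' := by
  obtain ⟨P, h1, h2, h3, ⟨e⟩⟩ := hX
  refine ⟨P⟦n⟧, fun i => h1 _, fun i => h2 _, fun i hi => h3 (i + n) (by lia), ⟨?_⟩⟩
  exact (Q.commShiftIso n).app P ≪≫ (shiftFunctor _ n).mapIso e

lemma PerfIn.isLE {X : DerivedCategory (ModuleCat.{0} Λ)} {a b : ℤ} (hX : PerfIn X a b) :
    X.IsLE b := by
  obtain ⟨P, h1, h2, h3, ⟨e⟩⟩ := hX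
  have : P.IsStrictlyLE b := by
    rw [CochainComplex.isStrictlyLE_iff]
    intro i hi
    exact h3 i (Or.inr hi)
  exact TStructure.t.isLE_of_iso e b

lemma perfIn_single (N : ModuleCat.{0} Λ) [hp : Projective N] [hf : Module.Finite Λ N] (n : ℤ) :
    PerfIn ((singleFunctor _ n).obj N) n n := by
  refine ⟨(CochainComplex.singleFunctor _ n).obj N, fun i => ?_, fun i => ?_, fun i hi => ?_,
    ⟨((singleFunctorIsoCompQ _ n).app N).symm⟩⟩
  · by_cases h : i = n
    · subst h
      exact Projective.of_iso (HomologicalComplex.singleObjXSelf (.up ℤ) i N).symm hp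
    · exact Projective.of_iso (IsZero.isoZero
        (HomologicalComplex.isZero_single_obj_X (.up ℤ) n N i h)).symm inferInstance
  · by_cases h : i = n
    · subst h
      exact Module.Finite.equiv (HomologicalComplex.singleObjXSelf (.up ℤ) i N).symm.toLinearEquiv
    · have := ModuleCat.subsingleton_of_isZero
        (HomologicalComplex.isZero_single_obj_X (.up ℤ) n N i h)
      exact @Module.Finite.of_finite _ _ _ _ _ (@Finite.of_subsingleton _ this)
  · exact HomologicalComplex.isZero_single_obj_X (.up ℤ) n N i (by lia)

lemma perf_cone {T : Triangle (DerivedCategory (ModuleCat.{0} Λ))}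
    (hT : T ∈ distTriang _) (h₁ : IsPerfectObj Λ T.obj₁) (h₂ : IsPerfectObj Λ T.obj₂) :
    IsPerfectObj Λ T.obj₃ := by
  obtain ⟨P, a, b, p1, p2, p3, ⟨e⟩⟩ := h₁
  obtain ⟨R, c, d, r1, r2, r3, ⟨e'⟩⟩ := h₂
  have := isKProjective_of p1 (fun n hn => p3 n (Or.inr hn))
  obtain ⟨g, hg⟩ := Q_lift (e.hom ≫ T.mor₁ ≫ e'.inv)
  have iso : ∀ n, (CochainComplex.mappingCone g).X n ≅ P.X (n+1) ⊞ R.X n := fun n =>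
    HomologicalComplex.homotopyCofiber.XIsoBiprod g n (n+1) (by simp)
  refine ⟨CochainComplex.mappingCone g, min (a - 1) c, max b d, fun n => ?_, fun n => ?_,
    fun n hn => ?_, ⟨?_⟩⟩
  · have := p1 (n+1)
    have := r1 n
    exact Projective.of_iso (iso n).symm inferInstance
  · have := p2 (n+1)
    have := r2 n
    exact Module.Finite.equiv (iso n ≪≫ ModuleCat.biprodIsoProd _ _).symm.toLinearEquiv
  · rw [CochainComplex.mappingCone.isZero_X_iff]
    exact ⟨p3 _ (by grind), r3 _ (by grind)⟩
  · exact Triangle.π₃.mapIso (isoTriangleOfIso₁₂ _ _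
      (DerivedCategory.mappingCone_triangle_distinguished g) hT e e' 
      (show Q.map g ≫ e'.hom = e.hom ≫ T.mor₁ by rw [hg]; simp))


lemma finite_of_exact [IsNoetherianRing Λ] {S : ShortComplex (ModuleCat.{0} Λ)} (hS : S.Exact)
    (_ : Module.Finite Λ S.X₁) (_ : Module.Finite Λ S.X₃) : Module.Finite Λ S.X₂ := by
  have h1 : Module.Finite Λ (LinearMap.ker S.g.hom) := by
    rw [← hS.moduleCat_range_eq_ker]
    infer_instance
  have h2 : Module.Finite Λ (S.X₂ ⧸ LinearMap.ker S.g.hom) :=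
    Module.Finite.equiv (S.g.hom.quotKerEquivRange).symm
  exact Module.Finite.of_submodule_quotient (LinearMap.ker S.g.hom)

lemma finite_of_isZero {N : ModuleCat.{0} Λ} (h : IsZero N) : Module.Finite Λ N := by
  have := ModuleCat.subsingleton_of_isZero h
  exact Module.Finite.of_finite

def homSingle (N : ModuleCat.{0} Λ) (n : ℤ) :
    (homologyFunctor _ n).obj ((singleFunctor _ n).obj N) ≅ N :=
  (singleFunctorCompHomologyFunctorIso (ModuleCat.{0} Λ) n).app N

lemma finite_single (N : ModuleCat.{0} Λ) [Module.Finite Λ N] (n m : ℤ) :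
    Module.Finite Λ ((homologyFunctor (ModuleCat.{0} Λ) m).obj ((singleFunctor (ModuleCat.{0} Λ) n).obj N)) := by
  rcases lt_trichotomy m n with h | h | h
  · exact finite_of_isZero (isZero_of_isGE _ n m h)
  · subst h
    exact Module.Finite.equiv (homSingle N m).symm.toLinearEquiv
  · exact finite_of_isZero (isZero_of_isLE _ n m h)

lemma isBoundedFG_single (N : ModuleCat.{0} Λ) [Module.Finite Λ N] (n : ℤ) :
    IsBoundedFG Λ ((singleFunctor _ n).obj N) := by
  refine ⟨(Set.finite_singleton n).subset ?_, fun m => finite_single N n m⟩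
  intro m hm
  rcases lt_trichotomy m n with h | h | h
  · exact absurd (isZero_of_isGE _ n m h) hm
  · exact h
  · exact absurd (isZero_of_isLE _ n m h) hm

lemma IsBoundedFG.bounds {M : DerivedCategory (ModuleCat.{0} Λ)} (h : IsBoundedFG Λ M) :
    ∃ a b : ℤ, M.IsGE a ∧ M.IsLE b := by
  obtain ⟨a, ha⟩ := h.1.bddBelow
  obtain ⟨b, hb⟩ := h.1.bddAbove
  refine ⟨a, b, ?_, ?_⟩
  · rw [isGE_iff]
    intro i hi
    by_contra hc
    exact absurd (ha hc) (by lia)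
  · rw [isLE_iff]
    intro i hi
    by_contra hc
    exact absurd (hb hc) (by lia)

/-- Approximation step: kill the top cohomology by a free module. -/
lemma step [IsNoetherianRing Λ] (M : DerivedCategory (ModuleCat.{0} Λ)) (b : ℤ) (hb : M.IsLE b)
    (hf : ∀ n, Module.Finite Λ ((homologyFunctor (ModuleCat.{0} Λ) n).obj M)) :
    ∃ (F : ModuleCat.{0} Λ) (_ : Projective F) (_ : Module.Finite Λ F)
      (C : DerivedCategory (ModuleCat.{0} Λ))
      (f : (singleFunctor _ b).obj F ⟶ M) (g : M ⟶ C)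
      (h : C ⟶ ((singleFunctor _ b).obj F)⟦(1 : ℤ)⟧),
      Triangle.mk f g h ∈ distTriang _ ∧ C.IsLE (b - 1) ∧
      (∀ e : ℤ, e ≤ b - 1 → M.IsGE e → C.IsGE e) ∧
      (∀ n, Module.Finite Λ ((homologyFunctor (ModuleCat.{0} Λ) n).obj C)) := by
  obtain ⟨A, B, hA, hB, i, p, d, hT⟩ := TStructure.t.exists_triangle M (b - 1) b (by lia)
  have hA' : A.IsLE (b - 1) := ⟨hA⟩
  have hB' : B.IsGE b := ⟨hB⟩
  have hBle : B.IsLE b := by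
    rw [isLE_iff]
    intro n hn
    exact (HomologySequence.exact₃ _ hT n (n + 1) rfl).isZero_X₂
      ((isZero_of_isLE M b n hn).eq_of_src _ _)
      ((isZero_of_isLE A (b - 1) (n + 1) (by lia)).eq_of_tgt _ _)
  obtain ⟨N, ⟨eN⟩⟩ := exists_iso_singleFunctor_obj_of_isGE_of_isLE B b
  have hmono : Mono ((homologyFunctor _ b).map p) := by
    have := HomologySequence.mono_homologyMap_mor₂_iff _ hT b
    exact this.2 ((isZero_of_isLE A (b - 1) b (by lia)).eq_of_src _ _)
  have hepi : Epi ((homologyFunctor _ b).map p) := by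
    have := HomologySequence.epi_homologyMap_mor₂_iff _ hT b (b + 1) rfl
    exact this.2 ((isZero_of_isLE A (b - 1) (b + 1) (by lia)).eq_of_tgt _ _)
  have hiso : IsIso ((homologyFunctor _ b).map p) := isIso_of_mono_of_epi _
  have hN : Module.Finite Λ N := by
    have := hf b
    exact Module.Finite.equiv (asIso ((homologyFunctor _ b).map p) ≪≫
      (homologyFunctor _ b).mapIso eN ≪≫ homSingle N b).toLinearEquiv
  obtain ⟨r, π, hπ⟩ := Module.Finite.exists_fin' Λ N
  let F : ModuleCat.{0} Λ := ModuleCat.of Λ (Fin r → Λ)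
  have hFp : Projective F := by
    exact (IsProjective.iff_projective (R := Λ) (Fin r → Λ)).1 inferInstance
  have hFf : Module.Finite Λ F := by
    change Module.Finite Λ (Fin r → Λ)
    infer_instance
  let q : F ⟶ N := ModuleCat.ofHom π
  have hq : Epi q := (ModuleCat.epi_iff_surjective _).2 hπ
  have hP := perfIn_single F b
  obtain ⟨f, hff⟩ : ∃ f : (singleFunctor _ b).obj F ⟶ M,
      (singleFunctor _ b).map q ≫ eN.inv = f ≫ p := Triangle.coyoneda_exact₃ _ hT ((singleFunctor _ b).map q ≫ eN.inv) (by
    have : (A⟦(1 : ℤ)⟧).IsLE (b - 2) := TStructure.t.isLE_shift A (b - 1) 1 (b - 2) (by lia)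
    exact hP.hom_zero this (by lia) _)
  have hfe : Epi ((homologyFunctor _ b).map f) := by
    have h1 : (homologyFunctor _ b).map f ≫ (homologyFunctor _ b).map p =
        (homologyFunctor _ b).map ((singleFunctor _ b).map q) ≫
          (homologyFunctor _ b).map eN.inv := by
      rw [← Functor.map_comp, ← Functor.map_comp]
      exact congrArg _ hff.symm
    have h2 : Epi ((homologyFunctor _ b).map ((singleFunctor (ModuleCat.{0} Λ) b).map q)) := by
      have := NatIso.naturality_2 (singleFunctorCompHomologyFunctorIso (ModuleCat.{0} Λ) b) q
      dsimp at this
      rw [← this]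
      infer_instance
    have h3 : (homologyFunctor _ b).map f = ((homologyFunctor _ b).map
        ((singleFunctor _ b).map q) ≫ (homologyFunctor _ b).map eN.inv) ≫
          inv ((homologyFunctor _ b).map p) := by
      rw [← h1]; simp
    rw [h3]
    infer_instance
  obtain ⟨C, g, h, hT'⟩ := distinguished_cocone_triangle f
  refine ⟨F, hFp, hFf, C, f, g, h, hT', ?_, ?_, ?_⟩
  · rw [isLE_iff]
    intro n hn
    refine (HomologySequence.exact₃ _ hT' n (n + 1) rfl).isZero_X₂ ?_
      ((isZero_of_isLE ((singleFunctor (ModuleCat.{0} Λ) b).obj F) b (n + 1) (by lia)).eq_of_tgt _ _)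
    by_cases hnb : n = b
    · subst hnb
      exact (HomologySequence.epi_homologyMap_mor₁_iff _ hT' n).1 hfe
    · exact (isZero_of_isLE M b n (by lia)).eq_of_src _ _
  · intro e he hM
    rw [isGE_iff]
    intro n hn
    exact (HomologySequence.exact₃ _ hT' n (n + 1) rfl).isZero_X₂
      ((isZero_of_isGE M e n hn).eq_of_src _ _)
      ((isZero_of_isGE ((singleFunctor (ModuleCat.{0} Λ) b).obj F) b (n + 1) (by lia)).eq_of_tgt _ _)
  · intro n
    exact finite_of_exact (HomologySequence.exact₃ _ hT' n (n + 1) rfl)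
      (hf n) (finite_single F b (n + 1))

def singleShift (X : ModuleCat.{0} Λ) (i n : ℤ) (h : i + n = 0) :
    ((singleFunctor (ModuleCat.{0} Λ) 0).obj X)⟦i⟧ ≅ (singleFunctor (ModuleCat.{0} Λ) n).obj X :=
  ((singleFunctors (ModuleCat.{0} Λ)).shiftIso i n 0 h).app X

lemma perf_of_vanish [IsNoetherianRing Λ] (l : ℕ) : ∀ (e b : ℤ)
    (M : DerivedCategory (ModuleCat.{0} Λ)), e + l = b → M.IsGE e → M.IsLE b →
    (∀ n, Module.Finite Λ ((homologyFunctor (ModuleCat.{0} Λ) n).obj M)) →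
    (∀ (X : ModuleCat.{0} Λ), Module.Finite Λ X → ∀ (i : ℤ), -e < i →
      ∀ f : M ⟶ ((singleFunctor (ModuleCat.{0} Λ) 0).obj X)⟦i⟧, f = 0) → IsPerfectObj Λ M := by
  induction l with
  | zero =>
    intro e b M hl hge hle hf hv
    obtain rfl : e = b := by simpa using hl
    obtain ⟨F, hFp, hFf, C, f, g, h, hT, hC1, hC2, hC3⟩ := step M e hle hf
    have : C.IsGE (e - 1) := hC2 (e - 1) le_rfl (TStructure.t.isGE_of_ge M (e - 1) e)
    obtain ⟨K, ⟨eK⟩⟩ := exists_iso_singleFunctor_obj_of_isGE_of_isLE C (e - 1)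
    have hK : Module.Finite Λ K := by
      have := hC3 (e - 1)
      exact Module.Finite.equiv
        ((homologyFunctor _ (e - 1)).mapIso eK ≪≫ homSingle K (e - 1)).toLinearEquiv
    let sK := singleShift K (1 - e) (e - 1) (by lia)
    have hg : g = 0 := by
      have := hv K hK (1 - e) (by lia) (g ≫ eK.hom ≫ sK.inv)
      rw [← cancel_mono (eK.hom ≫ sK.inv), this, zero_comp]
    obtain ⟨s, hs⟩ : ∃ s : M ⟶ (singleFunctor _ e).obj F, 𝟙 M = s ≫ f :=
      Triangle.coyoneda_exact₂ _ hT (𝟙 M) (by subst hg; exact comp_zero)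
    let R : Retract M ((singleFunctor _ e).obj F) := ⟨s, f, hs.symm⟩
    obtain ⟨N, ⟨eN⟩⟩ := exists_iso_singleFunctor_obj_of_isGE_of_isLE M e
    have hN : Module.Finite Λ N := by
      have := hf e
      exact Module.Finite.equiv
        ((homologyFunctor _ e).mapIso eN ≪≫ homSingle N e).toLinearEquiv
    have R2 : Retract N F := (Retract.ofIso ((homologyFunctor _ e).mapIso eN ≪≫
      homSingle N e).symm).trans ((R.map (homologyFunctor _ e)).trans
        (Retract.ofIso (homSingle F e)))
    have hNp : Projective N := R2.projective
    exact (isPerfectObj_iff M).2 ⟨e, e, (perfIn_single N e).of_iso eN.symm⟩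
  | succ l ih =>
    intro e b M hl hge hle hf hv
    push_cast at hl
    obtain ⟨F, hFp, hFf, C, f, g, h, hT, hC1, hC2, hC3⟩ := step M b hle hf
    have hFP := perfIn_single F b
    have hC : IsPerfectObj Λ C := by
      refine ih e (b - 1) C (by lia) (hC2 e (by lia) hge) hC1 hC3 ?_
      intro X hX i hi u
      obtain ⟨v, hv'⟩ : ∃ v : ((singleFunctor _ b).obj F)⟦(1 : ℤ)⟧ ⟶ _, u = h ≫ v :=
        Triangle.yoneda_exact₃ _ hT u (hv X hX i hi (g ≫ u))
      have hle' : (((singleFunctor (ModuleCat.{0} Λ) 0).obj X)⟦i⟧).IsLE (-i) :=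
        TStructure.t.isLE_shift _ 0 i (-i) (by lia)
      have hv0 : v = 0 := (hFP.shift 1 (b - 1) (b - 1) (by lia) (by lia)).hom_zero hle' (by lia) v
      rw [hv', hv0, comp_zero]
    obtain ⟨a', b', hC'⟩ := (isPerfectObj_iff C).1 hC
    exact perf_cone (inv_rot_of_distTriang _ hT)
      ((isPerfectObj_iff _).2 ⟨_, _, hC'.shift (-1) (a' + 1) (b' + 1) (by lia) (by lia)⟩)
      ((isPerfectObj_iff _).2 ⟨_, _, hFP⟩)

lemma vanish_of_ses {S : ShortComplex (ModuleCat.{0} Λ)} (hS : S.ShortExact)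
    (M : DerivedCategory (ModuleCat.{0} Λ)) (i : ℤ)
    (h₁ : ∀ f : M ⟶ ((singleFunctor (ModuleCat.{0} Λ) 0).obj S.X₁)⟦i⟧, f = 0)
    (h₃ : ∀ f : M ⟶ ((singleFunctor (ModuleCat.{0} Λ) 0).obj S.X₃)⟦i⟧, f = 0)
    (f : M ⟶ ((singleFunctor (ModuleCat.{0} Λ) 0).obj S.X₂)⟦i⟧) : f = 0 := by
  have hT := Triangle.shift_distinguished _ hS.singleTriangle_distinguished i
  obtain ⟨g, hg⟩ := Triangle.coyoneda_exact₂ _ hT f (h₃ _)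
  rw [hg, show g = 0 from h₁ g]
  exact zero_comp

lemma vanish_of_retract {X Y : ModuleCat.{0} Λ} (r : Retract X Y)
    (M : DerivedCategory (ModuleCat.{0} Λ)) (i : ℤ)
    (h : ∀ f : M ⟶ ((singleFunctor (ModuleCat.{0} Λ) 0).obj Y)⟦i⟧, f = 0)
    (f : M ⟶ ((singleFunctor (ModuleCat.{0} Λ) 0).obj X)⟦i⟧) : f = 0 := by
  have r' := (r.map (singleFunctor (ModuleCat.{0} Λ) 0)).map (shiftFunctor _ i)
  rw [← Category.comp_id f, ← r'.retract, ← Category.assoc, h (f ≫ r'.i), zero_comp]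

lemma isSemisimple_quot [IsArtinianRing Λ] :
    IsSemisimpleModule Λ (Λ ⧸ Ring.jacobson Λ) := by
  let l : (Λ ⧸ Ring.jacobson Λ) →ₛₗ[Ideal.Quotient.mk (Ring.jacobson Λ)] (Λ ⧸ Ring.jacobson Λ) :=
    { toFun := id
      map_add' := fun _ _ => rfl
      map_smul' := fun a x => by
        obtain ⟨y, rfl⟩ := Ideal.Quotient.mk_surjective x
        rfl }
  have : RingHomSurjective (Ideal.Quotient.mk (Ring.jacobson Λ)) :=
    ⟨Ideal.Quotient.mk_surjective⟩
  exact (l.isSemisimpleModule_iff_of_bijective Function.bijective_id).2 inferInstance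

lemma simple_retract [IsArtinianRing Λ] (X : Type) [AddCommGroup X] [Module Λ X]
    [IsSimpleModule Λ X] :
    Nonempty (Retract (ModuleCat.of Λ X) (ModuleCat.of Λ (Λ ⧸ Ring.jacobson Λ))) := by
  have := isSemisimple_quot (Λ := Λ)
  have := IsSimpleModule.nontrivial Λ X
  obtain ⟨x, hx⟩ := exists_ne (0 : X)
  let p : (Λ ⧸ Ring.jacobson Λ) →ₗ[Λ] X :=
    Submodule.liftQ (Ring.jacobson Λ) (LinearMap.toSpanSingleton Λ X x)
      (fun r hr => by
        have := IsSemisimpleModule.jacobson_le_annihilator Λ X hr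
        simpa using Module.mem_annihilator.1 this x)
  have hp : Function.Surjective p := by
    refine (LinearMap.surjective_or_eq_zero p).resolve_right fun h => hx ?_
    have h1 := LinearMap.congr_fun h (Submodule.Quotient.mk 1)
    exact (one_smul Λ x).symm.trans h1
  obtain ⟨s, hs⟩ := IsSemisimpleModule.lifting_property p hp LinearMap.id
  exact ⟨⟨ModuleCat.ofHom s, ModuleCat.ofHom p, by rw [← ModuleCat.ofHom_comp, hs]; rfl⟩⟩

lemma vanish_all [IsArtinianRing Λ] (M : DerivedCategory (ModuleCat.{0} Λ)) (i : ℤ)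
    (h : ∀ f : M ⟶ ((singleFunctor (ModuleCat.{0} Λ) 0).obj
      (ModuleCat.of Λ (Λ ⧸ Ring.jacobson Λ)))⟦i⟧, f = 0)
    (X : Type) [AddCommGroup X] [Module Λ X] (hX : IsFiniteLength Λ X) :
    ∀ f : M ⟶ ((singleFunctor (ModuleCat.{0} Λ) 0).obj (ModuleCat.of Λ X))⟦i⟧, f = 0 := by
  induction hX with
  | @of_subsingleton X _ _ _ =>
    intro f
    have h0 : IsZero (ModuleCat.of Λ X) := ModuleCat.isZero_of_subsingleton _
    exact ((shiftFunctor _ i).map_isZero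
      ((singleFunctor (ModuleCat.{0} Λ) 0).map_isZero h0)).eq_of_tgt _ _
  | @of_simple_quotient X _ _ N _ _ ih =>
    obtain ⟨r⟩ := simple_retract (Λ := Λ) (X ⧸ N)
    let S : ShortComplex (ModuleCat.{0} Λ) := ShortComplex.mk (ModuleCat.ofHom N.subtype)
      (ModuleCat.ofHom N.mkQ) (by ext x; simp)
    have hS : S.ShortExact :=
      { exact := (ShortComplex.moduleCat_exact_iff_range_eq_ker S).2 (by simp [S])
        mono_f := (ModuleCat.mono_iff_injective _).2 N.subtype_injective
        epi_g := (ModuleCat.epi_iff_surjective _).2 N.mkQ_surjective }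
    exact vanish_of_ses hS M i ih (vanish_of_retract r M i h)

end Helpers

theorem statement_2 (k : Type) [Field k] [IsAlgClosed k]
    (Λ : Type) [Ring Λ] [Algebra k Λ] [FiniteDimensional k Λ]
    [HasDerivedCategory (ModuleCat.{0} Λ)]
    (M : DerivedCategory (ModuleCat.{0} Λ)) (hM : IsBoundedFG Λ M) :
    IsPerfectObj Λ M ↔
      ∀ D' : DerivedCategory (ModuleCat.{0} Λ), IsBoundedFG Λ D' →
        {i : ℤ | ∃ f : M ⟶ D'⟦i⟧, f ≠ 0}.Finite := by
  have hArt : IsArtinianRing Λ := IsArtinianRing.of_finite k Λ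
  constructor
  · intro hP D' hD'
    obtain ⟨a, b, hP⟩ := (isPerfectObj_iff M).1 hP
    obtain ⟨c, d, hc, hd⟩ := hD'.bounds
    have hb := hP.isLE
    refine (Set.finite_Icc (c - b) (d - a)).subset ?_
    rintro i ⟨f, hf⟩
    rw [Set.mem_Icc]
    refine ⟨?_, ?_⟩
    · by_contra hi
      have : (D'⟦i⟧).IsGE (c - i) := TStructure.t.isGE_shift D' c i (c - i) (by lia)
      exact hf (TStructure.t.zero f b (c - i) (by lia))
    · by_contra hi
      exact hf (hP.hom_zero (TStructure.t.isLE_shift D' d i (d - i) (by lia)) (by lia) f)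
  · intro h
    obtain ⟨a, b, ha, hb⟩ := hM.bounds
    have hfin : Module.Finite Λ (ModuleCat.of Λ (Λ ⧸ Ring.jacobson Λ)) := by
      change Module.Finite Λ (Λ ⧸ Ring.jacobson Λ)
      infer_instance
    obtain ⟨d, hd⟩ := (h _ (isBoundedFG_single
      (ModuleCat.of Λ (Λ ⧸ Ring.jacobson Λ)) 0)).bddAbove
    have hv : ∀ (X : ModuleCat.{0} Λ), Module.Finite Λ X → ∀ (i : ℤ), d < i →
        ∀ f : M ⟶ ((singleFunctor (ModuleCat.{0} Λ) 0).obj X)⟦i⟧, f = 0 := by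
      intro X hX i hi
      refine vanish_all M i ?_ X (isFiniteLength_iff_isNoetherian_isArtinian.2
        ⟨inferInstance, inferInstance⟩)
      intro f
      by_contra hf
      exact absurd (hd ⟨f, hf⟩) (by lia)
    let e := min a (min b (-d))
    refine perf_of_vanish (b - e).toNat e b M (by lia) (TStructure.t.isGE_of_ge M e a) hb hM.2
      (fun X hX i hi => hv X hX i (by lia))

end
end

section
/- For every finite poset P there exists a finite-dimensional hereditary algebra Λ over k such that P embeds as an induced subposet of the 1-spherelike poset P_1(D^b(Λ)) (the set of spherical subcategories of indecomposable 1-spherelike objects, ordered by inclusion). -/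
/-!
STATEMENT 10: For every finite poset P there exists a finite-dimensional hereditary
algebra Λ over k such that P embeds as an induced subposet of the 1-spherelike poset
P₁(D^b(Λ)) (spherical subcategories of indecomposable 1-spherelike objects with Serre
dual, ordered by inclusion).

D^b(mod Λ) is modelled as the class of objects of `DerivedCategory (ModuleCat Λ)`
with bounded finitely generated cohomology.
-/

open CategoryTheory Limits Pretriangulated

noncomputable section

namespace SpherePaper

variable (k : Type) [Field k]

/-- `F` is a `d`-spherelike object: `Hom^•(F,F) ≅ k ⊕ k[-d]`. -/
def IsSpherelikeObj {D : Type*} [Category D] [Preadditive D]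
    [CategoryTheory.Linear k D] [HasShift D ℤ] (d : ℤ) (F : D) : Prop :=
  ∀ i : ℤ, Module.finrank k (F ⟶ F⟦i⟧) =
    (if i = 0 then 1 else 0) + (if i = d then 1 else 0)

/-- `F` is indecomposable: it is nonzero and its endomorphism ring is local. -/
def IndecomposableObj {D : Type*} [Category D] [Preadditive D] (F : D) : Prop :=
  ¬ IsZero F ∧ ∀ f : F ⟶ F, IsIso f ∨ IsIso (𝟙 F - f)

/-- Serre dual data for the object `F`, relative to a class `B` of objects. -/
structure SerreDualOn {D : Type*} [Category D] [Preadditive D]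
    [CategoryTheory.Linear k D] (B : Set D) (F SF : D) where
  φ : ∀ Y : D, Y ∈ B → ((F ⟶ Y) ≃ₗ[k] Module.Dual k (Y ⟶ SF))
  natY : ∀ (Y Y' : D) (hY : Y ∈ B) (hY' : Y' ∈ B) (g : Y ⟶ Y') (f : F ⟶ Y)
      (h : Y' ⟶ SF), φ Y' hY' (f ≫ g) h = φ Y hY f (g ≫ h)

/-- The spherical subcategory determined by the asphericality object `Q`,
inside the class `B` of objects. -/
def sphericalSubcatOn {D : Type*} [Category D] [Limits.HasZeroMorphisms D]
    [HasShift D ℤ] (B : Set D) (Q : D) : Set D :=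
  { X | X ∈ B ∧ ∀ (i : ℤ) (f : X ⟶ Q⟦i⟧), f = 0 }

/-- The `d`-spherelike poset of the triangulated category given by the class `B`
of objects of `D`: spherical subcategories of indecomposable `d`-spherelike
objects possessing a Serre dual, ordered by inclusion. -/
def dSpherelikePosetOn {D : Type*} [Category D] [Preadditive D]
    [CategoryTheory.Linear k D] [HasShift D ℤ] [HasZeroObject D]
    [∀ n : ℤ, (shiftFunctor D n).Additive] [Pretriangulated D]
    (B : Set D) (d : ℤ) : Set (Set D) :=
  { U | ∃ (F SF Q : D) (_ : SerreDualOn k B F SF) (w : F ⟶ SF⟦-d⟧)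
        (u : SF⟦-d⟧ ⟶ Q) (v : Q ⟶ F⟦(1:ℤ)⟧),
      F ∈ B ∧ SF ∈ B ∧ Q ∈ B ∧
      IsSpherelikeObj k d F ∧ IndecomposableObj F ∧ w ≠ 0 ∧
      (Triangle.mk w u v ∈ distTriang D) ∧ U = sphericalSubcatOn B Q }

/-- An object of the derived category of `Λ`-modules lies in `D^b(mod Λ)`. -/
def IsBoundedFG (Λ : Type) [Ring Λ] [HasDerivedCategory (ModuleCat.{0} Λ)]
    (X : DerivedCategory (ModuleCat.{0} Λ)) : Prop :=
  {n : ℤ | ¬ IsZero ((DerivedCategory.homologyFunctor (ModuleCat.{0} Λ) n).obj X)}.Finite ∧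
  ∀ n : ℤ, Module.Finite Λ ((DerivedCategory.homologyFunctor (ModuleCat.{0} Λ) n).obj X)

/-- `Λ` is hereditary: `Ext^i` vanishes for `i ≥ 2`. -/
def IsHereditaryAlg (Λ : Type) [Ring Λ] : Prop :=
  ∀ (M N : ModuleCat.{0} Λ) (i : ℕ), 2 ≤ i →
    Subsingleton (((_root_.Ext ℤ (ModuleCat.{0} Λ) i).obj (Opposite.op M)).obj N)

/-- A finite-dimensional `k`-algebra together with (a choice of) its derived
category and the `k`-linear structure on it. -/
structure AlgebraSetup (k : Type) [Field k] : Type 2 where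
  carrier : Type
  [ring : Ring carrier]
  [alg : Algebra k carrier]
  [findim : FiniteDimensional k carrier]
  [hdc : HasDerivedCategory.{1} (ModuleCat.{0} carrier)]
  [lin : CategoryTheory.Linear k (DerivedCategory (ModuleCat.{0} carrier))]

attribute [instance] AlgebraSetup.ring AlgebraSetup.alg AlgebraSetup.findim
  AlgebraSetup.hdc AlgebraSetup.lin

/-- The `d`-spherelike poset `P_d(D^b(Λ))`. -/
def dSpherelikePosetAlg (Λ : AlgebraSetup k) (d : ℤ) :
    Set (Set (DerivedCategory (ModuleCat.{0} Λ.carrier))) :=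
  dSpherelikePosetOn k {X | IsBoundedFG Λ.carrier X} d

section PartA
universe w v u
variable {C : Type u} [Category.{v} C] [Abelian C] [HasDerivedCategory.{w} C]

open DerivedCategory

instance isKProjective_single (P : C) [Projective P] (n : ℤ) :
    ((CochainComplex.singleFunctor C n).obj P).IsKProjective := by
  have : ∀ i : ℤ, Projective (((CochainComplex.singleFunctor C n).obj P).X i) := by
    intro i
    by_cases h : i = n
    · subst h
      exact Projective.of_iso
        (HomologicalComplex.singleObjXSelf (ComplexShape.up ℤ) i P).symm inferInstance
    · exact (HomologicalComplex.isZero_single_obj_X (ComplexShape.up ℤ) n P i h).projective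
  exact CochainComplex.isKProjective_of_projective _ n

instance isKInjective_single (P : C) [Injective P] (n : ℤ) :
    ((CochainComplex.singleFunctor C n).obj P).IsKInjective := by
  have : ∀ i : ℤ, Injective (((CochainComplex.singleFunctor C n).obj P).X i) := by
    intro i
    by_cases h : i = n
    · subst h
      exact Injective.of_iso
        (HomologicalComplex.singleObjXSelf (ComplexShape.up ℤ) i P).symm inferInstance
    · exact (HomologicalComplex.isZero_single_obj_X (ComplexShape.up ℤ) n P i h).injective
  exact CochainComplex.isKInjective_of_injective _ n

/-- The single complex. -/
abbrev sgl (P : C) (n : ℤ) : CochainComplex C ℤ :=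
  (HomologicalComplex.single C (ComplexShape.up ℤ) n).obj P

lemma exists_Q_map_of_KProjective (L K : CochainComplex C ℤ) [L.IsKProjective]
    (x : Q.obj L ⟶ Q.obj K) : ∃ ψ : L ⟶ K, x = Q.map ψ := by
  obtain ⟨y, hy⟩ := (CochainComplex.IsKProjective.Qh_map_bijective
    L ((HomotopyCategory.quotient _ _).obj K)).2
      ((quotientCompQhIso C).hom.app _ ≫ x ≫ (quotientCompQhIso C).inv.app K)
  obtain ⟨ψ, rfl⟩ := (HomotopyCategory.quotient _ _).map_surjective y
  refine ⟨ψ, ?_⟩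
  have := quotientCompQhIso_hom_naturality ψ
  rw [hy] at this
  rw [← cancel_epi ((quotientCompQhIso C).hom.app _), ← this]
  have h2 := (quotientCompQhIso C).inv_hom_id_app K
  simp only [Category.assoc]
  exact (congrArg (fun t => (quotientCompQhIso C).hom.app L ≫ x ≫ t) h2).trans
    (by simp) |>.symm

lemma exists_Q_map_of_KInjective (L K : CochainComplex C ℤ) [L.IsKInjective]
    (x : Q.obj K ⟶ Q.obj L) : ∃ ψ : K ⟶ L, x = Q.map ψ := by
  obtain ⟨y, hy⟩ := (CochainComplex.IsKInjective.Qh_map_bijective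
    ((HomotopyCategory.quotient _ _).obj K) L).2
      ((quotientCompQhIso C).hom.app _ ≫ x ≫ (quotientCompQhIso C).inv.app _)
  obtain ⟨ψ, rfl⟩ := (HomotopyCategory.quotient _ _).map_surjective y
  refine ⟨ψ, ?_⟩
  have := quotientCompQhIso_hom_naturality ψ
  rw [hy] at this
  rw [← cancel_epi ((quotientCompQhIso C).hom.app _), ← this]
  have h2 := (quotientCompQhIso C).inv_hom_id_app L
  simp only [Category.assoc]
  exact (congrArg (fun t => (quotientCompQhIso C).hom.app K ≫ x ≫ t) h2).trans
    (by simp) |>.symm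

lemma exists_Q_map_of_projective (P : C) [Projective P] (n : ℤ) (K : CochainComplex C ℤ)
    (x : Q.obj (sgl P n) ⟶ Q.obj K) : ∃ ψ : sgl P n ⟶ K, x = Q.map ψ := by
  have : (sgl P n).IsKProjective := isKProjective_single P n
  exact exists_Q_map_of_KProjective _ _ x

lemma exists_Q_map_of_injective (P : C) [Injective P] (n : ℤ) (K : CochainComplex C ℤ)
    (x : Q.obj K ⟶ Q.obj (sgl P n)) : ∃ ψ : K ⟶ sgl P n, x = Q.map ψ := by
  have : (sgl P n).IsKInjective := isKInjective_single P n
  exact exists_Q_map_of_KInjective _ _ x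

open CochainComplex.HomComplex in
lemma Q_map_eq_zero_of_coboundary {K L : CochainComplex C ℤ} (ψ : K ⟶ L)
    (z : Cochain K L (-1)) (hz : Cochain.ofHom ψ = δ (-1) 0 z) :
    (Q.map ψ : Q.obj K ⟶ Q.obj L) = 0 := by
  have : Homotopy ψ 0 := (Cochain.equivHomotopy ψ 0).symm ⟨z, by simpa using hz⟩
  rw [Q_map_eq_of_homotopy C this, Functor.map_zero]

/-- Comparison of homology of a complex and of its image in the derived category. -/
def hIso (K : CochainComplex C ℤ) (n : ℤ) :
    (homologyFunctor C n).obj (Q.obj K) ≅ K.homology n := (homologyFunctorFactors C n).app K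

lemma hIso_nat {K L : CochainComplex C ℤ} (ψ : K ⟶ L) (n : ℤ) :
    (homologyFunctor C n).map (Q.map ψ) ≫ (hIso L n).hom =
      (hIso K n).hom ≫ HomologicalComplex.homologyMap ψ n :=
  homologyFunctorFactors_hom_naturality ψ n

lemma homologyFunctor_map_Q_eq_zero_iff {K L : CochainComplex C ℤ} (ψ : K ⟶ L) (n : ℤ) :
    (homologyFunctor C n).map (Q.map ψ) = 0 ↔ HomologicalComplex.homologyMap ψ n = 0 := by
  rw [← cancel_mono (hIso L n).hom, hIso_nat, zero_comp]
  constructor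
  · intro h
    rwa [← cancel_epi (hIso K n).hom, comp_zero]
  · intro h
    rw [h, comp_zero]

open CochainComplex.HomComplex in
lemma Q_projective_faithful (P : C) [Projective P] (n : ℤ) {K : CochainComplex C ℤ}
    (ψ : sgl P n ⟶ K) (hx' : HomologicalComplex.homologyMap ψ n = 0) :
    (Q.map ψ : Q.obj (sgl P n) ⟶ Q.obj K) = 0 := by
  let e := HomologicalComplex.singleObjXSelf (ComplexShape.up ℤ) n P
  let f : P ⟶ K.X n := e.inv ≫ ψ.f n
  have hf : f ≫ K.d n (n+1) = 0 := by
    simp only [f, Category.assoc, ψ.comm, HomologicalComplex.single_obj_d, zero_comp, comp_zero]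
  have h1 : K.liftCycles f (n+1) (by simp) hf ≫ K.homologyπ n = 0 := by
    have : K.liftCycles f (n+1) (by simp) hf =
        (HomologicalComplex.singleObjCyclesSelfIso (ComplexShape.up ℤ) n P).inv ≫
           HomologicalComplex.cyclesMap ψ n := by
      rw [← cancel_mono (K.iCycles n)]
      simp [f, e]
    rw [this]
    simp [hx', ← HomologicalComplex.homologyπ_naturality]
  have hex : (ShortComplex.mk (K.toCycles (n-1) n) (K.homologyπ n) (by simp)).Exact :=
    ShortComplex.exact_of_g_is_cokernel _ (K.homologyIsCokernel (n-1) n (by simp))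
  let s : P ⟶ K.X (n-1) := hex.liftFromProjective _ h1
  have hs : s ≫ K.d (n-1) n = f := by
    have := hex.liftFromProjective_comp _ h1
    have := congr($this ≫ K.iCycles n)
    simpa using this
  refine Q_map_eq_zero_of_coboundary ψ
    (Cochain.single (p := n) (q := n-1) (e.hom ≫ s : (sgl P n).X n ⟶ K.X (n-1)) (-1)) ?_
  ext p
  by_cases hp : p = n
  · subst hp
    rw [δ_v (-1) 0 (by simp) _ p p (by simp) (p-1) (p+1) (by simp) (by simp),
      Cochain.single_v (e.hom ≫ s) (-1) (show p + -1 = p - 1 by ring)]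
    simp [hs, f, e]
  · exact (HomologicalComplex.isZero_single_obj_X (ComplexShape.up ℤ) n P p hp).eq_of_src _ _

open CochainComplex.HomComplex in
lemma Q_injective_faithful (P : C) [Injective P] (n : ℤ) {K : CochainComplex C ℤ}
    (ψ : K ⟶ sgl P n) (hx' : HomologicalComplex.homologyMap ψ n = 0) :
    (Q.map ψ : Q.obj K ⟶ Q.obj (sgl P n)) = 0 := by
  let e := HomologicalComplex.singleObjXSelf (ComplexShape.up ℤ) n P
  let f : K.X n ⟶ P := ψ.f n ≫ e.hom
  have hf : K.d (n-1) n ≫ f = 0 := by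
    simp only [f, ← ψ.comm_assoc, HomologicalComplex.single_obj_d, zero_comp, comp_zero]
  have h1 : K.homologyι n ≫ K.descOpcycles f (n-1) (by simp) hf = 0 := by
    have : K.descOpcycles f (n-1) (by simp) hf =
        HomologicalComplex.opcyclesMap ψ n ≫
        (HomologicalComplex.singleObjOpcyclesSelfIso (ComplexShape.up ℤ) n P).inv := by
      rw [← cancel_epi (K.pOpcycles n)]
      simp [f, e]
    rw [this]
    simp [hx', ← HomologicalComplex.homologyι_naturality_assoc]
  have hex : (ShortComplex.mk (K.homologyι n) (K.fromOpcycles n (n+1)) (by simp)).Exact :=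
    ShortComplex.exact_of_f_is_kernel _ (K.homologyIsKernel n (n+1) (by simp))
  let s : K.X (n+1) ⟶ P := hex.descToInjective _ h1
  have hs : K.d n (n+1) ≫ s = f := by
    have := hex.comp_descToInjective _ h1
    have := congr(K.pOpcycles n ≫ $this)
    simpa using this
  refine Q_map_eq_zero_of_coboundary ψ
    (Cochain.single (p := n+1) (q := n) (s ≫ e.inv : K.X (n+1) ⟶ (sgl P n).X n) (-1)) ?_
  ext p
  by_cases hp : p = n
  · subst hp
    rw [δ_v (-1) 0 (by simp) _ p p (by simp) (p-1) (p+1) (by simp) (by simp),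
      Cochain.single_v _ _ (by simp)]
    simp [reassoc_of% hs, f, e]
  · exact (HomologicalComplex.isZero_single_obj_X (ComplexShape.up ℤ) n P p hp).eq_of_tgt _ _

lemma Q_projective_full (P : C) [Projective P] (n : ℤ) {K : CochainComplex C ℤ}
    (f : (sgl P n).homology n ⟶ K.homology n) :
    ∃ ψ : sgl P n ⟶ K, HomologicalComplex.homologyMap ψ n = f := by
  let g : P ⟶ K.cycles n := Projective.factorThru
    ((HomologicalComplex.singleObjHomologySelfIso (ComplexShape.up ℤ) n P).inv ≫ f)
    (K.homologyπ n)
  have hg : g ≫ K.homologyπ n = _ := Projective.factorThru_comp _ _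
  let ψ : sgl P n ⟶ K := HomologicalComplex.mkHomFromSingle (g ≫ K.iCycles n) (by simp)
  refine ⟨ψ, ?_⟩
  have h1 : HomologicalComplex.cyclesMap ψ n =
      (HomologicalComplex.singleObjCyclesSelfIso (ComplexShape.up ℤ) n P).hom ≫ g := by
    rw [← cancel_mono (K.iCycles n), HomologicalComplex.cyclesMap_i]
    simp [ψ, HomologicalComplex.singleObjCyclesSelfIso_hom]
  rw [← cancel_epi (HomologicalComplex.homologyπ _ n), HomologicalComplex.homologyπ_naturality,
    h1, Category.assoc, hg]
  exact HomologicalComplex.singleObjHomologySelfIso_hom_singleObjHomologySelfIso_inv_assoc _ _ _ _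

lemma Q_injective_full (P : C) [Injective P] (n : ℤ) {K : CochainComplex C ℤ}
    (f : K.homology n ⟶ (sgl P n).homology n) :
    ∃ ψ : K ⟶ sgl P n, HomologicalComplex.homologyMap ψ n = f := by
  let g : K.opcycles n ⟶ P := Injective.factorThru
    (f ≫ (HomologicalComplex.singleObjHomologySelfIso (ComplexShape.up ℤ) n P).hom)
    (K.homologyι n)
  have hg : K.homologyι n ≫ g = _ := Injective.comp_factorThru _ _
  let ψ : K ⟶ sgl P n := HomologicalComplex.mkHomToSingle (K.pOpcycles n ≫ g) (by simp)
  refine ⟨ψ, ?_⟩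
  have h1 : HomologicalComplex.opcyclesMap ψ n =
      g ≫ (HomologicalComplex.singleObjOpcyclesSelfIso (ComplexShape.up ℤ) n P).hom := by
    rw [← cancel_epi (K.pOpcycles n), HomologicalComplex.p_opcyclesMap]
    simp [ψ, HomologicalComplex.singleObjOpcyclesSelfIso_hom]
  rw [← cancel_mono (HomologicalComplex.homologyι _ n), HomologicalComplex.homologyι_naturality,
    h1, reassoc_of% hg]
  simp

lemma projective_single_faithful (P : C) [Projective P] (n : ℤ) {Y : DerivedCategory C}
    (x : (singleFunctor C n).obj P ⟶ Y) (hx : (homologyFunctor C n).map x = 0) : x = 0 := by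
  change Q.obj (sgl P n) ⟶ Y at x
  change (x : Q.obj (sgl P n) ⟶ Y) = 0
  obtain ⟨K, ⟨e⟩⟩ : ∃ K, Nonempty (Q.obj K ≅ Y) := ⟨_, ⟨Q.objObjPreimageIso Y⟩⟩
  suffices h : x ≫ e.inv = 0 by exact (cancel_mono e.inv).1 (h.trans zero_comp.symm)
  have hx' : (homologyFunctor C n).map (x ≫ e.inv) = 0 := by
    rw [Functor.map_comp]
    exact (congrArg (· ≫ _) hx).trans zero_comp
  obtain ⟨ψ, hψ⟩ := exists_Q_map_of_projective P n K (x ≫ e.inv)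
  rw [hψ] at hx' ⊢
  rw [homologyFunctor_map_Q_eq_zero_iff] at hx'
  exact Q_projective_faithful P n ψ hx'

lemma injective_single_faithful (P : C) [Injective P] (n : ℤ) {Y : DerivedCategory C}
    (x : Y ⟶ (singleFunctor C n).obj P) (hx : (homologyFunctor C n).map x = 0) : x = 0 := by
  change Y ⟶ Q.obj (sgl P n) at x
  change (x : Y ⟶ Q.obj (sgl P n)) = 0
  obtain ⟨K, ⟨e⟩⟩ : ∃ K, Nonempty (Q.obj K ≅ Y) := ⟨_, ⟨Q.objObjPreimageIso Y⟩⟩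
  suffices h : e.hom ≫ x = 0 by exact (cancel_epi e.hom).1 (h.trans comp_zero.symm)
  have hx' : (homologyFunctor C n).map (e.hom ≫ x) = 0 := by
    rw [Functor.map_comp]
    exact (congrArg (_ ≫ ·) hx).trans comp_zero
  obtain ⟨ψ, hψ⟩ := exists_Q_map_of_injective P n K (e.hom ≫ x)
  rw [hψ] at hx' ⊢
  rw [homologyFunctor_map_Q_eq_zero_iff] at hx'
  exact Q_injective_faithful P n ψ hx'

lemma projective_single_full (P : C) [Projective P] (n : ℤ) {Y : DerivedCategory C}
    (f : (homologyFunctor C n).obj ((singleFunctor C n).obj P) ⟶ (homologyFunctor C n).obj Y) :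
    ∃ x : (singleFunctor C n).obj P ⟶ Y, (homologyFunctor C n).map x = f := by
  change (homologyFunctor C n).obj (Q.obj (sgl P n)) ⟶ (homologyFunctor C n).obj Y at f
  change ∃ x : Q.obj (sgl P n) ⟶ Y, (homologyFunctor C n).map x = f
  obtain ⟨K, ⟨e⟩⟩ : ∃ K, Nonempty (Q.obj K ≅ Y) := ⟨_, ⟨Q.objObjPreimageIso Y⟩⟩
  obtain ⟨ψ, hψ⟩ := Q_projective_full P n (K := K)
    ((hIso _ n).inv ≫ f ≫ (homologyFunctor C n).map e.inv ≫
      (hIso _ n).hom)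
  refine ⟨Q.map ψ ≫ e.hom, ?_⟩
  have := hIso_nat ψ n
  rw [hψ, Iso.hom_inv_id_assoc, ← Category.assoc, cancel_mono] at this
  rw [Functor.map_comp, this]
  rw [Category.assoc, ← Functor.map_comp, e.inv_hom_id, CategoryTheory.Functor.map_id]
  exact Category.comp_id _

lemma injective_single_full (P : C) [Injective P] (n : ℤ) {Y : DerivedCategory C}
    (f : (homologyFunctor C n).obj Y ⟶ (homologyFunctor C n).obj ((singleFunctor C n).obj P)) :
    ∃ x : Y ⟶ (singleFunctor C n).obj P, (homologyFunctor C n).map x = f := by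
  change (homologyFunctor C n).obj Y ⟶ (homologyFunctor C n).obj (Q.obj (sgl P n)) at f
  change ∃ x : Y ⟶ Q.obj (sgl P n), (homologyFunctor C n).map x = f
  obtain ⟨K, ⟨e⟩⟩ : ∃ K, Nonempty (Q.obj K ≅ Y) := ⟨_, ⟨Q.objObjPreimageIso Y⟩⟩
  obtain ⟨ψ, hψ⟩ := Q_injective_full P n (K := K)
    ((hIso _ n).inv ≫ (homologyFunctor C n).map e.hom ≫ f ≫
      (hIso _ n).hom)
  refine ⟨e.inv ≫ Q.map ψ, ?_⟩
  have := hIso_nat ψ n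
  rw [hψ, Iso.hom_inv_id_assoc, ← Category.assoc, cancel_mono] at this
  rw [Functor.map_comp, this]
  rw [← Functor.map_comp_assoc, e.inv_hom_id, CategoryTheory.Functor.map_id]
  exact Category.id_comp _

end PartA

section PartC
universe v u
variable {k : Type} [Field k]
variable {D : Type u} [Category.{v} D] [Preadditive D] [CategoryTheory.Linear k D]

/-- A trace `t` on `Hom(X, SX)` inducing perfect pairings with all objects of `B`. -/
structure Perf (B : Set D) (X SX : D) (t : (X ⟶ SX) →ₗ[k] k) : Prop where
  left : ∀ Y ∈ B, ∀ x : X ⟶ Y, (∀ y : Y ⟶ SX, t (x ≫ y) = 0) → x = 0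
  right : ∀ Y ∈ B, ∀ y : Y ⟶ SX, (∀ x : X ⟶ Y, t (x ≫ y) = 0) → y = 0
  fin : ∀ Y ∈ B, FiniteDimensional k (X ⟶ Y)

/-- The pairing. -/
def pairing {X SX : D} (t : (X ⟶ SX) →ₗ[k] k) (Y : D) : (X ⟶ Y) →ₗ[k] (Y ⟶ SX) →ₗ[k] k :=
  LinearMap.mk₂ k (fun x y => t (x ≫ y)) (by simp) (by simp) (by simp) (by simp)

@[simp] lemma pairing_apply {X SX : D} (t : (X ⟶ SX) →ₗ[k] k) (Y : D) (x : X ⟶ Y) (y : Y ⟶ SX) :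
    pairing t Y x y = t (x ≫ y) := rfl

namespace Perf

variable {B : Set D} {X SX : D} {t : (X ⟶ SX) →ₗ[k] k}

lemma isPerf (h : Perf B X SX t) {Y : D} (hY : Y ∈ B) : (pairing t Y).IsPerfPair := by
  have := h.fin Y hY
  apply LinearMap.IsPerfPair.of_injective
  · rw [injective_iff_map_eq_zero]
    intro x hx
    exact h.left Y hY x (fun y => congr($hx y))
  · rw [injective_iff_map_eq_zero]
    intro y hy
    exact h.right Y hY y (fun x => congr($hy x))

lemma rep_right (h : Perf B X SX t) {Y : D} (hY : Y ∈ B) (ψ : (Y ⟶ SX) →ₗ[k] k) :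
    ∃ x : X ⟶ Y, ∀ y, t (x ≫ y) = ψ y := by
  obtain ⟨x, hx⟩ := (h.isPerf hY).bijective_left.2 ψ
  exact ⟨x, fun y => congr($hx y)⟩

lemma rep_left (h : Perf B X SX t) {Y : D} (hY : Y ∈ B) (ψ : (X ⟶ Y) →ₗ[k] k) :
    ∃ y : Y ⟶ SX, ∀ x, t (x ≫ y) = ψ x := by
  obtain ⟨x, hx⟩ := (h.isPerf hY).bijective_right.2 ψ
  exact ⟨x, fun y => congr($hx y)⟩

/-- Serre dual data from a perfect trace. -/
def serre (h : Perf B X SX t) : SerreDualOn k B X SX where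
  φ Y hY := LinearEquiv.ofBijective (pairing t Y) (h.isPerf hY).bijective_left
  natY Y Y' hY hY' g f h := by simp

end Perf

lemma exists_factor {V W : Type*} [AddCommGroup V] [Module k V] [AddCommGroup W] [Module k W]
    (A : V →ₗ[k] W) (ψ : V →ₗ[k] k) (h : ∀ v, A v = 0 → ψ v = 0) :
    ∃ ψ' : W →ₗ[k] k, ∀ v, ψ' (A v) = ψ v := by
  have : ψ ∈ A.dualMap.range := by
    rw [LinearMap.range_dualMap_eq_dualAnnihilator_ker, Submodule.mem_dualAnnihilator]
    exact fun v hv => h v hv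
  obtain ⟨ψ', hψ⟩ := this
  exact ⟨ψ', fun v => congr($hψ v)⟩

variable [HasZeroObject D] [HasShift D ℤ] [∀ n : ℤ, (shiftFunctor D n).Additive]
  [∀ n : ℤ, Functor.Linear k (shiftFunctor D n)]

/-- Shift as a linear equivalence on homs. -/
def shiftEquiv (X Y : D) (n : ℤ) : (X ⟶ Y) ≃ₗ[k] (X⟦n⟧ ⟶ Y⟦n⟧) :=
  LinearEquiv.ofBijective ((shiftFunctor D n).mapLinearMap k)
    ⟨(shiftFunctor D n).map_injective, (shiftFunctor D n).map_surjective⟩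

lemma shiftEquiv_apply {X Y : D} (n : ℤ) (f : X ⟶ Y) : shiftEquiv (k := k) X Y n f = f⟦n⟧' := rfl

/-- Shift of a trace. -/
def shTr {X SX : D} (t : (X ⟶ SX) →ₗ[k] k) (n : ℤ) : (X⟦n⟧ ⟶ SX⟦n⟧) →ₗ[k] k :=
  t ∘ₗ (shiftEquiv X SX n).symm.toLinearMap

@[simp] lemma shTr_map {X SX : D} (t : (X ⟶ SX) →ₗ[k] k) (n : ℤ) (f : X ⟶ SX) :
    shTr t n (f⟦n⟧') = t f := by
  rw [← shiftEquiv_apply (k := k)]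
  simp [shTr]

lemma Perf.shift {B : Set D} (hB : ∀ Y ∈ B, ∀ n : ℤ, Y⟦n⟧ ∈ B)
    {X SX : D} {t : (X ⟶ SX) →ₗ[k] k} (h : Perf B X SX t) (n : ℤ) :
    Perf B (X⟦n⟧) (SX⟦n⟧) (shTr t n) := by
  have key : ∀ Y : D, ∃ (Z : D), (Y ∈ B → Z ∈ B) ∧ Nonempty (Z⟦n⟧ ≅ Y) := fun Y =>
    ⟨Y⟦-n⟧, fun hY => hB Y hY _, ⟨shiftNegShift Y n⟩⟩
  refine ⟨?_, ?_, ?_⟩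
  · intro Y hY x hx
    obtain ⟨Z, hZ, ⟨e⟩⟩ := key Y
    obtain ⟨z, hz⟩ := (shiftFunctor D n).map_surjective (x ≫ e.inv)
    have : z = 0 := h.left Z (hZ hY) z (fun y => by
      have := hx (e.inv ≫ y⟦n⟧')
      rwa [← Category.assoc, ← hz, ← Functor.map_comp, shTr_map] at this)
    rw [← cancel_mono e.inv, ← hz, this]
    simp
  · intro Y hY x hx
    obtain ⟨Z, hZ, ⟨e⟩⟩ := key Y
    obtain ⟨z, hz⟩ := (shiftFunctor D n).map_surjective (e.hom ≫ x)
    have : z = 0 := h.right Z (hZ hY) z (fun y => by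
      have := hx (y⟦n⟧' ≫ e.hom)
      rwa [Category.assoc, ← hz, ← Functor.map_comp, shTr_map] at this)
    rw [← cancel_epi e.hom, ← hz, this]
    simp
  · intro Y hY
    obtain ⟨Z, hZ, ⟨e⟩⟩ := key Y
    have := h.fin Z (hZ hY)
    refine Module.Finite.of_surjective
      ((Linear.rightComp k _ e.hom) ∘ₗ (shiftEquiv (k := k) X Z n).toLinearMap) ?_
    intro y
    obtain ⟨z, hz⟩ := (shiftEquiv (k := k) X Z n).surjective (y ≫ e.inv)
    exact ⟨z, by simp [hz]⟩

variable [Pretriangulated D]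

/-- Cone construction of Serre duals. -/
theorem perf_cone {B : Set D} (hB : ∀ Y ∈ B, ∀ n : ℤ, Y⟦n⟧ ∈ B)
    {Pb Pa F Ib Ia SF : D} {f : Pb ⟶ Pa} {g : Pa ⟶ F} {h : F ⟶ Pb⟦(1:ℤ)⟧}
    (hT : Triangle.mk f g h ∈ distTriang D)
    {Sf : Ib ⟶ Ia} {Sg : Ia ⟶ SF} {Sh : SF ⟶ Ib⟦(1:ℤ)⟧}
    (hT' : Triangle.mk Sf Sg Sh ∈ distTriang D)
    (hF : F ∈ B) (hSF : SF ∈ B)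
    {ta : (Pa ⟶ Ia) →ₗ[k] k} {tb : (Pb ⟶ Ib) →ₗ[k] k}
    (pa : Perf B Pa Ia ta) (pb : Perf B Pb Ib tb)
    (compat : ∀ z : Pa ⟶ Ib, tb (f ≫ z) = ta (z ≫ Sf))
    (H1 : ∀ x : Pa ⟶ F, ∃ c : k, x = c • g)
    (H2 : ∀ y : SF ⟶ Ib⟦(1:ℤ)⟧, ∃ c : k, y = c • Sh)
    (H3 : ∀ x : Pa ⟶ SF, x = 0)
    (x0 : F ⟶ Ia) (H4 : x0 ≠ 0) :
    ∃ tF : (F ⟶ SF) →ₗ[k] k, Perf B F SF tF := by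
  have zfg : f ≫ g = 0 := comp_distTriang_mor_zero₁₂ _ hT
  have zgh : g ≫ h = 0 := comp_distTriang_mor_zero₂₃ _ hT
  have zhf : h ≫ f⟦(1:ℤ)⟧' = 0 := comp_distTriang_mor_zero₃₁ _ hT
  have zfg' : Sf ≫ Sg = 0 := comp_distTriang_mor_zero₁₂ _ hT'
  have zgh' : Sg ≫ Sh = 0 := comp_distTriang_mor_zero₂₃ _ hT'
  have zhf' : Sh ≫ Sf⟦(1:ℤ)⟧' = 0 := comp_distTriang_mor_zero₃₁ _ hT'
  have pa1 := pa.shift hB 1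
  have pb1 := pb.shift hB 1
  set ta1 := shTr ta 1 with hta1
  set tb1 := shTr tb 1 with htb1
  have compat1 : ∀ z : Pa⟦(1:ℤ)⟧ ⟶ Ib⟦(1:ℤ)⟧, tb1 (f⟦(1:ℤ)⟧' ≫ z) = ta1 (z ≫ Sf⟦(1:ℤ)⟧') := by
    intro z
    obtain ⟨z, rfl⟩ := (shiftFunctor D (1:ℤ)).map_surjective z
    rw [← Functor.map_comp, ← Functor.map_comp, hta1, htb1, shTr_map, shTr_map, compat]
  -- exactness
  have ex1 : ∀ {Y : D} (x : F ⟶ Y), g ≫ x = 0 → ∃ x', x = h ≫ x' :=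
    fun x hx => Triangle.yoneda_exact₃ _ hT x hx
  have ex2 : ∀ {Y : D} (x : Pb⟦(1:ℤ)⟧ ⟶ Y), h ≫ x = 0 → ∃ x', x = f⟦(1:ℤ)⟧' ≫ x' := by
    intro Y x hx
    obtain ⟨x', hx'⟩ := Triangle.yoneda_exact₃ _ (rot_of_distTriang _ hT) x hx
    refine ⟨-x', hx'.trans ?_⟩
    change (-f⟦(1:ℤ)⟧') ≫ x' = _
    exact (Preadditive.neg_comp _ _).trans (Preadditive.comp_neg _ _).symm
  have ex3 : ∀ {Y : D} (x : Pa ⟶ Y), f ≫ x = 0 → ∃ x', x = g ≫ x' :=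
    fun x hx => Triangle.yoneda_exact₂ _ hT x hx
  have ey1 : ∀ {Y : D} (y : Y ⟶ SF), y ≫ Sh = 0 → ∃ y', y = y' ≫ Sg :=
    fun y hy => Triangle.coyoneda_exact₃ _ hT' y hy
  have ey2 : ∀ {Y : D} (y : Y ⟶ Ia), y ≫ Sg = 0 → ∃ y', y = y' ≫ Sf :=
    fun y hy => Triangle.coyoneda_exact₂ _ hT' y hy
  have ey3 : ∀ {Y : D} (y : Y ⟶ Ib⟦(1:ℤ)⟧), y ≫ Sf⟦(1:ℤ)⟧' = 0 → ∃ y', y = y' ≫ Sh :=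
    fun y hy => Triangle.coyoneda_exact₁ _ hT' y hy
  -- the trace
  obtain ⟨tF, htF⟩ : ∃ tF : (F ⟶ SF) →ₗ[k] k, ∀ y : Pb⟦(1:ℤ)⟧ ⟶ SF,
      tF (h ≫ y) = tb1 (y ≫ Sh) := by
    refine exists_factor (Linear.leftComp k SF h) (tb1 ∘ₗ Linear.rightComp k _ Sh) ?_
    intro y hy
    obtain ⟨z, rfl⟩ := ex2 y hy
    simp only [LinearMap.comp_apply, Linear.rightComp_apply, Category.assoc]
    rw [compat1, Category.assoc, zhf', comp_zero, map_zero]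
  have hsurj : ∀ x : F ⟶ SF, ∃ y, x = h ≫ y := fun x => ex1 x (H3 _)
  -- injectivity statements
  have inj1 : ∀ x : F ⟶ Ia, ta (g ≫ x) = 0 → x = 0 := by
    intro x hx
    refine pa.right F hF x (fun z => ?_)
    obtain ⟨c, rfl⟩ := H1 z
    simp [hx]
  have inj2 : ∀ y : Pb⟦(1:ℤ)⟧ ⟶ SF, tb1 (y ≫ Sh) = 0 → y = 0 := by
    intro y hy
    refine pb1.left SF hSF y (fun z => ?_)
    obtain ⟨c, rfl⟩ := H2 z
    simp [hy]
  have hx0 : tF (x0 ≫ Sg) ≠ 0 := by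
    intro h0
    obtain ⟨y, hy⟩ := hsurj (x0 ≫ Sg)
    rw [hy, htF] at h0
    rw [inj2 y h0, comp_zero] at hy
    obtain ⟨z, hz⟩ := ey2 x0 hy
    refine H4 (inj1 _ ?_)
    rw [hz, ← Category.assoc, ← compat, ← Category.assoc, zfg, zero_comp, map_zero]
  have hx0' : ta (g ≫ x0) ≠ 0 := fun h => H4 (inj1 _ h)
  obtain ⟨c, hc, compat2⟩ : ∃ c : k, c ≠ 0 ∧ ∀ x : F ⟶ Ia, tF (x ≫ Sg) = c * ta (g ≫ x) := by
    refine ⟨tF (x0 ≫ Sg) / ta (g ≫ x0), div_ne_zero hx0 hx0', fun x => ?_⟩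
    have : x = (ta (g ≫ x) / ta (g ≫ x0)) • x0 := by
      rw [← sub_eq_zero]
      apply inj1
      simp [hx0']
    rw [this]
    simp
    field_simp
  refine ⟨tF, ⟨?_, ?_, ?_⟩⟩
  · intro Y hY x hx
    have h1 : g ≫ x = 0 := by
      refine pa.left Y hY _ (fun y => ?_)
      have := hx (y ≫ Sg)
      rw [← Category.assoc, compat2] at this
      simpa [hc] using this
    obtain ⟨x, rfl⟩ := ex1 x h1
    obtain ⟨ψ', hψ'⟩ := exists_factor (Linear.rightComp k Y (Sf⟦(1:ℤ)⟧')) (pairing tb1 Y x) (by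
      intro y hy
      obtain ⟨y, rfl⟩ := ey3 y hy
      have := hx y
      rw [Category.assoc, htF] at this
      simpa using this)
    obtain ⟨z, hz⟩ := pa1.rep_right hY ψ'
    have : x = f⟦(1:ℤ)⟧' ≫ z := by
      rw [← sub_eq_zero]
      refine pb1.left Y hY _ (fun y => ?_)
      rw [Preadditive.sub_comp, map_sub, Category.assoc, compat1, Category.assoc, hz]
      have := hψ' y
      simp only [Linear.rightComp_apply, pairing_apply] at this
      rw [this, sub_self]
    rw [this, ← Category.assoc, zhf, zero_comp]
  · intro Y hY y hy
    have h1 : y ≫ Sh = 0 := by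
      refine pb1.right Y hY _ (fun x => ?_)
      rw [← Category.assoc, ← htF, ← Category.assoc, hy]
    obtain ⟨y, rfl⟩ := ey1 y h1
    obtain ⟨ψ', hψ'⟩ := exists_factor (Linear.leftComp k Y f) ((pairing ta Y).flip y) (by
      intro x hx
      obtain ⟨x, rfl⟩ := ex3 x hx
      have := hy x
      rw [← Category.assoc, compat2] at this
      simpa [hc] using this)
    obtain ⟨z, hz⟩ := pb.rep_left hY ψ'
    have : y = z ≫ Sf := by
      rw [← sub_eq_zero]
      refine pa.right Y hY _ (fun x => ?_)
      rw [Preadditive.comp_sub, map_sub, ← Category.assoc, ← compat, ← Category.assoc, hz]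
      have := hψ' x
      simp only [Linear.leftComp_apply, LinearMap.flip_apply, pairing_apply] at this
      rw [this, sub_self]
    rw [this, Category.assoc, zfg', comp_zero]
  · intro Y hY
    have := pa.fin Y hY
    have := pb1.fin Y hY
    have e1 : (Linear.leftComp k Y h).range = (Linear.leftComp k Y g).ker := by
      ext x
      constructor
      · rintro ⟨x, rfl⟩
        simp [← Category.assoc, zgh]
      · intro hx
        obtain ⟨y, rfl⟩ := ex1 x hx
        exact ⟨y, rfl⟩
    have i1 : Module.Finite k (Linear.leftComp k Y g).ker := by
      rw [← e1]; infer_instance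
    have i2 : Module.Finite k ((F ⟶ Y) ⧸ (Linear.leftComp k Y g).ker) :=
      Module.Finite.equiv (Linear.leftComp k Y g).quotKerEquivRange.symm
    exact Module.Finite.of_submodule_quotient (Linear.leftComp k Y g).ker

end PartC

section PartD
universe w
open DerivedCategory
open scoped ModuleCat.Algebra

variable {k : Type} [Field k]
variable {A : Type} [Ring A] [Algebra k A]

/-- `P` is the projective module `A e` with generator `u`. -/
structure IsP (e : A) (P : ModuleCat.{0} A) (u : P) : Prop where
  eu : e • u = u
  ex : ∀ (M : ModuleCat.{0} A) (m : M), e • m = m → ∃ g : P ⟶ M, g.hom u = m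
  uniq : ∀ (M : ModuleCat.{0} A) (g g₂ : P ⟶ M), g.hom u = g₂.hom u → g = g₂

/-- `I` is an injective module dual to the right modules `e i A`. -/
structure IsI {ι : Type} (e : ι → A) (I : ModuleCat.{0} A) (θ : ι → I →ₗ[k] k) : Prop where
  eθ : ∀ i m, θ i (e i • m) = θ i m
  ex : ∀ (M : ModuleCat.{0} A) (ψ : ι → M →ₗ[k] k), (∀ i m, ψ i (e i • m) = ψ i m) →
    ∃ g : M ⟶ I, ∀ i m, θ i (g.hom m) = ψ i m
  uniq : ∀ (M : ModuleCat.{0} A) (g g₂ : M ⟶ I), (∀ i m, θ i (g.hom m) = θ i (g₂.hom m)) → g = g₂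

/-- Multiplication by an element as a `k`-linear map. -/
def smulL (e : A) (M : ModuleCat.{0} A) : M →ₗ[k] M := Algebra.lsmul k k M e

@[simp] lemma smulL_apply (e : A) (M : ModuleCat.{0} A) (m : M) : smulL (k := k) e M m = e • m := rfl

/-- Underlying `k`-linear map. -/
def homL {M N : ModuleCat.{0} A} (f : M ⟶ N) : M →ₗ[k] N := f.hom.restrictScalars k

@[simp] lemma homL_apply {M N : ModuleCat.{0} A} (f : M ⟶ N) (m : M) :
    homL (k := k) f m = f.hom m := rfl

lemma IsP.projective {e : A} (he : e * e = e) {P : ModuleCat.{0} A} {u : P} (h : IsP e P u) :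
    Projective P := by
  refine ⟨fun {E X} f q hq => ?_⟩
  obtain ⟨m, hm⟩ := (ModuleCat.epi_iff_surjective q).1 hq (f.hom u)
  obtain ⟨g, hg⟩ := h.ex E (e • m) (by rw [smul_smul, he])
  refine ⟨g, h.uniq _ _ _ ?_⟩
  have hm' : q.hom m = f.hom u := hm
  simp only [ModuleCat.hom_comp, LinearMap.comp_apply, hg, map_smul, hm']
  rw [← map_smul, h.eu]

lemma IsI.injective {ι : Type} {e : ι → A} (he : ∀ i, e i * e i = e i) {I : ModuleCat.{0} A}
    {θ : ι → I →ₗ[k] k} (h : IsI e I θ) : Injective I := by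
  refine ⟨fun {X Y} g f hf => ?_⟩
  have hf' := (ModuleCat.mono_iff_injective f).1 hf
  have : ∀ i, ∃ ψ : Y →ₗ[k] k, ∀ x, ψ (homL (k := k) f x) = θ i (g.hom x) := fun i =>
    exists_factor (homL (k := k) f) ((θ i) ∘ₗ (homL g)) (by
      intro x hx
      have : x = 0 := hf' (by rw [map_zero]; exact hx)
      simp [this])
  choose ψ hψ using this
  obtain ⟨y, hy⟩ := h.ex Y (fun i => ψ i ∘ₗ smulL (e i) Y) (by
    intro i m
    simp [smul_smul, he])
  refine ⟨y, h.uniq _ _ _ (fun i m => ?_)⟩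
  have := hψ i (e i • m)
  simp only [homL_apply, map_smul, h.eθ] at this
  simp [hy, this]

variable [HasDerivedCategory.{w} (ModuleCat.{0} A)]

/-- The embedding of modules in degree zero. -/
abbrev S0 : ModuleCat.{0} A ⥤ DerivedCategory (ModuleCat.{0} A) :=
  singleFunctor (ModuleCat.{0} A) 0

/-- Homology in degree zero. -/
abbrev H0 : DerivedCategory (ModuleCat.{0} A) ⥤ ModuleCat.{0} A :=
  homologyFunctor (ModuleCat.{0} A) 0

/-- Degree zero homology of a module. -/
def sIso (M : ModuleCat.{0} A) : H0.obj (S0.obj M) ≅ M :=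
  (singleFunctorCompHomologyFunctorIso (ModuleCat.{0} A) 0).app M

lemma sIso_nat {M N : ModuleCat.{0} A} (f : M ⟶ N) :
    H0.map (S0.map f) ≫ (sIso N).hom = (sIso M).hom ≫ f :=
  (singleFunctorCompHomologyFunctorIso (ModuleCat.{0} A) 0).hom.naturality f

lemma sIso_nat' {M N : ModuleCat.{0} A} (f : M ⟶ N) :
    (sIso M).inv ≫ H0.map (S0.map f) = f ≫ (sIso N).inv := by
  rw [Iso.inv_comp_eq, ← Category.assoc, Iso.eq_comp_inv, sIso_nat]

lemma smul_hom_apply {M N : ModuleCat.{0} A} (c : k) (f : M ⟶ N) (m : M) :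
    (c • f).hom m = c • f.hom m := rfl

/-- Homs out of a projective. -/
def el (P : ModuleCat.{0} A) (Y : DerivedCategory (ModuleCat.{0} A)) :
    (S0.obj P ⟶ Y) →ₗ[k] (P ⟶ H0.obj Y) where
  toFun x := (sIso P).inv ≫ H0.map x
  map_add' x y := by rw [Functor.map_add, Preadditive.comp_add]
  map_smul' c x := by
    have : c • x = S0.map (c • 𝟙 P) ≫ x := by
      rw [Functor.map_smul, CategoryTheory.Functor.map_id, Linear.smul_comp, Category.id_comp]
    rw [this, Functor.map_comp, ← Category.assoc, sIso_nat']
    simp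

lemma el_inj (P : ModuleCat.{0} A) [Projective P] (Y : DerivedCategory (ModuleCat.{0} A)) :
    Function.Injective (el (k := k) P Y) := by
  rw [injective_iff_map_eq_zero]
  intro x hx
  apply projective_single_faithful P 0 x
  exact (cancel_epi (sIso P).inv).1 (hx.trans comp_zero.symm)

lemma el_surj (P : ModuleCat.{0} A) [Projective P] (Y : DerivedCategory (ModuleCat.{0} A))
    (f : P ⟶ H0.obj Y) : ∃ x : S0.obj P ⟶ Y, (sIso P).inv ≫ H0.map x = f := by
  obtain ⟨x, hx⟩ := projective_single_full P 0 ((sIso P).hom ≫ f)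
  exact ⟨x, (Iso.inv_comp_eq _).2 hx⟩

lemma co_inj (I : ModuleCat.{0} A) [Injective I] (Y : DerivedCategory (ModuleCat.{0} A))
    (y : Y ⟶ S0.obj I) (hy : H0.map y ≫ (sIso I).hom = 0) : y = 0 :=
  injective_single_faithful I 0 y ((cancel_mono (sIso I).hom).1 (hy.trans zero_comp.symm))

lemma co_surj (I : ModuleCat.{0} A) [Injective I] (Y : DerivedCategory (ModuleCat.{0} A))
    (f : H0.obj Y ⟶ I) : ∃ y : Y ⟶ S0.obj I, H0.map y ≫ (sIso I).hom = f := by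
  obtain ⟨x, hx⟩ := injective_single_full I 0 (f ≫ (sIso I).inv)
  exact ⟨x, (Iso.comp_inv_eq _).1 hx.symm |>.symm⟩

/-- The trace pairing of a projective and an injective. -/
def trPI (P I : ModuleCat.{0} A) (u : P) (θ : I →ₗ[k] k) : (S0.obj P ⟶ S0.obj I) →ₗ[k] k where
  toFun x := θ (((sIso P).inv ≫ H0.map x ≫ (sIso I).hom).hom u)
  map_add' x y := by
    have := map_add (el (k := k) P _) x y
    change (sIso P).inv ≫ H0.map (x + y) = (sIso P).inv ≫ H0.map x + (sIso P).inv ≫ H0.map y at this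
    rw [← Category.assoc, this, Preadditive.add_comp]
    simp
  map_smul' c x := by
    have := map_smul (el (k := k) P _) c x
    change (sIso P).inv ≫ H0.map (c • x) = c • ((sIso P).inv ≫ H0.map x) at this
    rw [← Category.assoc, this, Linear.smul_comp, Category.assoc]
    simp [smul_hom_apply]

lemma trPI_map (P I : ModuleCat.{0} A) (u : P) (θ : I →ₗ[k] k) (z : P ⟶ I) :
    trPI P I u θ (S0.map z) = θ (z.hom u) := by
  change θ (((sIso P).inv ≫ H0.map (S0.map z) ≫ (sIso I).hom).hom u) = _
  rw [sIso_nat, Iso.inv_hom_id_assoc]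

lemma trPI_comp (P I : ModuleCat.{0} A) (u : P) (θ : I →ₗ[k] k)
    {Y : DerivedCategory (ModuleCat.{0} A)} (x : S0.obj P ⟶ Y) (y : Y ⟶ S0.obj I) :
    trPI P I u θ (x ≫ y) =
      θ ((H0.map y ≫ (sIso I).hom).hom (((sIso P).inv ≫ H0.map x).hom u)) := by
  change θ (((sIso P).inv ≫ H0.map (x ≫ y) ≫ (sIso I).hom).hom u) = _
  rw [Functor.map_comp]
  simp

/-- The class of objects of the bounded derived category. -/
abbrev BB (A : Type) [Ring A] [HasDerivedCategory.{w} (ModuleCat.{0} A)] :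
    Set (DerivedCategory (ModuleCat.{0} A)) := {X | IsBoundedFG A X}

theorem perf_PI [FiniteDimensional k A] (e : A) (he : e * e = e) (P I : ModuleCat.{0} A) (u : P)
    (θ : I →ₗ[k] k) (hP : IsP e P u) (hI : IsI (fun _ : Unit => e) I (fun _ => θ)) :
    Perf (BB A) (S0.obj P) (S0.obj I) (trPI P I u θ) := by
  have := hP.projective he
  have := hI.injective (fun _ => he)
  refine ⟨?_, ?_, ?_⟩
  · intro Y hY x hx
    by_contra hne
    have hm : ((sIso P).inv ≫ H0.map x).hom u ≠ 0 := by
      intro h0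
      have h1 : (sIso P).inv ≫ H0.map x = 0 := hP.uniq _ _ _ (by rw [h0]; rfl)
      exact hne (el_inj (k := k) P Y (h1.trans (map_zero _).symm))
    set m := ((sIso P).inv ≫ H0.map x).hom u with hmdef
    have hem : e • m = m := by rw [hmdef, ← map_smul, hP.eu]
    apply hm
    rw [← Module.forall_dual_apply_eq_zero_iff k]
    intro ψ
    obtain ⟨f, hf⟩ := hI.ex (H0.obj Y) (fun _ => ψ ∘ₗ smulL e _) (by
      intro i m
      simp [smul_smul, he])
    obtain ⟨y, hy⟩ := co_surj I Y f
    have := hx y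
    rw [trPI_comp, hy, ← hmdef, hf ()] at this
    simpa [hem] using this
  · intro Y hY y hy
    refine co_inj I Y y (hI.uniq _ _ _ (fun _ m => ?_))
    obtain ⟨f, hf⟩ := hP.ex (H0.obj Y) (e • m) (by rw [smul_smul, he])
    obtain ⟨x, hx⟩ := el_surj P Y f
    have := hy x
    rw [trPI_comp, hx, hf, map_smul] at this
    have h2 := hI.eθ () ((H0.map y ≫ (sIso I).hom).hom m)
    rw [← h2, this]
    simp
  · intro Y hY
    have : Module.Finite A (H0.obj Y) := hY.2 0
    have : Module.Finite k (H0.obj Y) := Module.Finite.trans A _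
    let ev : (S0.obj P ⟶ Y) →ₗ[k] (H0.obj Y) :=
      { toFun := fun x => (el (k := k) P Y x).hom u
        map_add' := fun x y => by simp
        map_smul' := fun c x => by rw [map_smul]; rfl }
    refine Module.Finite.of_injective ev ?_
    intro x y hxy
    exact el_inj (k := k) P Y (hP.uniq _ _ _ hxy)

/-- Homology of a shift. -/
def hShift (X : DerivedCategory (ModuleCat.{0} A)) (n a a' : ℤ) (h : n + a = a') :
    (homologyFunctor _ a).obj (X⟦n⟧) ≅ (homologyFunctor _ a').obj X :=
  ((homologyFunctor (ModuleCat.{0} A) 0).shiftIso n a a' h).app X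

lemma BB_shift (Y : DerivedCategory (ModuleCat.{0} A)) (hY : Y ∈ BB A) (n : ℤ) :
    Y⟦n⟧ ∈ BB A := by
  refine ⟨?_, fun a => ?_⟩
  · refine Set.Finite.subset (hY.1.preimage ((add_right_injective n).injOn)) ?_
    intro a ha h0
    exact ha (h0.of_iso (hShift Y n a (n + a) rfl))
  · have := hY.2 (n + a)
    exact Module.Finite.equiv (hShift Y n a (n + a) rfl).symm.toLinearEquiv

lemma isZero_homology_single (M : ModuleCat.{0} A) (n : ℤ) (hn : n ≠ 0) :
    IsZero ((homologyFunctor _ n).obj (S0.obj M)) := by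
  rcases lt_or_gt_of_ne hn with h | h
  · exact isZero_of_isGE (S0.obj M) 0 n h
  · exact isZero_of_isLE (S0.obj M) 0 n h

lemma BB_single (M : ModuleCat.{0} A) [Module.Finite A M] : S0.obj M ∈ BB A := by
  refine ⟨?_, fun a => ?_⟩
  · refine Set.Finite.subset (Set.finite_singleton (0:ℤ)) ?_
    intro a ha
    by_contra h
    exact ha (isZero_homology_single M a h)
  · by_cases h : a = 0
    · subst h
      exact Module.Finite.equiv (sIso M).symm.toLinearEquiv
    · have := ModuleCat.subsingleton_of_isZero (isZero_homology_single M a h)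
      infer_instance

lemma hom_proj_zero (P M : ModuleCat.{0} A) [Projective P] (i : ℤ) (hi : i ≠ 0)
    (x : S0.obj P ⟶ (S0.obj M)⟦i⟧) : x = 0 := by
  apply projective_single_faithful P 0 x
  apply IsZero.eq_of_tgt
  exact (isZero_homology_single M i hi).of_iso (hShift _ i 0 i (by simp))

lemma hom_inj_zero (I M : ModuleCat.{0} A) [Injective I] (i : ℤ) (hi : i ≠ 0)
    (x : S0.obj M ⟶ (S0.obj I)⟦i⟧) : x = 0 := by
  have key : ∀ y : (S0.obj M)⟦-i⟧ ⟶ S0.obj I, y = 0 := by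
    intro y
    apply injective_single_faithful I 0 y
    apply IsZero.eq_of_src
    exact (isZero_homology_single M (-i) (by simpa using hi)).of_iso (hShift _ (-i) 0 (-i) (by simp))
  have h1 := key (x⟦-i⟧' ≫ (shiftShiftNeg (S0.obj I) i).hom)
  have h2 : x⟦-i⟧' = 0 := (cancel_mono (shiftShiftNeg (S0.obj I) i).hom).1 (h1.trans zero_comp.symm)
  exact (shiftFunctor _ (-i)).map_injective (h2.trans (Functor.map_zero _ _ _).symm)

end PartD

section PartE
universe w
open DerivedCategory
open scoped ModuleCat.Algebra

variable {k : Type} [Field k]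
variable {A : Type} [Ring A] [Algebra k A]

lemma finrank_eq_one_of_span {V : Type*} [AddCommGroup V] [Module k V] (v : V) (hv : v ≠ 0)
    (h : ∀ w : V, ∃ c : k, w = c • v) : Module.finrank k V = 1 :=
  finrank_eq_one v hv (fun w => (h w).imp (fun _ h => h.symm))

lemma finrank_eq_zero_of_forall {V : Type*} [AddCommGroup V] [Module k V]
    (h : ∀ w : V, w = 0) : Module.finrank k V = 0 := by
  have : Subsingleton V := ⟨fun a b => by rw [h a, h b]⟩
  exact Module.finrank_zero_of_subsingleton

variable [HasDerivedCategory.{w} (ModuleCat.{0} A)]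

lemma S0_span {M N : ModuleCat.{0} A} (f : M ⟶ N) (h : ∀ x : M ⟶ N, ∃ c : k, x = c • f)
    (y : S0.obj M ⟶ S0.obj N) : ∃ c : k, y = c • S0.map f := by
  obtain ⟨x, rfl⟩ := S0.map_surjective y
  obtain ⟨c, rfl⟩ := h x
  exact ⟨c, Functor.map_smul _ _ _⟩

lemma S0_ne {M N : ModuleCat.{0} A} (f : M ⟶ N) (h : f ≠ 0) : S0.map f ≠ 0 := fun h0 =>
  h (S0.map_injective (h0.trans (Functor.map_zero _ _ _).symm))

theorem mem_poset [FiniteDimensional k A] {ea eb : A} (hea : ea * ea = ea) (heb : eb * eb = eb)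
    {Pa Pb F τF Ib Ia Qm : ModuleCat.{0} A}
    [Module.Finite A F] [Module.Finite A τF] [Module.Finite A Qm]
    {ua : Pa} {ub : Pb} {θa : Ia →ₗ[k] k} {θb : Ib →ₗ[k] k}
    (hPa : IsP ea Pa ua) (hPb : IsP eb Pb ub)
    (hIa : IsI (fun _ : Unit => ea) Ia (fun _ => θa))
    (hIb : IsI (fun _ : Unit => eb) Ib (fun _ => θb))
    {f : Pb ⟶ Pa} {g : Pa ⟶ F} {hfg : f ≫ g = 0} (S1 : (ShortComplex.mk f g hfg).ShortExact)
    {j : τF ⟶ Ib} {q : Ib ⟶ Ia} {hjq : j ≫ q = 0} (S2 : (ShortComplex.mk j q hjq).ShortExact)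
    {w : F ⟶ τF} {r : τF ⟶ Qm} {hwr : w ≫ r = 0} (S3 : (ShortComplex.mk w r hwr).ShortExact)
    (compat : ∀ z : Pa ⟶ Ib, θb ((f ≫ z).hom ub) = θa ((z ≫ q).hom ua))
    (H1 : ∀ x : Pa ⟶ F, ∃ c : k, x = c • g)
    (H2 : ∀ y : τF ⟶ Ib, ∃ c : k, y = c • j)
    (x0 : F ⟶ Ia) (H4 : x0 ≠ 0)
    (E0 : ∀ x : F ⟶ F, ∃ c : k, x = c • 𝟙 F)
    (i0 : Pb ⟶ F) (hi0 : i0 ≠ 0) (E1 : ∀ x : Pb ⟶ F, ∃ c : k, x = c • i0)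
    (hw : w ≠ 0) :
    sphericalSubcatOn (BB A) (S0.obj Qm) ∈ dSpherelikePosetOn k (BB A) 1 := by
  have hpa := hPa.projective hea
  have hpb := hPb.projective heb
  have hF0 : 𝟙 F ≠ 0 := fun h0 => hw (by rw [← Category.id_comp w, h0, zero_comp])
  have T1 := S1.singleTriangle_distinguished
  have T2 := rot_of_distTriang _ S2.singleTriangle_distinguished
  have T3 := S3.singleTriangle_distinguished
  have hFB : S0.obj F ∈ BB A := BB_single F
  have hSFB : (S0.obj τF)⟦(1:ℤ)⟧ ∈ BB A := BB_shift _ (BB_single τF) 1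
  obtain ⟨tF, htF⟩ := perf_cone (k := k) (B := BB A) BB_shift (f := S0.map f) (g := S0.map g)
    (h := S1.singleδ) T1 (Sf := S0.map q) (Sg := S2.singleδ) (Sh := -(S0.map j)⟦(1:ℤ)⟧') T2
    hFB hSFB (perf_PI ea hea Pa Ia ua θa hPa hIa) (perf_PI eb heb Pb Ib ub θb hPb hIb)
    (by
      intro z
      obtain ⟨z, rfl⟩ := S0.map_surjective z
      rw [← Functor.map_comp, ← Functor.map_comp, trPI_map, trPI_map, compat])
    (S0_span g H1)
    (by
      intro y
      obtain ⟨y, rfl⟩ := (shiftFunctor _ (1:ℤ)).map_surjective y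
      obtain ⟨c, rfl⟩ := S0_span j H2 y
      exact ⟨-c, by rw [Functor.map_smul, neg_smul, smul_neg, neg_neg]⟩)
    (fun x => hom_proj_zero Pa τF 1 one_ne_zero x) (S0.map x0) (S0_ne x0 H4)
  have ex1 : ∀ {Y : DerivedCategory (ModuleCat.{0} A)} (x : S0.obj F ⟶ Y),
      S0.map g ≫ x = 0 → ∃ x', x = S1.singleδ ≫ x' :=
    fun x hx => Triangle.yoneda_exact₃ _ T1 x hx
  have hspan : ∀ x : S0.obj F ⟶ S0.obj F, ∃ c : k, x = c • 𝟙 (S0.obj F) := by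
    intro x
    obtain ⟨c, hc⟩ := S0_span (𝟙 F) E0 x
    exact ⟨c, by rw [hc, CategoryTheory.Functor.map_id]⟩
  have hid0 : 𝟙 (S0.obj F) ≠ 0 := by
    rw [← CategoryTheory.Functor.map_id]
    exact S0_ne _ hF0
  refine ⟨S0.obj F, (S0.obj τF)⟦(1:ℤ)⟧, S0.obj Qm, htF.serre,
    S0.map w ≫ (shiftShiftNeg (S0.obj τF) (1:ℤ)).inv,
    (shiftShiftNeg (S0.obj τF) (1:ℤ)).hom ≫ S0.map r, S3.singleδ, hFB, hSFB, BB_single Qm,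
    ?_, ?_, ?_, ?_, rfl⟩
  · intro i
    by_cases hi0' : i = 0
    · subst hi0'
      simp only [if_true, zero_ne_one, if_false, add_zero]
      let e := (shiftFunctorZero (DerivedCategory (ModuleCat.{0} A)) ℤ).app (S0.obj F)
      refine finrank_eq_one_of_span e.inv ?_ ?_
      · intro h0
        apply hid0
        have := e.inv_hom_id
        rw [h0, zero_comp] at this
        exact this.symm
      · intro x
        obtain ⟨c, hc⟩ := hspan (x ≫ e.hom)
        refine ⟨c, ?_⟩
        rw [← cancel_mono e.hom, hc, Linear.smul_comp, e.inv_hom_id]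
        rfl
    · by_cases hi1 : i = 1
      · subst hi1
        simp only [one_ne_zero, if_true, if_false, zero_add]
        refine finrank_eq_one_of_span (S1.singleδ ≫ (S0.map i0)⟦(1:ℤ)⟧') ?_ ?_
        · intro h0
          obtain ⟨y, hy⟩ := Triangle.yoneda_exact₃ _ (rot_of_distTriang _ T1)
            ((S0.map i0)⟦(1:ℤ)⟧') h0
          change (S0.obj Pa)⟦(1:ℤ)⟧ ⟶ _ at y
          change (S0.map i0)⟦(1:ℤ)⟧' = (-(S0.map f)⟦(1:ℤ)⟧') ≫ y at hy
          obtain ⟨y, rfl⟩ := (shiftFunctor _ (1:ℤ)).map_surjective y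
          obtain ⟨c, rfl⟩ := S0_span g H1 y
          have h2 : S0.map f ≫ S0.map g = 0 := by
            rw [← Functor.map_comp, hfg, Functor.map_zero]
          have h3 : (S0.map i0)⟦(1:ℤ)⟧' = 0 := by
            refine hy.trans ((Preadditive.neg_comp _ _).trans ?_)
            rw [← Functor.map_comp, Linear.comp_smul, h2, smul_zero, Functor.map_zero, neg_zero]
          exact S0_ne i0 hi0
            ((shiftFunctor _ (1:ℤ)).map_injective (h3.trans (Functor.map_zero _ _ _).symm))
        · intro x
          obtain ⟨y, rfl⟩ := ex1 x (hom_proj_zero Pa F 1 one_ne_zero _)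
          change (S0.obj Pb)⟦(1:ℤ)⟧ ⟶ _ at y
          obtain ⟨y, rfl⟩ := (shiftFunctor _ (1:ℤ)).map_surjective y
          obtain ⟨c, rfl⟩ := S0_span i0 E1 y
          exact ⟨c, by rw [Functor.map_smul]; exact Linear.comp_smul _ _ _ _ _ _⟩
      · simp only [hi0', hi1, if_false, add_zero]
        refine finrank_eq_zero_of_forall (fun x => ?_)
        obtain ⟨y, rfl⟩ := ex1 x (hom_proj_zero Pa F i hi0' _)
        change (S0.obj Pb)⟦(1:ℤ)⟧ ⟶ _ at y
        let e := (shiftFunctorAdd' (DerivedCategory (ModuleCat.{0} A)) (i-1) 1 i (by ring)).app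
          (S0.obj F)
        obtain ⟨z, hz⟩ := (shiftFunctor _ (1:ℤ)).map_surjective
          (show (S0.obj Pb)⟦(1:ℤ)⟧ ⟶ ((S0.obj F)⟦(i-1)⟧)⟦(1:ℤ)⟧ from y ≫ e.hom)
        have hz0 : z = 0 := hom_proj_zero Pb F (i-1) (sub_ne_zero.2 hi1) z
        rw [hz0, Functor.map_zero] at hz
        have : y = 0 := (cancel_mono e.hom).1 (hz.symm.trans zero_comp.symm)
        rw [this]
        exact comp_zero
  · refine ⟨fun h => hid0 (h.eq_of_src _ _), fun x => ?_⟩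
    obtain ⟨c, rfl⟩ := hspan x
    by_cases hc : c = 0
    · right
      rw [hc, zero_smul, sub_zero]
      infer_instance
    · left
      exact ⟨c⁻¹ • 𝟙 _, by simp [smul_smul, hc], by simp [smul_smul, hc]⟩
  · intro h0
    exact S0_ne w hw ((cancel_mono (shiftShiftNeg (S0.obj τF) (1:ℤ)).inv).1
      (h0.trans zero_comp.symm))
  · refine isomorphic_distinguished _ T3 _ ?_
    refine Triangle.isoMk _ _ (Iso.refl _) (shiftShiftNeg (S0.obj τF) (1:ℤ)) (Iso.refl _) ?_ ?_ ?_
    · change (S0.map w ≫ (shiftShiftNeg (S0.obj τF) (1:ℤ)).inv) ≫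
        (shiftShiftNeg (S0.obj τF) (1:ℤ)).hom = 𝟙 _ ≫ S0.map w
      rw [Category.assoc, Iso.inv_hom_id, Category.comp_id, Category.id_comp]
    · change ((shiftShiftNeg (S0.obj τF) (1:ℤ)).hom ≫ S0.map r) ≫ 𝟙 _ =
        (shiftShiftNeg (S0.obj τF) (1:ℤ)).hom ≫ S0.map r
      rw [Category.comp_id]
    · change S3.singleδ ≫ (𝟙 (S0.obj F))⟦(1:ℤ)⟧' = 𝟙 (S0.obj Qm) ≫ S3.singleδ
      rw [CategoryTheory.Functor.map_id]
      exact (Category.comp_id _).trans (Category.id_comp _).symm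

/-- For a retract, left orthogonals are included. -/
lemma subcat_mono {Q Q' : ModuleCat.{0} A} (i : Q' ⟶ Q) (p : Q ⟶ Q') (h : i ≫ p = 𝟙 Q') :
    sphericalSubcatOn (BB A) (S0.obj Q) ⊆ sphericalSubcatOn (BB A) (S0.obj Q') := by
  rintro X ⟨hX, hX'⟩
  refine ⟨hX, fun n f => ?_⟩
  have h1 := hX' n (f ≫ (S0.map i)⟦n⟧')
  have h2 : (S0.map i)⟦n⟧' ≫ (S0.map p)⟦n⟧' = 𝟙 _ := by
    rw [← Functor.map_comp, ← Functor.map_comp, h, CategoryTheory.Functor.map_id,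
      CategoryTheory.Functor.map_id]
  rw [← Category.comp_id f, ← h2, ← Category.assoc, h1, zero_comp]

/-- A module in one orthogonal and not in the other. -/
lemma subcat_not_le {Q Q' M : ModuleCat.{0} A} [Module.Finite A M] [Injective Q]
    (h : ∀ f : M ⟶ Q, f = 0) (f' : M ⟶ Q') (hf' : f' ≠ 0) :
    ¬ sphericalSubcatOn (BB A) (S0.obj Q) ⊆ sphericalSubcatOn (BB A) (S0.obj Q') := by
  intro hle
  have h1 : S0.obj M ∈ sphericalSubcatOn (BB A) (S0.obj Q) := by
    refine ⟨BB_single M, fun i x => ?_⟩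
    by_cases hi : i = 0
    · subst hi
      let e := (shiftFunctorZero (DerivedCategory (ModuleCat.{0} A)) ℤ).app (S0.obj Q)
      obtain ⟨y, hy⟩ := S0.map_surjective
        (show S0.obj M ⟶ S0.obj Q from x ≫ e.hom)
      rw [h y, Functor.map_zero] at hy
      exact (cancel_mono e.hom).1 (hy.symm.trans zero_comp.symm)
    · exact hom_inj_zero Q M i hi x
  let e := (shiftFunctorZero (DerivedCategory (ModuleCat.{0} A)) ℤ).app (S0.obj Q')
  have h2 := (hle h1).2 0 (S0.map f' ≫ e.inv)
  exact S0_ne f' hf' ((cancel_mono e.inv).1 (h2.trans zero_comp.symm))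

end PartE

section PartH
open ZeroObject

universe v₁ u₁
variable {C : Type u₁} [Category.{v₁} C] [Abelian C]

/-- The objects of a resolution of length one. -/
def twoX (K P : C) : ℕ → C
  | 0 => P
  | 1 => K
  | _ + 2 => 0

/-- The differentials of a resolution of length one. -/
def twoD {K P : C} (i : K ⟶ P) : ∀ n, twoX K P (n + 1) ⟶ twoX K P n
  | 0 => i
  | _ + 1 => 0

/-- A two-term complex. -/
def twoC {K P : C} (i : K ⟶ P) : ChainComplex C ℕ :=
  ChainComplex.of (twoX K P) (twoD i) (fun n => by
    change (0 : _ ⟶ _) ≫ _ = 0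
    rw [zero_comp])

lemma twoC_d {K P : C} (i : K ⟶ P) (n : ℕ) : (twoC i).d (n + 1) n = twoD i n :=
  ChainComplex.of_d _ _ n

lemma twoC_zero {K P : C} (i : K ⟶ P) (n : ℕ) : IsZero ((twoC i).X (n + 2)) :=
  isZero_zero C

/-- A short exact sequence as a resolution. -/
def twoRes {K P M : C} [Projective K] [Projective P] (i : K ⟶ P) (p : P ⟶ M) (w : i ≫ p = 0)
    (h : (ShortComplex.mk i p w).ShortExact) : ProjectiveResolution M where
  complex := twoC i
  projective := fun n => by
    match n with
    | 0 => exact inferInstanceAs (Projective P)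
    | 1 => exact inferInstanceAs (Projective K)
    | n + 2 => exact inferInstanceAs (Projective (0 : C))
  π := (ChainComplex.toSingle₀Equiv (twoC i) M).symm ⟨p, by
    rw [twoC_d]; exact w⟩
  quasiIso := ⟨fun n => by
    have := h.epi_g
    have := h.mono_f
    cases n with
    | zero =>
      rw [ChainComplex.quasiIsoAt₀_iff, ShortComplex.quasiIso_iff_of_zeros']
      · refine (ShortComplex.exact_and_epi_g_iff_of_iso ?_).2 ⟨h.exact, h.epi_g⟩
        exact ShortComplex.isoMk (Iso.refl _) (Iso.refl _) (Iso.refl _)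
          ((Category.id_comp _).trans (((twoC_d i 0).symm).trans (Category.comp_id _).symm))
          (by
            refine (Category.id_comp _).trans (Eq.trans ?_ (Category.comp_id _).symm)
            exact (ChainComplex.toSingle₀Equiv_symm_apply_f_zero (C := twoC i) p _).symm)
      all_goals rfl
    | succ n =>
      rw [quasiIsoAt_iff_exactAt']
      · rw [HomologicalComplex.exactAt_iff' _ (n + 1 + 1) (n + 1) n (by simp) (by simp)]
        match n with
        | 0 =>
          refine (ShortComplex.exact_iff_mono _ ?_).2 ?_
          · exact (twoC_zero i 0).eq_of_src _ _
          · change Mono ((twoC i).d 1 0)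
            rw [twoC_d]
            exact h.mono_f
        | n + 1 => exact ShortComplex.exact_of_isZero_X₂ _ (twoC_zero i n)
      · apply ChainComplex.exactAt_succ_single_obj⟩

lemma ext_zero_of_ses [EnoughProjectives C] {R : Type*} [Ring R] [Linear R C]
    {K P M : C} [Projective K] [Projective P] (i : K ⟶ P)
    (p : P ⟶ M) (w : i ≫ p = 0) (h : (ShortComplex.mk i p w).ShortExact) (N : C) (n : ℕ)
    (hn : 2 ≤ n) : IsZero (((Ext R C n).obj (Opposite.op M)).obj N) := by
  obtain ⟨n, rfl⟩ := Nat.exists_eq_add_of_le' hn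
  refine IsZero.of_iso ?_ ((twoRes i p w h).isoExt (n + 2) N)
  rw [← HomologicalComplex.exactAt_iff_isZero_homology, HomologicalComplex.exactAt_iff]
  refine ShortComplex.exact_of_isZero_X₂ _ ?_
  rw [IsZero.iff_id_eq_zero]
  ext (x : _ ⟶ _)
  obtain rfl : x = 0 := (twoC_zero i n).eq_of_src _ _
  rfl

end PartH

section PartB
set_option linter.unusedSectionVars false
open scoped ModuleCat.Algebra

variable {k : Type} [Field k] {SA SB E : Type}

/-- Path algebra of a bipartite quiver with sources `SA`, sinks `SB` and edges `E`. -/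
def QA (k : Type) [Field k] {SA SB E : Type} (_s : E → SA) (_t : E → SB) : Type :=
  (SA → k) × (SB → k) × (E → k)

namespace QA
variable {s : E → SA} {t : E → SB}

instance : AddCommGroup (QA k s t) := inferInstanceAs (AddCommGroup ((SA → k) × (SB → k) × (E → k)))
instance : Module k (QA k s t) := inferInstanceAs (Module k ((SA → k) × (SB → k) × (E → k)))

/-- Component at sources. -/
def a (x : QA k s t) : SA → k := x.1
/-- Component at sinks. -/
def b (x : QA k s t) : SB → k := x.2.1
/-- Component at edges. -/
def e (x : QA k s t) : E → k := x.2.2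
/-- Constructor. -/
def mk' (x : SA → k) (y : SB → k) (z : E → k) : QA k s t := (x, y, z)

@[simp] lemma mk'_a (x : SA → k) (y : SB → k) (z : E → k) : (mk' x y z : QA k s t).a = x := rfl
@[simp] lemma mk'_b (x : SA → k) (y : SB → k) (z : E → k) : (mk' x y z : QA k s t).b = y := rfl
@[simp] lemma mk'_e (x : SA → k) (y : SB → k) (z : E → k) : (mk' x y z : QA k s t).e = z := rfl

lemma ext' {x y : QA k s t} (h1 : ∀ i, x.a i = y.a i) (h2 : ∀ i, x.b i = y.b i)
    (h3 : ∀ i, x.e i = y.e i) : x = y :=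
  Prod.ext (funext h1) (Prod.ext (funext h2) (funext h3))

@[simp] lemma add_a (x y : QA k s t) (i : SA) : (x + y).a i = x.a i + y.a i := rfl
@[simp] lemma add_b (x y : QA k s t) (i : SB) : (x + y).b i = x.b i + y.b i := rfl
@[simp] lemma add_e (x y : QA k s t) (i : E) : (x + y).e i = x.e i + y.e i := rfl
@[simp] lemma smul_a (c : k) (y : QA k s t) (i : SA) : (c • y).a i = c * y.a i := rfl
@[simp] lemma smul_b (c : k) (y : QA k s t) (i : SB) : (c • y).b i = c * y.b i := rfl
@[simp] lemma smul_e (c : k) (y : QA k s t) (i : E) : (c • y).e i = c * y.e i := rfl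
@[simp] lemma zero_a (i : SA) : (0 : QA k s t).a i = 0 := rfl
@[simp] lemma zero_b (i : SB) : (0 : QA k s t).b i = 0 := rfl
@[simp] lemma zero_e (i : E) : (0 : QA k s t).e i = 0 := rfl

instance : Mul (QA k s t) :=
  ⟨fun x y => mk' (fun i => x.a i * y.a i) (fun i => x.b i * y.b i)
    (fun i => x.b (t i) * y.e i + x.e i * y.a (s i))⟩
instance : One (QA k s t) := ⟨mk' (fun _ => 1) (fun _ => 1) (fun _ => 0)⟩

@[simp] lemma mul_a (x y : QA k s t) (i : SA) : (x * y).a i = x.a i * y.a i := rfl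
@[simp] lemma mul_b (x y : QA k s t) (i : SB) : (x * y).b i = x.b i * y.b i := rfl
@[simp] lemma mul_e (x y : QA k s t) (i : E) :
    (x * y).e i = x.b (t i) * y.e i + x.e i * y.a (s i) := rfl
@[simp] lemma one_a (i : SA) : (1 : QA k s t).a i = 1 := rfl
@[simp] lemma one_b (i : SB) : (1 : QA k s t).b i = 1 := rfl
@[simp] lemma one_e (i : E) : (1 : QA k s t).e i = 0 := rfl

instance : Ring (QA k s t) :=
  { (inferInstance : AddCommGroup (QA k s t)) with
    left_distrib := fun x y z => ext' (fun i => by simp; ring) (fun i => by simp; ring)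
      (fun i => by simp; ring)
    right_distrib := fun x y z => ext' (fun i => by simp; ring) (fun i => by simp; ring)
      (fun i => by simp; ring)
    zero_mul := fun x => ext' (fun i => by simp) (fun i => by simp) (fun i => by simp)
    mul_zero := fun x => ext' (fun i => by simp) (fun i => by simp) (fun i => by simp)
    mul_assoc := fun x y z => ext' (fun i => by simp; ring) (fun i => by simp; ring)
      (fun i => by simp; ring)
    one_mul := fun x => ext' (fun i => by simp) (fun i => by simp) (fun i => by simp)
    mul_one := fun x => ext' (fun i => by simp) (fun i => by simp) (fun i => by simp) }

instance : Algebra k (QA k s t) := Algebra.ofModule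
  (fun r x y => ext' (fun i => by simp; ring) (fun i => by simp; ring) (fun i => by simp; ring))
  (fun r x y => ext' (fun i => by simp; ring) (fun i => by simp; ring) (fun i => by simp; ring))

@[simp] lemma algebraMap_a (c : k) (i : SA) : (algebraMap k (QA k s t) c).a i = c := by
  rw [Algebra.algebraMap_eq_smul_one]; simp
@[simp] lemma algebraMap_b (c : k) (i : SB) : (algebraMap k (QA k s t) c).b i = c := by
  rw [Algebra.algebraMap_eq_smul_one]; simp
@[simp] lemma algebraMap_e (c : k) (i : E) : (algebraMap k (QA k s t) c).e i = 0 := by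
  rw [Algebra.algebraMap_eq_smul_one]; simp

instance [Finite SA] [Finite SB] [Finite E] : FiniteDimensional k (QA k s t) :=
  inferInstanceAs (FiniteDimensional k ((SA → k) × (SB → k) × (E → k)))

variable [DecidableEq SA] [DecidableEq SB] [DecidableEq E]

/-- Idempotent of a source. -/
def ea (i : SA) : QA k s t := mk' (Pi.single i 1) 0 0
/-- Idempotent of a sink. -/
def eb (i : SB) : QA k s t := mk' 0 (Pi.single i 1) 0
/-- An edge. -/
def ee (i : E) : QA k s t := mk' 0 0 (Pi.single i 1)

@[simp] lemma ea_a (i j : SA) : (ea i : QA k s t).a j = if j = i then 1 else 0 := by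
  simp [ea, Pi.single_apply]
@[simp] lemma ea_b (i : SA) (j : SB) : (ea i : QA k s t).b j = 0 := rfl
@[simp] lemma ea_e (i : SA) (j : E) : (ea i : QA k s t).e j = 0 := rfl
@[simp] lemma eb_b (i j : SB) : (eb i : QA k s t).b j = if j = i then 1 else 0 := by
  simp [eb, Pi.single_apply]
@[simp] lemma eb_a (i : SB) (j : SA) : (eb i : QA k s t).a j = 0 := rfl
@[simp] lemma eb_e (i : SB) (j : E) : (eb i : QA k s t).e j = 0 := rfl
@[simp] lemma ee_e (i j : E) : (ee i : QA k s t).e j = if j = i then 1 else 0 := by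
  simp [ee, Pi.single_apply]
@[simp] lemma ee_a (i : E) (j : SA) : (ee i : QA k s t).a j = 0 := rfl
@[simp] lemma ee_b (i : E) (j : SB) : (ee i : QA k s t).b j = 0 := rfl

lemma ea_mul_ea (i : SA) : (ea i * ea i : QA k s t) = ea i :=
  ext' (fun j => by simp) (fun j => by simp) (fun j => by simp)
lemma eb_mul_eb (i : SB) : (eb i * eb i : QA k s t) = eb i :=
  ext' (fun j => by simp) (fun j => by simp) (fun j => by simp)
lemma mul_ea (x : QA k s t) (i : SA) (h : ∀ j, s j ≠ i) : x * ea i = x.a i • ea i :=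
  ext' (fun j => by by_cases hj : j = i <;> simp [hj]) (fun j => by simp) (fun j => by simp [h])
lemma ea_mul (x : QA k s t) (i : SA) : ea i * x = x.a i • ea i :=
  ext' (fun j => by by_cases hj : j = i <;> simp [hj]) (fun j => by simp) (fun j => by simp)
lemma mul_eb (x : QA k s t) (i : SB) : x * eb i = x.b i • eb i :=
  ext' (fun j => by simp) (fun j => by by_cases hj : j = i <;> simp [hj]) (fun j => by simp)
lemma mul_ee (x : QA k s t) (i : E) : x * ee i = x.b (t i) • ee i :=
  ext' (fun j => by simp) (fun j => by simp) (fun j => by by_cases hj : j = i <;> simp [hj])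
lemma ee_mul (x : QA k s t) (i : E) : ee i * x = x.a (s i) • ee i :=
  ext' (fun j => by simp) (fun j => by simp) (fun j => by by_cases hj : j = i <;> simp [hj])

/-- The degree zero part. -/
def pr (x : QA k s t) : QA k s t := mk' x.a x.b 0
@[simp] lemma pr_a (x : QA k s t) (i : SA) : (pr x).a i = x.a i := rfl
@[simp] lemma pr_b (x : QA k s t) (i : SB) : (pr x).b i = x.b i := rfl
@[simp] lemma pr_e (x : QA k s t) (i : E) : (pr x).e i = 0 := rfl

lemma pr_mul (x y : QA k s t) : pr (x * y) = pr x * pr y :=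
  ext' (fun j => by simp) (fun j => by simp) (fun j => by simp)
lemma pr_add (x y : QA k s t) : pr (x + y) = pr x + pr y :=
  ext' (fun j => by simp) (fun j => by simp) (fun j => by simp)
lemma pr_one : pr (1 : QA k s t) = 1 :=
  ext' (fun j => by simp) (fun j => by simp) (fun j => by simp)
lemma pr_zero : pr (0 : QA k s t) = 0 :=
  ext' (fun j => by simp) (fun j => by simp) (fun j => by simp)
lemma pr_algebraMap (c : k) : pr (algebraMap k (QA k s t) c) = algebraMap k _ c :=
  ext' (fun j => by simp) (fun j => by simp) (fun j => by simp)

/-- Components as additive maps. -/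
def aH (i : SA) : QA k s t →+ k := ⟨⟨fun x => x.a i, rfl⟩, fun _ _ => rfl⟩
/-- Components as additive maps. -/
def bH (i : SB) : QA k s t →+ k := ⟨⟨fun x => x.b i, rfl⟩, fun _ _ => rfl⟩
/-- Components as additive maps. -/
def eH (i : E) : QA k s t →+ k := ⟨⟨fun x => x.e i, rfl⟩, fun _ _ => rfl⟩

@[simp] lemma sum_a {ι : Type} (S : Finset ι) (f : ι → QA k s t) (i : SA) :
    (∑ j ∈ S, f j).a i = ∑ j ∈ S, (f j).a i := map_sum (aH i) f S
@[simp] lemma sum_b {ι : Type} (S : Finset ι) (f : ι → QA k s t) (i : SB) :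
    (∑ j ∈ S, f j).b i = ∑ j ∈ S, (f j).b i := map_sum (bH i) f S
@[simp] lemma sum_e {ι : Type} (S : Finset ι) (f : ι → QA k s t) (i : E) :
    (∑ j ∈ S, f j).e i = ∑ j ∈ S, (f j).e i := map_sum (eH i) f S

variable [Fintype SA] [Fintype SB] [Fintype E]

lemma pr_eq (x : QA k s t) : pr x = ∑ i, x.a i • ea i + ∑ i, x.b i • eb i :=
  ext' (fun j => by simp) (fun j => by simp) (fun j => by simp)
lemma eq_pr (x : QA k s t) : x = pr x + ∑ i, x.e i • ee i :=
  ext' (fun j => by simp) (fun j => by simp) (fun j => by simp)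
lemma eq_sum (x : QA k s t) : x = ∑ i, x.a i • ea i + ∑ i, x.b i • eb i + ∑ i, x.e i • ee i := by
  rw [← pr_eq, ← eq_pr]
lemma one_eq : (1 : QA k s t) = ∑ i, ea i + ∑ i, eb i :=
  ext' (fun j => by simp) (fun j => by simp) (fun j => by simp)

lemma smul_eq (x : QA k s t) (M : ModuleCat.{0} (QA k s t)) (m : M) :
    x • m = ∑ i, x.a i • ((ea i : QA k s t) • m) + ∑ i, x.b i • ((eb i : QA k s t) • m)
      + ∑ i, x.e i • ((ee i : QA k s t) • m) := by
  conv_lhs => rw [eq_sum x]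
  simp only [add_smul, Finset.sum_smul, smul_assoc]

/-- A `k`-linear map commuting with generators is a morphism. -/
lemma mkHom {M N : ModuleCat.{0} (QA k s t)} (f : M →ₗ[k] N)
    (ha : ∀ i m, f ((ea i : QA k s t) • m) = (ea i : QA k s t) • f m)
    (hb : ∀ i m, f ((eb i : QA k s t) • m) = (eb i : QA k s t) • f m)
    (he : ∀ i m, f ((ee i : QA k s t) • m) = (ee i : QA k s t) • f m) :
    ∃ g : M ⟶ N, ∀ m, g.hom m = f m :=
  ⟨ModuleCat.ofHom
    { toFun := f
      map_add' := map_add f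
      map_smul' := fun x m => by
        rw [RingHom.id_apply, smul_eq x N, smul_eq x M]
        simp only [map_add, map_sum, map_smul, ha, hb, he] }, fun _ => rfl⟩

end QA
end PartB

section PartK
set_option linter.unusedSectionVars false
open scoped ModuleCat.Algebra
open QA

variable {k : Type} [Field k] {SA SB E : Type} {s : E → SA} {t : E → SB}
variable [DecidableEq SA] [DecidableEq SB] [DecidableEq E] [Fintype SA] [Fintype SB] [Fintype E]

lemma ksmul_def (M : ModuleCat.{0} (QA k s t)) (c : k) (m : M) :
    c • m = (algebraMap k (QA k s t) c) • m := rfl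

/-- Carrier of the kernel. -/
def KK (M : ModuleCat.{0} (QA k s t)) : Type := E → M
instance (M : ModuleCat.{0} (QA k s t)) : AddCommGroup (KK M) :=
  inferInstanceAs (AddCommGroup (E → M))
instance (M : ModuleCat.{0} (QA k s t)) : SMul (QA k s t) (KK M) :=
  ⟨fun x f => (fun i => x.b (t i) • f i : E → M)⟩
/-- Underlying function. -/
def KK.g {M : ModuleCat.{0} (QA k s t)} (f : KK M) : E → M := f
lemma KK.ext {M : ModuleCat.{0} (QA k s t)} {f g : KK M} (h : ∀ i, f.g i = g.g i) : f = g := funext h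
@[simp] lemma KK.add_apply {M : ModuleCat.{0} (QA k s t)} (f g : KK M) (i : E) :
  (f + g).g i = f.g i + g.g i := rfl
@[simp] lemma KK.zero_apply {M : ModuleCat.{0} (QA k s t)} (i : E) :
  (0 : KK M).g i = 0 := rfl
@[simp] lemma KK.smul_apply {M : ModuleCat.{0} (QA k s t)} (x : QA k s t) (f : KK M) (i : E) :
  (x • f).g i = x.b (t i) • f.g i := rfl
instance (M : ModuleCat.{0} (QA k s t)) : Module (QA k s t) (KK M) where
  one_smul f := KK.ext fun i => by simp
  mul_smul x y f := KK.ext fun i => by simp [mul_smul]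
  smul_zero x := KK.ext fun i => by simp
  smul_add x f g := KK.ext fun i => by simp
  add_smul x y f := KK.ext fun i => by simp [add_smul]
  zero_smul f := KK.ext fun i => by simp

/-- Carrier of the projective cover. -/
def PP (M : ModuleCat.{0} (QA k s t)) : Type := M × (E → M)
/-- First component. -/
def PP.m {M : ModuleCat.{0} (QA k s t)} (x : PP M) : M := x.1
/-- Second component. -/
def PP.f {M : ModuleCat.{0} (QA k s t)} (x : PP M) : E → M := x.2
/-- Constructor. -/
def PP.mk {M : ModuleCat.{0} (QA k s t)} (x : M) (f : E → M) : PP M := (x, f)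
@[simp] lemma PP.mk_m {M : ModuleCat.{0} (QA k s t)} (x : M) (f : E → M) : (PP.mk x f).m = x := rfl
@[simp] lemma PP.mk_f {M : ModuleCat.{0} (QA k s t)} (x : M) (f : E → M) : (PP.mk x f).f = f := rfl
lemma PP.ext {M : ModuleCat.{0} (QA k s t)} {f g : PP M} (h0 : f.m = g.m) (h : ∀ i, f.f i = g.f i) :
    f = g := Prod.ext h0 (funext h)
instance (M : ModuleCat.{0} (QA k s t)) : AddCommGroup (PP M) :=
  inferInstanceAs (AddCommGroup (M × (E → M)))
instance (M : ModuleCat.{0} (QA k s t)) : SMul (QA k s t) (PP M) :=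
  ⟨fun x f => PP.mk (pr x • f.m)
    (fun i => x.b (t i) • f.f i + x.e i • ((ea (s i) : QA k s t) • f.m))⟩
@[simp] lemma PP.add_m {M : ModuleCat.{0} (QA k s t)} (f g : PP M) : (f + g).m = f.m + g.m := rfl
@[simp] lemma PP.zero_m {M : ModuleCat.{0} (QA k s t)} : (0 : PP M).m = 0 := rfl
@[simp] lemma PP.smul_m {M : ModuleCat.{0} (QA k s t)} (x : QA k s t) (f : PP M) :
  (x • f).m = pr x • f.m := rfl
@[simp] lemma PP.add_f {M : ModuleCat.{0} (QA k s t)} (f g : PP M) (i : E) :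
  (f + g).f i = f.f i + g.f i := rfl
@[simp] lemma PP.zero_f {M : ModuleCat.{0} (QA k s t)} (i : E) : (0 : PP M).f i = 0 := rfl
@[simp] lemma PP.smul_f {M : ModuleCat.{0} (QA k s t)} (x : QA k s t) (f : PP M) (i : E) :
  (x • f).f i = x.b (t i) • f.f i + x.e i • ((ea (s i) : QA k s t) • f.m) := rfl

instance (M : ModuleCat.{0} (QA k s t)) : Module (QA k s t) (PP M) where
  one_smul f := PP.ext (by simp [pr_one]) fun i => by simp
  mul_smul x y f := PP.ext (by simp [pr_mul, mul_smul]) fun i => by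
    have h : (ea (s i) : QA k s t) • (pr y • f.m) = y.a (s i) • ((ea (s i) : QA k s t) • f.m) := by
      rw [← mul_smul, ea_mul, smul_assoc, pr_a]
    simp only [PP.smul_f, PP.smul_m, QA.mul_b, QA.mul_e, add_smul, mul_smul, smul_add, h]
    abel
  smul_zero x := PP.ext (by simp) fun i => by simp
  smul_add x f g := PP.ext (by simp) fun i => by simp; abel
  add_smul x y f := PP.ext (by simp [pr_add, add_smul]) fun i => by simp [add_smul]; abel
  zero_smul f := PP.ext (by simp [pr_zero]) fun i => by simp

/-- Morphism of modules from a function. -/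
def mkH {A : Type} [Ring A] {M N : ModuleCat.{0} A} (f : M → N)
    (map_add : ∀ x y, f (x + y) = f x + f y) (map_smul : ∀ (c : A) x, f (c • x) = c • f x) : M ⟶ N :=
  ModuleCat.ofHom { toFun := f, map_add' := map_add, map_smul' := map_smul }
lemma mkH_apply {A : Type} [Ring A] {M N : ModuleCat.{0} A} (f : M → N)
    (map_add : ∀ x y, f (x + y) = f x + f y) (map_smul : ∀ (c : A) x, f (c • x) = c • f x) (x : M) :
    (mkH f map_add map_smul).hom x = f x := rfl

/-- The kernel object. -/
def KM (M : ModuleCat.{0} (QA k s t)) : ModuleCat.{0} (QA k s t) := ModuleCat.of _ (KK M)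
/-- The projective cover. -/
def PM (M : ModuleCat.{0} (QA k s t)) : ModuleCat.{0} (QA k s t) := ModuleCat.of _ (PP M)

namespace KM
variable {M : ModuleCat.{0} (QA k s t)}
/-- Underlying function. -/
def g (f : KM M) : E → M := KK.g f
/-- Constructor. -/
def mk (f : E → M) : KM M := (f : KK M)
@[simp] lemma mk_g (f : E → M) : g (mk f) = f := rfl
lemma ext {f f' : KM M} (h : ∀ i, g f i = g f' i) : f = f' := KK.ext h
@[simp] lemma add_g (f f' : KM M) (i : E) : g (f + f') i = g f i + g f' i := rfl
@[simp] lemma zero_g (i : E) : g (0 : KM M) i = 0 := rfl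
@[simp] lemma smul_g (x : QA k s t) (f : KM M) (i : E) : g (x • f) i = x.b (t i) • g f i := rfl
@[simp] lemma ksmul_g (c : k) (f : KM M) (i : E) : g (c • f) i = c • g f i := by
  rw [ksmul_def, smul_g, algebraMap_b]
/-- Coordinates as additive maps. -/
def gH (i : E) : KM M →+ M := ⟨⟨fun f => g f i, rfl⟩, fun _ _ => rfl⟩
@[simp] lemma sum_g {ι : Type} (S : Finset ι) (f : ι → KM M) (i : E) :
    g (∑ j ∈ S, f j) i = ∑ j ∈ S, g (f j) i := map_sum (gH i) f S
end KM

namespace PM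
variable {M : ModuleCat.{0} (QA k s t)}
/-- First component. -/
def m (x : PM M) : M := PP.m x
/-- Second component. -/
def f (x : PM M) : E → M := PP.f x
/-- Constructor. -/
def mk (x : M) (f : E → M) : PM M := PP.mk x f
@[simp] lemma mk_m (x : M) (f : E → M) : m (mk x f) = x := rfl
@[simp] lemma mk_f (x : M) (g : E → M) : f (mk x g) = g := rfl
lemma ext {x y : PM M} (h0 : m x = m y) (h : ∀ i, f x i = f y i) : x = y := PP.ext h0 h
@[simp] lemma add_m (x y : PM M) : m (x + y) = m x + m y := rfl
@[simp] lemma add_f (x y : PM M) (i : E) : f (x + y) i = f x i + f y i := rfl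
@[simp] lemma zero_m : m (0 : PM M) = 0 := rfl
@[simp] lemma zero_f (i : E) : f (0 : PM M) i = 0 := rfl
@[simp] lemma smul_m (x : QA k s t) (y : PM M) : m (x • y) = pr x • m y := rfl
@[simp] lemma smul_f (x : QA k s t) (y : PM M) (i : E) :
  f (x • y) i = x.b (t i) • f y i + x.e i • ((ea (s i) : QA k s t) • m y) := rfl
@[simp] lemma ksmul_m (c : k) (x : PM M) : m (c • x) = c • m x := by
  rw [ksmul_def, smul_m, pr_algebraMap, ksmul_def]
@[simp] lemma ksmul_f (c : k) (x : PM M) (i : E) : f (c • x) i = c • f x i := by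
  rw [ksmul_def, smul_f, algebraMap_b, algebraMap_e, zero_smul, add_zero]
/-- Coordinates as additive maps. -/
def mH : PM M →+ M := ⟨⟨fun x => m x, rfl⟩, fun _ _ => rfl⟩
/-- Coordinates as additive maps. -/
def fH (i : E) : PM M →+ M := ⟨⟨fun x => f x i, rfl⟩, fun _ _ => rfl⟩
@[simp] lemma sum_m {ι : Type} (S : Finset ι) (x : ι → PM M) :
    m (∑ j ∈ S, x j) = ∑ j ∈ S, m (x j) := map_sum mH x S
@[simp] lemma sum_f {ι : Type} (S : Finset ι) (x : ι → PM M) (i : E) :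
    f (∑ j ∈ S, x j) i = ∑ j ∈ S, f (x j) i := map_sum (fH i) x S
end PM

/-- Morphisms out of `KM`. -/
def KM.desc {M N : ModuleCat.{0} (QA k s t)} (w : E → M →ₗ[k] N)
    (hw : ∀ i m, (eb (t i) : QA k s t) • w i m = w i m) : KM M ⟶ N :=
  mkH (fun f => ∑ i, w i (KM.g f i))
      (fun f g => by simp [Finset.sum_add_distrib])
      (fun x f => by
        rw [Finset.smul_sum]
        refine Finset.sum_congr rfl fun i _ => ?_
        rw [KM.smul_g, map_smul]
        conv_rhs => rw [← hw, ← mul_smul, mul_eb, smul_assoc, hw])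

lemma eq_pr_smul (x : QA k s t) {N : ModuleCat.{0} (QA k s t)} (n : N) :
    x • n = pr x • n + ∑ i, x.e i • ((ee i : QA k s t) • n) := by
  conv_lhs => rw [eq_pr x, add_smul, Finset.sum_smul]
  simp only [smul_assoc]

/-- Morphisms out of `PM`. -/
def PM.desc {M N : ModuleCat.{0} (QA k s t)} (u : M →ₗ[k] N) (w : E → M →ₗ[k] N)
    (hu : ∀ (x : QA k s t) m, u (pr x • m) = pr x • u m)
    (hw : ∀ i m, (eb (t i) : QA k s t) • w i m = w i m)
    (huw : ∀ i m, w i ((ea (s i) : QA k s t) • m) = (ee i : QA k s t) • u m) : PM M ⟶ N :=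
  mkH (fun f => u (PM.m f) + ∑ i, w i (PM.f f i))
      (fun f g => by simp [Finset.sum_add_distrib]; abel)
      (fun x f => by
        rw [smul_add, Finset.smul_sum, PM.smul_m, hu]
        rw [eq_pr_smul x (u (PM.m f))]
        rw [add_assoc, ← Finset.sum_add_distrib]
        congr 1
        refine Finset.sum_congr rfl fun i _ => ?_
        rw [PM.smul_f, map_add, map_smul, map_smul, huw, add_comm]
        congr 1
        conv_rhs => rw [← hw, ← mul_smul, mul_eb, smul_assoc, hw])

lemma exists_section {M N : ModuleCat.{0} (QA k s t)} (q : M ⟶ N) [Epi q] :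
    ∃ σ : N →ₗ[k] M, ∀ n, q.hom (σ n) = n := by
  obtain ⟨σ, hσ⟩ := LinearMap.exists_rightInverse_of_surjective (homL (k := k) q)
    (LinearMap.range_eq_top.2 ((ModuleCat.epi_iff_surjective q).1 inferInstance))
  exact ⟨σ, fun n => congrArg (fun h => h n) hσ⟩

/-- Inclusion of a summand. -/
def KM.single (M : ModuleCat.{0} (QA k s t)) (i : E) : M →ₗ[k] KM M where
  toFun m := KM.mk (Pi.single i m : E → M)
  map_add' m n := KM.ext fun j => by
    simp only [KM.mk_g, KM.add_g, Pi.single_add, Pi.add_apply]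
  map_smul' c m := KM.ext fun j => by
    simp only [KM.mk_g, KM.ksmul_g, Pi.single_smul, Pi.smul_apply, RingHom.id_apply]

lemma KM.single_apply (M : ModuleCat.{0} (QA k s t)) (i : E) (m : M) :
    KM.single M i m = KM.mk (Pi.single i m : E → M) := rfl
lemma KM.single_same (M : ModuleCat.{0} (QA k s t)) (i : E) (m : M) :
    KM.g (KM.single M i m) i = m := by simp [KM.single_apply]
lemma KM.single_ne (M : ModuleCat.{0} (QA k s t)) (i j : E) (h : j ≠ i) (m : M) :
    KM.g (KM.single M i m) j = 0 := by simp [KM.single_apply, h]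

lemma KM.smul_single (M : ModuleCat.{0} (QA k s t)) (x : QA k s t) (i : E) (m : M) :
    x • KM.single M i m = x.b (t i) • KM.single M i m := by
  refine KM.ext fun j => ?_
  rw [KM.ksmul_g, KM.smul_g]
  by_cases h : j = i
  · rw [h]
  · rw [KM.single_ne _ _ _ h, smul_zero, smul_zero]

lemma KM.eq_sum (M : ModuleCat.{0} (QA k s t)) (f : KM M) :
    f = ∑ i, KM.single M i (KM.g f i) := by
  refine KM.ext fun j => ?_
  rw [KM.sum_g, Finset.sum_eq_single j, KM.single_same]
  · intro i _ h
    rw [KM.single_ne _ _ _ h.symm]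
  · simp

instance KM_projective (M : ModuleCat.{0} (QA k s t)) : Projective (KM M) := by
  refine ⟨fun {N' N} φ q hq => ?_⟩
  obtain ⟨σ, hσ⟩ := exists_section q
  refine ⟨KM.desc (fun i => smulL (eb (t i)) N' ∘ₗ σ ∘ₗ homL φ ∘ₗ KM.single M i) ?_, ?_⟩
  · intro i m
    simp only [LinearMap.comp_apply, smulL_apply]
    rw [← mul_smul, eb_mul_eb]
  · ext f
    change q.hom (∑ i, (eb (t i) : QA k s t) • σ (φ.hom (KM.single M i (KM.g f i)))) = φ.hom f
    conv_rhs => rw [KM.eq_sum M f]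
    rw [map_sum, map_sum]
    refine Finset.sum_congr rfl fun i _ => ?_
    rw [map_smul, hσ, ← map_smul, KM.smul_single]
    simp

/-- Inclusion of `M`. -/
def PM.inl (M : ModuleCat.{0} (QA k s t)) : M →ₗ[k] PM M where
  toFun m := PM.mk m 0
  map_add' m n := PM.ext (by simp) fun i => by simp
  map_smul' c m := PM.ext (by simp) fun i => by simp

/-- Inclusion of a summand. -/
def PM.inr (M : ModuleCat.{0} (QA k s t)) (i : E) : M →ₗ[k] PM M where
  toFun m := PM.mk 0 (Pi.single i m : E → M)
  map_add' m n := PM.ext (by simp) fun j => by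
    simp only [PM.mk_f, PM.add_f, Pi.single_add, Pi.add_apply]
  map_smul' c m := PM.ext (by simp) fun j => by
    simp only [PM.mk_f, PM.ksmul_f, Pi.single_smul, Pi.smul_apply, RingHom.id_apply]

lemma PM.inr_apply (M : ModuleCat.{0} (QA k s t)) (i : E) (m : M) :
    PM.inr M i m = PM.mk 0 (Pi.single i m : E → M) := rfl
lemma PM.inr_same (M : ModuleCat.{0} (QA k s t)) (i : E) (m : M) :
    PM.f (PM.inr M i m) i = m := by simp [PM.inr_apply]
lemma PM.inr_ne (M : ModuleCat.{0} (QA k s t)) (i j : E) (h : j ≠ i) (m : M) :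
    PM.f (PM.inr M i m) j = 0 := by simp [PM.inr_apply, h]
lemma PM.inr_m (M : ModuleCat.{0} (QA k s t)) (i : E) (m : M) : PM.m (PM.inr M i m) = 0 := rfl
lemma PM.inl_m (M : ModuleCat.{0} (QA k s t)) (m : M) : PM.m (PM.inl M m) = m := rfl
lemma PM.inl_f (M : ModuleCat.{0} (QA k s t)) (m : M) (i : E) : PM.f (PM.inl M m) i = 0 := rfl

lemma PM.smul_inr (M : ModuleCat.{0} (QA k s t)) (x : QA k s t) (i : E) (m : M) :
    x • PM.inr M i m = x.b (t i) • PM.inr M i m := by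
  refine PM.ext ?_ fun j => ?_
  · rw [PM.ksmul_m, PM.smul_m, PM.inr_m, smul_zero, smul_zero]
  · rw [PM.ksmul_f, PM.smul_f, PM.inr_m, smul_zero, smul_zero, add_zero]
    by_cases h : j = i
    · rw [h]
    · rw [PM.inr_ne _ _ _ h, smul_zero, smul_zero]

lemma PM.pr_smul_inl (M : ModuleCat.{0} (QA k s t)) (x : QA k s t) (m : M) :
    pr x • PM.inl M m = PM.inl M (pr x • m) := by
  refine PM.ext rfl fun j => ?_
  rw [PM.smul_f, PM.inl_f, PM.inl_f, pr_e, zero_smul, smul_zero, add_zero]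

lemma PM.ee_smul_inl (M : ModuleCat.{0} (QA k s t)) (i : E) (m : M) :
    (ee i : QA k s t) • PM.inl M m = PM.inr M i ((ea (s i) : QA k s t) • m) := by
  refine PM.ext ?_ fun j => ?_
  · rw [PM.smul_m, PM.inr_m, PM.inl_m]
    have : pr (ee i : QA k s t) = 0 :=
      QA.ext' (fun _ => by simp) (fun _ => by simp) (fun _ => by simp)
    rw [this, zero_smul]
  · rw [PM.smul_f, PM.inl_f, PM.inl_m, smul_zero, zero_add, ee_e]
    by_cases h : j = i
    · subst h
      rw [PM.inr_same, if_pos rfl, one_smul]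
    · rw [PM.inr_ne _ _ _ h, if_neg h, zero_smul]

lemma PM.eq_sum (M : ModuleCat.{0} (QA k s t)) (f : PM M) :
    f = PM.inl M (PM.m f) + ∑ i, PM.inr M i (PM.f f i) := by
  refine PM.ext ?_ fun j => ?_
  · rw [PM.add_m, PM.sum_m, PM.inl_m, Finset.sum_eq_zero fun i _ => PM.inr_m M i _, add_zero]
  · rw [PM.add_f, PM.sum_f, PM.inl_f, Finset.sum_eq_single j, PM.inr_same, zero_add]
    · intro i _ h
      rw [PM.inr_ne _ _ _ h.symm]
    · simp

lemma pr_ea (i : SA) : pr (ea i : QA k s t) = ea i :=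
  QA.ext' (fun _ => rfl) (fun _ => rfl) (fun _ => rfl)
lemma pr_eb (i : SB) : pr (eb i : QA k s t) = eb i :=
  QA.ext' (fun _ => rfl) (fun _ => rfl) (fun _ => rfl)

instance PM_projective (M : ModuleCat.{0} (QA k s t)) : Projective (PM M) := by
  refine ⟨fun {N' N} φ q hq => ?_⟩
  obtain ⟨σ, hσ⟩ := exists_section q
  let u : M →ₗ[k] N' :=
    ∑ i, smulL (ea i) N' ∘ₗ σ ∘ₗ homL φ ∘ₗ PM.inl M ∘ₗ smulL (ea i) M +
    ∑ i, smulL (eb i) N' ∘ₗ σ ∘ₗ homL φ ∘ₗ PM.inl M ∘ₗ smulL (eb i) M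
  have hu0 : ∀ m, u m = ∑ i, (ea i : QA k s t) • σ (φ.hom (PM.inl M ((ea i : QA k s t) • m))) +
      ∑ i, (eb i : QA k s t) • σ (φ.hom (PM.inl M ((eb i : QA k s t) • m))) := by
    intro m
    simp only [u, LinearMap.add_apply, LinearMap.sum_apply, LinearMap.comp_apply, smulL_apply,
      homL_apply]
  have hu : ∀ (x : QA k s t) m, u (pr x • m) = pr x • u m := by
    intro x m
    rw [hu0, hu0, smul_add, Finset.smul_sum, Finset.smul_sum]
    congr 1
    · refine Finset.sum_congr rfl fun i _ => ?_
      have h : pr x * (ea i : QA k s t) = x.a i • ea i :=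
        ext' (fun j => by by_cases hj : j = i <;> simp [hj]) (fun j => by simp) (fun j => by simp)
      rw [← mul_smul, ← mul_smul, ea_mul, h, pr_a]
      simp only [smul_assoc]
      rw [← homL_apply (k := k) φ, map_smul, map_smul, map_smul, smul_comm]
      rfl
    · refine Finset.sum_congr rfl fun i _ => ?_
      have h : (eb i : QA k s t) * pr x = x.b i • eb i :=
        ext' (fun j => by simp) (fun j => by by_cases hj : j = i <;> simp [hj]) (fun j => by simp)
      rw [← mul_smul, ← mul_smul, mul_eb, h, pr_b]
      simp only [smul_assoc]
      rw [← homL_apply (k := k) φ, map_smul, map_smul, map_smul, smul_comm]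
      rfl
  have hqu : ∀ m, q.hom (u m) = φ.hom (PM.inl M m) := by
    intro m
    have : m = (∑ i, (ea i : QA k s t) • m) + ∑ i, (eb i : QA k s t) • m := by
      rw [← Finset.sum_smul, ← Finset.sum_smul, ← add_smul, ← one_eq, one_smul]
    conv_rhs => rw [this]
    rw [hu0]
    simp only [map_add, map_sum, map_smul, hσ]
    congr 1
    · refine Finset.sum_congr rfl fun i _ => ?_
      rw [← map_smul φ.hom, ← pr_ea, PM.pr_smul_inl, ← mul_smul, pr_ea, ea_mul_ea]
    · refine Finset.sum_congr rfl fun i _ => ?_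
      rw [← map_smul φ.hom, ← pr_eb, PM.pr_smul_inl, ← mul_smul, pr_eb, eb_mul_eb]
  refine ⟨PM.desc u (fun i => smulL (ee i) N' ∘ₗ u + smulL (eb (t i)) N' ∘ₗ σ ∘ₗ homL φ ∘ₗ
    PM.inr M i ∘ₗ (LinearMap.id - smulL (ea (s i)) M)) hu ?_ ?_, ?_⟩
  · intro i m
    simp only [LinearMap.comp_apply, smulL_apply, LinearMap.add_apply, smul_add]
    rw [← mul_smul, ← mul_smul, eb_mul_eb, mul_ee]
    simp
  · intro i m
    simp only [LinearMap.comp_apply, smulL_apply, LinearMap.add_apply, LinearMap.sub_apply,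
      LinearMap.id_apply]
    rw [← mul_smul, ea_mul_ea, sub_self, map_zero, map_zero, map_zero, smul_zero, add_zero,
      ← pr_ea, hu, ← mul_smul, ee_mul]
    simp
  · ext f
    change q.hom (u (PM.m f) + ∑ i, ((ee i : QA k s t) • u (PM.f f i) + (eb (t i) : QA k s t) •
      σ (φ.hom (PM.inr M i (PM.f f i - (ea (s i) : QA k s t) • PM.f f i))))) = φ.hom f
    conv_rhs => rw [PM.eq_sum M f]
    rw [map_add, map_sum, map_add, map_sum, hqu]
    congr 1
    refine Finset.sum_congr rfl fun i _ => ?_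
    rw [map_add, map_smul, map_smul, hσ, hqu, ← map_smul φ.hom, ← map_smul φ.hom, ← map_add,
      PM.ee_smul_inl, PM.smul_inr]
    simp

/-- The surjection. -/
def PM.p (M : ModuleCat.{0} (QA k s t)) : PM M ⟶ M :=
  PM.desc LinearMap.id (fun i => smulL (ee i) M) (fun _ _ => rfl)
    (fun i m => by rw [smulL_apply, ← mul_smul, mul_ee]; simp)
    (fun i m => by rw [smulL_apply, ← mul_smul, ee_mul]; simp)

lemma PM.p_apply (M : ModuleCat.{0} (QA k s t)) (f : PM M) :
    (PM.p M).hom f = PM.m f + ∑ i, (ee i : QA k s t) • PM.f f i := rfl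

/-- The injection. -/
def KM.i (M : ModuleCat.{0} (QA k s t)) : KM M ⟶ PM M :=
  mkH (fun f => PM.mk (- ∑ i, (ee i : QA k s t) • KM.g f i) (KM.g f))
      (fun f g => PM.ext (by simp [Finset.sum_add_distrib]; abel) fun i => rfl)
      (fun x f => PM.ext (by
        rw [PM.smul_m, PM.mk_m, PM.mk_m, smul_neg, Finset.smul_sum]
        congr 1
        refine Finset.sum_congr rfl fun i _ => ?_
        rw [← mul_smul, mul_ee, KM.smul_g, pr_b, smul_assoc, smul_comm]) fun i => by
        rw [PM.smul_f, PM.mk_m, PM.mk_f, PM.mk_f, smul_neg, Finset.smul_sum,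
          Finset.sum_eq_zero, neg_zero, smul_zero, add_zero, KM.smul_g]
        intro j _
        rw [← mul_smul, ea_mul]
        simp)

lemma KM.i_apply (M : ModuleCat.{0} (QA k s t)) (f : KM M) :
    (KM.i M).hom f = PM.mk (- ∑ i, (ee i : QA k s t) • KM.g f i) (KM.g f) := rfl

lemma KM.i_p (M : ModuleCat.{0} (QA k s t)) : KM.i M ≫ PM.p M = 0 := by
  ext f
  change (PM.p M).hom ((KM.i M).hom f) = 0
  rw [PM.p_apply, KM.i_apply]
  simp

/-- A criterion for short exactness. -/
lemma shortExact_of {A : Type} [Ring A] {X Y Z : ModuleCat.{0} A} (f : X ⟶ Y) (g : Y ⟶ Z)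
    (w : f ≫ g = 0)
    (hf : ∀ x, f.hom x = 0 → x = 0) (hg : ∀ z, ∃ y, g.hom y = z)
    (h : ∀ y, g.hom y = 0 → ∃ x, f.hom x = y) : (ShortComplex.mk f g w).ShortExact where
  exact := (ShortComplex.moduleCat_exact_iff _).2 h
  mono_f := (ModuleCat.mono_iff_injective _).2 ((injective_iff_map_eq_zero f.hom).2 hf)
  epi_g := (ModuleCat.epi_iff_surjective _).2 hg

theorem QA_hereditary : IsHereditaryAlg (QA k s t) := by
  intro M N i hi
  have := ext_zero_of_ses (R := ℤ) (KM.i M) (PM.p M) (KM.i_p M) (shortExact_of _ _ _ ?_ ?_ ?_) N i hi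
  · exact ModuleCat.subsingleton_of_isZero this
  · intro f hf
    exact KM.ext fun i => congrArg (fun z : PM M => PM.f z i) hf
  · intro m
    exact ⟨PM.mk m 0, by rw [PM.p_apply]; simp⟩
  · intro f hf
    refine ⟨KM.mk (PM.f f), ?_⟩
    rw [KM.i_apply]
    rw [PM.p_apply] at hf
    exact PM.ext (eq_neg_of_add_eq_zero_left hf).symm fun i => rfl

end PartK

section PartM
set_option linter.unusedSectionVars false
open scoped ModuleCat.Algebra
open QA

variable {k : Type} [Field k] {SA SB E : Type} {s : E → SA} {t : E → SB}
variable [DecidableEq SA] [DecidableEq SB] [DecidableEq E] [Fintype SA] [Fintype SB] [Fintype E]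

lemma finite_of_coord {V : Type} [AddCommGroup V] [Module k V] [Module.Finite k V]
    (M : ModuleCat.{0} (QA k s t)) (f : V →ₗ[k] M) (hf : Function.Surjective f) :
    Module.Finite (QA k s t) M := by
  have : Module.Finite k M := Module.Finite.of_surjective f hf
  exact Module.Finite.of_restrictScalars_finite k (QA k s t) M

/-- Semisimple module at sources. -/
def RM (k : Type) [Field k] (s : E → SA) (t : E → SB) {C : Type} (l : C → SA) :
    ModuleCat.{0} (QA k s t) :=
  letI : Module (QA k s t) (C → k) :=
    { smul := fun x m c => x.a (l c) * m c
      one_smul := fun m => funext fun c => one_mul _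
      mul_smul := fun x y m => funext fun c => mul_assoc _ _ _
      smul_zero := fun x => funext fun c => mul_zero _
      smul_add := fun x m n => funext fun c => mul_add _ _ _
      add_smul := fun x y m => funext fun c => add_mul _ _ _
      zero_smul := fun m => funext fun c => zero_mul _ }
  ModuleCat.of (QA k s t) (C → k)

namespace RM
variable {C : Type} {l : C → SA}
/-- Coordinates. -/
def g (f : RM k s t l) : C → k := f
/-- Constructor. -/
def mk (f : C → k) : RM k s t l := f
@[simp] lemma mk_g (f : C → k) : g (mk f : RM k s t l) = f := rfl
lemma ext {f f' : RM k s t l} (h : ∀ i, g f i = g f' i) : f = f' := funext h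
@[simp] lemma add_g (f f' : RM k s t l) (i : C) : g (f + f') i = g f i + g f' i := rfl
@[simp] lemma zero_g (i : C) : g (0 : RM k s t l) i = 0 := rfl
@[simp] lemma smul_g (x : QA k s t) (f : RM k s t l) (i : C) : g (x • f) i = x.a (l i) * g f i := rfl
@[simp] lemma ksmul_g (c : k) (f : RM k s t l) (i : C) : g (c • f) i = c * g f i := by
  rw [ksmul_def, smul_g, algebraMap_a]
/-- Coordinates as linear maps. -/
def gL (i : C) : RM k s t l →ₗ[k] k where
  toFun f := g f i
  map_add' _ _ := rfl
  map_smul' c f := ksmul_g c f i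
@[simp] lemma gL_apply (i : C) (f : RM k s t l) : gL i f = g f i := rfl

instance [Finite C] : Module.Finite (QA k s t) (RM k s t l) :=
  finite_of_coord (V := C → k) _
    { toFun := fun f => mk f
      map_add' := fun f f' => RM.ext fun i => by simp
      map_smul' := fun c f => RM.ext fun i => by simp } (fun f => ⟨g f, rfl⟩)

lemma isI : IsI (fun c => (ea (l c) : QA k s t)) (RM k s t l) (fun c => gL c) where
  eθ c m := by simp
  ex M ψ hψ := ⟨mkH (fun m => RM.mk fun c => ψ c m) (fun x y => RM.ext fun i => by simp)
    (fun x m => RM.ext fun i => by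
      rw [smul_g, mk_g, mk_g, ← hψ, ← mul_smul, ea_mul, smul_assoc, map_smul, hψ, smul_eq_mul]),
    fun i m => rfl⟩
  uniq M g g' h := by
    ext m
    exact RM.ext fun i => h i m

instance : Injective (RM k s t l) := isI.injective (k := k) (fun _ => ea_mul_ea _)

end RM

/-- Modules with one-dimensional part at a sink. -/
def TM (k : Type) [Field k] (s : E → SA) (t : E → SB) {C : Type} [Fintype C] (b : SB) (ι : C → E)
    (h : ∀ c, t (ι c) = b) : ModuleCat.{0} (QA k s t) :=
  letI : Module (QA k s t) (k × (C → k)) :=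
    { smul := fun x m => (x.b b * m.1 + ∑ c, x.e (ι c) * m.2 c, fun c => x.a (s (ι c)) * m.2 c)
      one_smul := fun m => Prod.ext
        (by change (1 : QA k s t).b b * m.1 + ∑ c, (1 : QA k s t).e (ι c) * m.2 c = _; simp)
        (funext fun c => one_mul _)
      mul_smul := fun x y m => Prod.ext
        (by
          change (x * y).b b * m.1 + ∑ c, (x * y).e (ι c) * m.2 c =
            x.b b * (y.b b * m.1 + ∑ c, y.e (ι c) * m.2 c) +
              ∑ c, x.e (ι c) * (y.a (s (ι c)) * m.2 c)
          simp only [QA.mul_b, QA.mul_e, h, mul_add, Finset.mul_sum, add_assoc,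
            ← Finset.sum_add_distrib, add_mul, mul_assoc])
        (funext fun c => mul_assoc _ _ _)
      smul_zero := fun x => Prod.ext
        (by
          change x.b b * (0 : k) + ∑ c, x.e (ι c) * (0 : k) = (0 : k)
          simp)
        (funext fun c => mul_zero _)
      smul_add := fun x m n => Prod.ext
        (by
          change x.b b * (m.1 + n.1) + ∑ c, x.e (ι c) * (m.2 c + n.2 c) =
            x.b b * m.1 + ∑ c, x.e (ι c) * m.2 c + (x.b b * n.1 + ∑ c, x.e (ι c) * n.2 c)
          simp only [mul_add, Finset.sum_add_distrib]
          ring)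
        (funext fun c => mul_add _ _ _)
      add_smul := fun x y m => Prod.ext
        (by
          change (x + y).b b * m.1 + ∑ c, (x + y).e (ι c) * m.2 c =
            x.b b * m.1 + ∑ c, x.e (ι c) * m.2 c + (y.b b * m.1 + ∑ c, y.e (ι c) * m.2 c)
          simp only [QA.add_b, QA.add_e, add_mul, Finset.sum_add_distrib]
          ring)
        (funext fun c => add_mul _ _ _)
      zero_smul := fun m => Prod.ext
        (by change (0 : QA k s t).b b * m.1 + ∑ c, (0 : QA k s t).e (ι c) * m.2 c = _; simp)
        (funext fun c => zero_mul _) }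
  ModuleCat.of (QA k s t) (k × (C → k))

namespace TM
variable {C : Type} [Fintype C] {b : SB} {ι : C → E} {h : ∀ c, t (ι c) = b}
/-- Coordinate. -/
def n (f : TM k s t b ι h) : k := Prod.fst (α := k) (β := C → k) f
/-- Coordinates. -/
def m (f : TM k s t b ι h) : C → k := Prod.snd (α := k) (β := C → k) f
/-- Constructor. -/
def mk (n : k) (f : C → k) : TM k s t b ι h := ((n, f) : k × (C → k))
@[simp] lemma mk_n (x : k) (f : C → k) : n (mk x f : TM k s t b ι h) = x := rfl
@[simp] lemma mk_m (x : k) (f : C → k) : m (mk x f : TM k s t b ι h) = f := rfl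
lemma ext {f f' : TM k s t b ι h} (h0 : n f = n f') (h : ∀ i, m f i = m f' i) : f = f' :=
  Prod.ext (α := k) (β := C → k) h0 (funext h)
@[simp] lemma add_n (f f' : TM k s t b ι h) : n (f + f') = n f + n f' := rfl
@[simp] lemma add_m (f f' : TM k s t b ι h) (i : C) : m (f + f') i = m f i + m f' i := rfl
@[simp] lemma zero_n : n (0 : TM k s t b ι h) = 0 := rfl
@[simp] lemma zero_m (i : C) : m (0 : TM k s t b ι h) i = 0 := rfl
@[simp] lemma smul_n (x : QA k s t) (f : TM k s t b ι h) :
    n (x • f) = x.b b * n f + ∑ c, x.e (ι c) * m f c := rfl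
@[simp] lemma smul_m (x : QA k s t) (f : TM k s t b ι h) (i : C) :
    m (x • f) i = x.a (s (ι i)) * m f i := rfl
@[simp] lemma ksmul_n (c : k) (f : TM k s t b ι h) : n (c • f) = c * n f := by
  rw [ksmul_def, smul_n, algebraMap_b]; simp
@[simp] lemma ksmul_m (c : k) (f : TM k s t b ι h) (i : C) : m (c • f) i = c * m f i := by
  rw [ksmul_def, smul_m, algebraMap_a]
/-- Coordinate as linear map. -/
def nL : TM k s t b ι h →ₗ[k] k where
  toFun f := n f
  map_add' _ _ := rfl
  map_smul' c f := ksmul_n c f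
@[simp] lemma nL_apply (f : TM k s t b ι h) : nL f = n f := rfl

instance : Module.Finite (QA k s t) (TM k s t b ι h) :=
  finite_of_coord (V := k × (C → k)) _
    { toFun := fun f => mk f.1 f.2
      map_add' := fun f f' => TM.ext (by simp) fun i => by simp
      map_smul' := fun c f => TM.ext (by simp) fun i => by simp } (fun f => ⟨f, rfl⟩)

lemma n_ee (hinj : Function.Injective ι) (c : C) (f : TM k s t b ι h) :
    n ((ee (ι c) : QA k s t) • f) = m f c := by
  classical
  rw [smul_n]
  simp [hinj.eq_iff]

lemma isI (hinj : Function.Injective ι) (hsurj : ∀ e, t e = b → ∃ c, ι c = e) :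
    IsI (fun _ : Unit => (eb b : QA k s t)) (TM k s t b ι h) (fun _ => nL) where
  eθ c m := by simp
  ex M ψ hψ := by
    have key : ∀ x : QA k s t, eb b * x = x.b b • eb b + ∑ c, x.e (ι c) • ee (ι c) := by
      intro x
      refine QA.ext' (fun i => by simp) (fun i => by by_cases hi : i = b <;> simp [hi]) fun i => ?_
      by_cases hi : t i = b
      · obtain ⟨c, rfl⟩ := hsurj i hi
        classical
        simp [h, hinj.eq_iff]
      · have : ∀ c, i ≠ ι c := fun c hc => hi (hc ▸ h c)
        simp [hi, this]
    refine ⟨mkH (fun m => TM.mk (ψ () m) fun c => ψ () ((ee (ι c) : QA k s t) • m))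
      (fun x y => TM.ext (by simp) fun i => by simp)
      (fun x y => TM.ext ?_ fun i => ?_), fun i m => rfl⟩
    · rw [smul_n, mk_n, mk_n, mk_m, ← hψ, ← mul_smul, key, add_smul, Finset.sum_smul]
      simp only [map_add, map_sum, smul_assoc, map_smul, hψ, smul_eq_mul]
    · rw [smul_m, mk_m, mk_m, ← mul_smul, ee_mul, smul_assoc, map_smul, smul_eq_mul]
  uniq M g g' hg := by
    ext y
    refine TM.ext (hg () y) fun i => ?_
    rw [← n_ee hinj, ← n_ee hinj, ← map_smul, ← map_smul]
    exact hg () _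

lemma isP [IsEmpty C] : IsP (eb b : QA k s t) (TM k s t b ι h) (TM.mk 1 0) where
  eu := TM.ext (by simp) fun i => isEmptyElim i
  ex M v hv := ⟨mkH (fun f => n f • v) (fun x y => by rw [add_n, add_smul]) (fun x y => by
      have : x • v = x.b b • v := by
        conv_lhs => rw [← hv, ← mul_smul, mul_eb, smul_assoc, hv]
      rw [smul_n, Finset.univ_eq_empty, Finset.sum_empty, add_zero, smul_comm, this, smul_smul,
        mul_comm, ← smul_smul, smul_comm]), by rw [mkH_apply, mk_n, one_smul]⟩
  uniq M g g' hg := by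
    ext y
    have : y = n y • (TM.mk 1 0) := TM.ext (by simp) fun i => isEmptyElim i
    rw [this, ← homL_apply (k := k), ← homL_apply (k := k), map_smul, map_smul]
    exact congrArg _ hg

variable {C' D : Type} [Fintype C'] [Fintype D]
/-- Inclusion. -/
def inc {ι : C' ⊕ D → E} {h : ∀ c, t (ι c) = b} {h' : ∀ c, t (ι (Sum.inl c)) = b} :
    TM k s t b (fun c => ι (Sum.inl c)) h' ⟶ TM k s t b ι h :=
  mkH (fun f => mk (n f) (Sum.elim (m f) 0))
    (fun x y => TM.ext (by simp) fun i => by cases i <;> simp)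
    (fun x y => TM.ext (by simp) fun i => by cases i <;> simp)

/-- Projection. -/
def proj {ι : C' ⊕ D → E} {h : ∀ c, t (ι c) = b} :
    TM k s t b ι h ⟶ RM k s t (fun d => s (ι (Sum.inr d))) :=
  mkH (fun f => RM.mk fun d => m f (Sum.inr d))
    (fun x y => RM.ext fun i => by simp)
    (fun x y => RM.ext fun i => by simp)

lemma inc_apply {ι : C' ⊕ D → E} {h : ∀ c, t (ι c) = b} {h' : ∀ c, t (ι (Sum.inl c)) = b}
    (f : TM k s t b (fun c => ι (Sum.inl c)) h') :
    (inc (h := h)).hom f = mk (n f) (Sum.elim (m f) 0) := rfl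
lemma proj_apply {ι : C' ⊕ D → E} {h : ∀ c, t (ι c) = b} (f : TM k s t b ι h) :
    proj.hom f = RM.mk fun d => m f (Sum.inr d) := rfl

lemma inc_proj {ι : C' ⊕ D → E} {h : ∀ c, t (ι c) = b} {h' : ∀ c, t (ι (Sum.inl c)) = b} :
    inc (k := k) (s := s) (h := h) (h' := h') ≫ proj = 0 := by
  ext f
  exact RM.ext fun i => rfl

lemma inc_proj_exact {ι : C' ⊕ D → E} {h : ∀ c, t (ι c) = b} {h' : ∀ c, t (ι (Sum.inl c)) = b} :
    (ShortComplex.mk _ _ (inc_proj (k := k) (s := s) (h := h) (h' := h'))).ShortExact := by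
  refine shortExact_of _ _ _ ?_ ?_ ?_
  · intro f hf
    rw [inc_apply] at hf
    refine TM.ext ?_ fun i => ?_
    · simpa using congrArg n hf
    · simpa using congrArg (fun z => m z (Sum.inl i)) hf
  · intro z
    exact ⟨mk 0 (Sum.elim 0 (RM.g z)), RM.ext fun i => rfl⟩
  · intro y hy
    refine ⟨mk (n y) (fun c => m y (Sum.inl c)), TM.ext rfl fun i => ?_⟩
    cases i with
    | inl i => rfl
    | inr i => exact (congrArg (fun z => RM.g z i) hy).symm

end TM

/-- Projective modules of sources. -/
def AM (k : Type) [Field k] (s : E → SA) (t : E → SB) {C : Type} (a : SA) (ι : C → E)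
    (h : ∀ c, s (ι c) = a) : ModuleCat.{0} (QA k s t) :=
  letI : Module (QA k s t) (k × (C → k)) :=
    { smul := fun x m => (x.a a * m.1, fun c => x.b (t (ι c)) * m.2 c + x.e (ι c) * m.1)
      one_smul := fun m => Prod.ext (one_mul _)
        (funext fun c => by
          change (1 : QA k s t).b _ * m.2 c + (1 : QA k s t).e _ * m.1 = m.2 c
          simp)
      mul_smul := fun x y m => Prod.ext (mul_assoc _ _ _)
        (funext fun c => by
          change (x * y).b _ * m.2 c + (x * y).e _ * m.1 =
            x.b (t (ι c)) * (y.b (t (ι c)) * m.2 c + y.e (ι c) * m.1) + x.e (ι c) * (y.a a * m.1)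
          simp only [QA.mul_b, QA.mul_e, h]
          ring)
      smul_zero := fun x => Prod.ext (mul_zero _)
        (funext fun c => by
          change x.b (t (ι c)) * (0 : k) + x.e (ι c) * (0 : k) = 0
          simp)
      smul_add := fun x m n => Prod.ext (mul_add _ _ _)
        (funext fun c => by
          change x.b (t (ι c)) * (m.2 c + n.2 c) + x.e (ι c) * (m.1 + n.1) =
            (x.b (t (ι c)) * m.2 c + x.e (ι c) * m.1) + (x.b (t (ι c)) * n.2 c + x.e (ι c) * n.1)
          ring)
      add_smul := fun x y m => Prod.ext (add_mul _ _ _)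
        (funext fun c => by
          change (x + y).b (t (ι c)) * m.2 c + (x + y).e (ι c) * m.1 =
            (x.b (t (ι c)) * m.2 c + x.e (ι c) * m.1) + (y.b (t (ι c)) * m.2 c + y.e (ι c) * m.1)
          simp only [QA.add_b, QA.add_e]
          ring)
      zero_smul := fun m => Prod.ext (zero_mul _)
        (funext fun c => by
          change (0 : QA k s t).b _ * m.2 c + (0 : QA k s t).e _ * m.1 = 0
          simp) }
  ModuleCat.of (QA k s t) (k × (C → k))

namespace AM
variable {C : Type} {a : SA} {ι : C → E} {h : ∀ c, s (ι c) = a}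
/-- Coordinate. -/
def m (f : AM k s t a ι h) : k := Prod.fst (α := k) (β := C → k) f
/-- Coordinates. -/
def n (f : AM k s t a ι h) : C → k := Prod.snd (α := k) (β := C → k) f
/-- Constructor. -/
def mk (n : k) (f : C → k) : AM k s t a ι h := ((n, f) : k × (C → k))
@[simp] lemma mk_m (x : k) (f : C → k) : m (mk x f : AM k s t a ι h) = x := rfl
@[simp] lemma mk_n (x : k) (f : C → k) : n (mk x f : AM k s t a ι h) = f := rfl
lemma ext {f f' : AM k s t a ι h} (h0 : m f = m f') (h : ∀ i, n f i = n f' i) : f = f' :=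
  Prod.ext (α := k) (β := C → k) h0 (funext h)
@[simp] lemma add_m (f f' : AM k s t a ι h) : m (f + f') = m f + m f' := rfl
@[simp] lemma add_n (f f' : AM k s t a ι h) (i : C) : n (f + f') i = n f i + n f' i := rfl
@[simp] lemma zero_m : m (0 : AM k s t a ι h) = 0 := rfl
@[simp] lemma zero_n (i : C) : n (0 : AM k s t a ι h) i = 0 := rfl
@[simp] lemma smul_m (x : QA k s t) (f : AM k s t a ι h) :
    m (x • f) = x.a a * m f := rfl
@[simp] lemma smul_n (x : QA k s t) (f : AM k s t a ι h) (i : C) :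
    n (x • f) i = x.b (t (ι i)) * n f i + x.e (ι i) * m f := rfl

lemma isP [Fintype C] (hinj : Function.Injective ι) (hsurj : ∀ e, s e = a → ∃ c, ι c = e) :
    IsP (ea a : QA k s t) (AM k s t a ι h) (AM.mk 1 0) where
  eu := AM.ext (by simp) fun i => by simp
  ex M v hv := by
    have key : ∀ x : QA k s t, x * ea a = x.a a • ea a + ∑ c, x.e (ι c) • ee (ι c) := by
      intro x
      refine QA.ext' (fun i => by by_cases hi : i = a <;> simp [hi]) (fun i => by simp) fun i => ?_
      by_cases hi : s i = a
      · obtain ⟨c, rfl⟩ := hsurj i hi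
        classical
        simp [h, hinj.eq_iff]
      · have : ∀ c, i ≠ ι c := fun c hc => hi (hc ▸ h c)
        simp [hi, this]
    have hE : ∀ c, (ee (ι c) : QA k s t) • v = (ee (ι c) * ea a : QA k s t) • v := fun c => by
      rw [mul_smul, hv]
    have hx : ∀ x : QA k s t, x • v = x.a a • v + ∑ c, x.e (ι c) • ((ee (ι c) : QA k s t) • v) := by
      intro x
      conv_lhs => rw [← hv, ← mul_smul, key, add_smul, Finset.sum_smul, smul_assoc, hv]
      simp only [smul_assoc]
    refine ⟨mkH (fun f => m f • v + ∑ c, n f c • ((ee (ι c) : QA k s t) • v))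
      (fun x y => ?_) (fun x y => ?_), ?_⟩
    · simp only [add_m, add_n, add_smul, Finset.sum_add_distrib]
      abel
    · have hc : ∀ c, x • n y c • ((ee (ι c) : QA k s t) • v) =
          (x.b (t (ι c)) * n y c) • ((ee (ι c) : QA k s t) • v) := by
        intro c
        rw [smul_comm, ← mul_smul, mul_ee, smul_assoc, smul_smul, mul_comm]
      simp only [smul_m, smul_n, smul_add, Finset.smul_sum, hc, add_smul, Finset.sum_add_distrib]
      rw [smul_comm x, hx, smul_add, smul_smul, Finset.smul_sum, mul_comm]
      simp only [smul_smul, mul_comm (m y)]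
      abel
    · rw [mkH_apply]
      simp
  uniq M g g' hg := by
    ext y
    have : y = (QA.mk' (fun i => if i = a then m y else 0) 0
        (fun e => ∑ c, if ι c = e then n y c else 0) : QA k s t) • (AM.mk 1 0) := by
      classical
      refine AM.ext (by simp) fun i => by simp [hinj.eq_iff]
    rw [this, map_smul, map_smul, hg]

end AM

end PartM

section PartN
set_option linter.unusedSectionVars false
open scoped ModuleCat.Algebra
open QA

variable {k : Type} [Field k] {SA SB E : Type} {s : E → SA} {t : E → SB}
variable [DecidableEq SA] [DecidableEq SB] [DecidableEq E] [Fintype SA] [Fintype SB] [Fintype E]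

/-- All the edges into a sink. -/
def allE {J : Type} (α β : E) (γ : J → E) : (Unit ⊕ J) ⊕ Unit → E :=
  Sum.elim (Sum.elim (fun _ : Unit => α) γ) (fun _ : Unit => β)

/-- The two edges. -/
def twoE (α β : E) : Unit ⊕ Unit → E := Sum.elim (fun _ => α) (fun _ => β)

theorem setup [HasDerivedCategory (ModuleCat.{0} (QA k s t))]
    {J : Type} [Fintype J] (b : SB) (α β : E) (γ : J → E) (hs : s α = s β)
    (hall : ∀ c, t (allE α β γ c) = b) (hinj : Function.Injective (allE α β γ))
    (hsurj : ∀ e, t e = b → ∃ c, allE α β γ c = e)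
    (hout : ∀ e, s e = s β → e = α ∨ e = β) :
    sphericalSubcatOn (BB (QA k s t)) (S0.obj (RM k s t (fun j => s (γ j)))) ∈
      dSpherelikePosetOn k (BB (QA k s t)) 1 := by
  have hαβ : α ≠ β := fun h => by
    have : (Sum.inl (Sum.inl ()) : (Unit ⊕ J) ⊕ Unit) = Sum.inr () := hinj h
    cases this
  have h2 : ∀ c, s (twoE α β c) = s β := fun c => by
    rcases c with _ | _
    · exact hs
    · rfl
  have h2inj : Function.Injective (twoE α β) := by
    rintro (_ | _) (_ | _) h
    · rfl
    · exact absurd h hαβ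
    · exact absurd h.symm hαβ
    · rfl
  have h2surj : ∀ e, s e = s β → ∃ c, twoE α β c = e := fun e he => by
    rcases hout e he with h | h
    · exact ⟨Sum.inl (), h.symm⟩
    · exact ⟨Sum.inr (), h.symm⟩
  have htα : t α = b := hall (Sum.inl (Sum.inl ()))
  have htβ : t β = b := hall (Sum.inr ())
  have ht1 : ∀ i, t (twoE α β (Sum.inl i)) = b := fun _ => htα
  have ht2 : ∀ i, t (twoE α β (Sum.inr i)) = b := fun _ => htβ
  have hs1 : ∀ i, s (allE α β γ (Sum.inl (Sum.inl i))) = s β := fun _ => hs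
  let f : (TM k s t (C := Empty) b (fun c => c.elim) (fun c => c.elim)) ⟶ (AM k s t (s β) (twoE α β) h2) := mkH (fun x => AM.mk 0 (Sum.elim 0 (fun _ => TM.n x)))
    (fun x y => AM.ext (by simp) fun i => by rcases i with i | i <;> simp)
    (fun x y => AM.ext (by simp) fun i => by rcases i with i | i <;> simp [ht2])
  let g : (AM k s t (s β) (twoE α β) h2) ⟶ (TM k s t b (fun c => allE α β γ (Sum.inl (Sum.inl c))) (fun c => hall _)) := mkH (fun x => TM.mk (AM.n x (Sum.inl ())) (fun _ => AM.m x))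
    (fun x y => TM.ext (by simp) fun i => by simp)
    (fun x y => TM.ext (by simp [ht1]; exact Or.inl rfl) fun i => by simp [hs1])
  have hfg : f ≫ g = 0 := by
    ext x
    exact TM.ext rfl fun i => rfl
  have S1 : (ShortComplex.mk f g hfg).ShortExact := by
    refine shortExact_of _ _ _ ?_ ?_ ?_
    · intro x hx
      exact TM.ext (congrArg (fun z => AM.n z (Sum.inr ())) hx) fun i => i.elim
    · intro z
      exact ⟨AM.mk (TM.m z ()) (fun _ => TM.n z), TM.ext rfl fun i => rfl⟩
    · intro y hy
      refine ⟨TM.mk (AM.n y (Sum.inr ())) 0, AM.ext ?_ fun i => ?_⟩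
      · exact (congrArg (fun z => TM.m z ()) hy).symm
      · rcases i with i | i
        · exact (congrArg (fun z => TM.n z) hy).symm
        · rfl
  have hPa : IsP (ea (s β) : QA k s t) (AM k s t (s β) (twoE α β) h2) (AM.mk 1 0) := AM.isP h2inj h2surj
  have hPb : IsP (eb b : QA k s t) (TM k s t (C := Empty) b (fun c => c.elim) (fun c => c.elim)) (TM.mk 1 0) := TM.isP
  have hIb : IsI (fun _ : Unit => (eb b : QA k s t)) (TM k s t b (allE α β γ) hall) (fun _ => TM.nL) := TM.isI hinj hsurj
  have hIa : IsI (fun _ : Unit => (ea (s β) : QA k s t)) (RM k s t (fun _ : Unit => s β)) (fun _ => RM.gL ()) := RM.isI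
  let x0 : (TM k s t b (fun c => allE α β γ (Sum.inl (Sum.inl c))) (fun c => hall _)) ⟶ (RM k s t (fun _ : Unit => s β)) := mkH (fun x => RM.mk (TM.m x)) (fun x y => RM.ext fun i => by simp)
    (fun x y => RM.ext fun i => by simp [hs1])
  let i0 : (TM k s t (C := Empty) b (fun c => c.elim) (fun c => c.elim)) ⟶ (TM k s t b (fun c => allE α β γ (Sum.inl (Sum.inl c))) (fun c => hall _)) := mkH (fun x => TM.mk (TM.n x) 0)
    (fun x y => TM.ext (by simp) fun i => by simp)
    (fun x y => TM.ext (by simp) fun i => by simp)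
  have H1 : ∀ x : (AM k s t (s β) (twoE α β) h2) ⟶ (TM k s t b (fun c => allE α β γ (Sum.inl (Sum.inl c))) (fun c => hall _)), ∃ c : k, x = c • g := fun x => by
    refine ⟨TM.m (x.hom (AM.mk 1 0)) (), hPa.uniq _ _ _ ?_⟩
    have e1 : (ea (s β) : QA k s t) • x.hom (AM.mk 1 0) = x.hom (AM.mk 1 0) := by
      rw [← map_smul, hPa.eu]
    rw [smul_hom_apply]
    refine TM.ext ?_ fun i => ?_
    · rw [← e1]
      have : TM.n (g.hom (AM.mk 1 0)) = 0 := rfl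
      rw [TM.ksmul_n, this]
      simp
    · have : TM.m (g.hom (AM.mk 1 0)) i = 1 := rfl
      rw [TM.ksmul_m, this, mul_one]
  have : Epi g := S1.epi_g
  refine mem_poset
    (ea_mul_ea _) (eb_mul_eb _) hPa hPb hIa hIb S1
    (TM.inc_proj_exact (ι := allE α β γ) (h' := fun c => hall _)) (TM.inc_proj_exact (ι := fun c => allE α β γ (Sum.inl c)))
    ?_ H1 ?_ x0 ?_ ?_ i0 ?_ ?_ ?_
  · intro z
    have e1 : f.hom (TM.mk 1 0) = (ee β : QA k s t) • (AM.mk 1 0 : (AM k s t (s β) (twoE α β) h2)) := by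
      refine AM.ext (by simp [f, mkH_apply]) fun i => ?_
      rw [AM.smul_n, ee_b, ee_e, zero_mul, zero_add, AM.mk_m, mul_one]
      rcases i with i | i
      · change (0 : k) = if α = β then 1 else 0
        rw [if_neg hαβ]
      · change (1 : k) = if β = β then 1 else 0
        rw [if_pos rfl]
    change TM.n (z.hom (f.hom (TM.mk 1 0))) = TM.m (z.hom (AM.mk 1 0)) (Sum.inr ())
    rw [e1, map_smul]
    exact TM.n_ee hinj (Sum.inr ()) _
  · intro y
    refine ⟨TM.n (y.hom (TM.mk 1 0)), hIb.uniq _ _ _ fun _ z => ?_⟩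
    have e1 : (eb b : QA k s t) • z = TM.n z • (TM.mk 1 0 : (TM k s t b (fun c => allE α β γ (Sum.inl c)) (fun c => hall _))) :=
      TM.ext (by simp) fun i => by simp
    rw [← hIb.eθ () (y.hom z), ← map_smul, e1, smul_hom_apply, ← homL_apply (k := k), map_smul,
      map_smul, map_smul, homL_apply]
    change TM.n z * TM.n (y.hom (TM.mk 1 0)) = TM.n (y.hom (TM.mk 1 0)) * TM.n z
    rw [mul_comm]
  · intro h
    have := congrArg (fun z : (TM k s t b (fun c => allE α β γ (Sum.inl (Sum.inl c))) (fun c => hall _)) ⟶ (RM k s t (fun _ : Unit => s β)) => RM.g (z.hom (TM.mk 0 1)) ()) h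
    exact one_ne_zero (α := k) this
  · intro x
    obtain ⟨c, hc⟩ := H1 (g ≫ x)
    refine ⟨c, ?_⟩
    rw [← cancel_epi g, hc, Linear.comp_smul, Category.comp_id]
  · intro h
    have := congrArg (fun z : (TM k s t (C := Empty) b (fun c => c.elim) (fun c => c.elim)) ⟶ (TM k s t b (fun c => allE α β γ (Sum.inl (Sum.inl c))) (fun c => hall _)) => TM.n (z.hom (TM.mk 1 0))) h
    exact one_ne_zero (α := k) this
  · intro x
    refine ⟨TM.n (x.hom (TM.mk 1 0)), hPb.uniq _ _ _ ?_⟩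
    have e1 : (eb b : QA k s t) • x.hom (TM.mk 1 0) = x.hom (TM.mk 1 0) := by
      rw [← map_smul, hPb.eu]
    rw [smul_hom_apply]
    refine TM.ext ?_ fun i => ?_
    · have : TM.n (i0.hom (TM.mk 1 0)) = 1 := rfl
      rw [TM.ksmul_n, this, mul_one]
    · rw [← e1]
      have : TM.m (i0.hom (TM.mk 1 0)) i = 0 := rfl
      rw [TM.ksmul_m, this]
      simp
  · intro h
    have := congrArg (fun z : (TM k s t b (fun c => allE α β γ (Sum.inl (Sum.inl c))) (fun c => hall _)) ⟶ (TM k s t b (fun c => allE α β γ (Sum.inl c)) (fun c => hall _)) => TM.n (z.hom (TM.mk 1 0))) h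
    exact one_ne_zero (α := k) this

end PartN

section PartO
set_option linter.unusedSectionVars false
open scoped ModuleCat.Algebra
open QA

variable {k : Type} [Field k] {P : Type} [Fintype P] [PartialOrder P]

/-- Edges of the quiver attached to a poset. -/
abbrev EP (P : Type) [PartialOrder P] : Type := P ⊕ (P ⊕ {x : P × P // x.1 ≤ x.2})

/-- Sources of the edges. -/
def sP : EP P → P ⊕ P
  | Sum.inl p => Sum.inl p
  | Sum.inr (Sum.inl p) => Sum.inl p
  | Sum.inr (Sum.inr x) => Sum.inr x.1.2

/-- Targets of the edges. -/
def tP : EP P → P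
  | Sum.inl p => p
  | Sum.inr (Sum.inl p) => p
  | Sum.inr (Sum.inr x) => x.1.1

/-- The asphericality of the object attached to an element of the poset. -/
abbrev QP (k : Type) [Field k] (p : P) : ModuleCat.{0} (QA k (sP (P := P)) tP) :=
  RM k sP tP (fun j : {r : P // p ≤ r} => Sum.inr j.1)

theorem setup' {SA SB E : Type} {s : E → SA} {t : E → SB}
    [DecidableEq SA] [DecidableEq SB] [DecidableEq E] [Fintype SA] [Fintype SB] [Fintype E]
    [HasDerivedCategory (ModuleCat.{0} (QA k s t))]
    {J : Type} [Fintype J] (b : SB) (α β : E) (γ : J → E) (l : J → SA) (hl : ∀ j, s (γ j) = l j)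
    (hs : s α = s β)
    (hall : ∀ c, t (allE α β γ c) = b) (hinj : Function.Injective (allE α β γ))
    (hsurj : ∀ e, t e = b → ∃ c, allE α β γ c = e)
    (hout : ∀ e, s e = s β → e = α ∨ e = β) :
    sphericalSubcatOn (BB (QA k s t)) (S0.obj (RM k s t l)) ∈
      dSpherelikePosetOn k (BB (QA k s t)) 1 := by
  obtain rfl : (fun j => s (γ j)) = l := funext hl
  exact setup b α β γ hs hall hinj hsurj hout

theorem QP_mem [HasDerivedCategory (ModuleCat.{0} (QA k (sP (P := P)) tP))] (p : P) :
    sphericalSubcatOn (BB (QA k (sP (P := P)) tP)) (S0.obj (QP k p)) ∈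
      dSpherelikePosetOn k (BB (QA k (sP (P := P)) tP)) 1 := by
  classical
  refine setup' (J := {r : P // p ≤ r}) p (Sum.inl p) (Sum.inr (Sum.inl p))
    (fun j => Sum.inr (Sum.inr ⟨(p, j.1), j.2⟩)) _ (fun j => rfl) rfl ?_ ?_ ?_ ?_
  · rintro ((_ | _) | _) <;> rfl
  · rintro ((_ | ⟨r, hr⟩) | _) ((_ | ⟨r', hr'⟩) | _) h <;> simp_all [allE]
  · rintro (q | q | ⟨⟨q, r⟩, hq⟩) h
    · exact ⟨Sum.inl (Sum.inl ()), by subst h; rfl⟩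
    · exact ⟨Sum.inr (), by subst h; rfl⟩
    · have h : q = p := h
      subst h
      exact ⟨Sum.inl (Sum.inr ⟨r, hq⟩), rfl⟩
  · rintro (q | q | ⟨⟨q, r⟩, hq⟩) h
    · exact Or.inl (congrArg _ (Sum.inl.inj h))
    · exact Or.inr (congrArg (fun z => Sum.inr (Sum.inl z)) (Sum.inl.inj h))
    · cases h

theorem QP_le [HasDerivedCategory (ModuleCat.{0} (QA k (sP (P := P)) tP))] (p q : P) :
    p ≤ q ↔ sphericalSubcatOn (BB (QA k (sP (P := P)) tP)) (S0.obj (QP k p)) ⊆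
      sphericalSubcatOn (BB (QA k (sP (P := P)) tP)) (S0.obj (QP k q)) := by
  classical
  constructor
  · intro hpq
    refine subcat_mono (Q := QP k p) (Q' := QP k q)
      (mkH (fun f => RM.mk (fun j => if h : q ≤ j.1 then RM.g f ⟨j.1, h⟩ else 0)) ?_ ?_)
      (mkH (fun f => RM.mk (fun j => RM.g f ⟨j.1, hpq.trans j.2⟩)) ?_ ?_) ?_
    · intro x y
      refine RM.ext fun i => ?_
      rw [RM.add_g, RM.mk_g, RM.mk_g, RM.mk_g]
      split_ifs
      · exact RM.add_g _ _ _
      · rw [add_zero]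
    · intro x y
      refine RM.ext fun i => ?_
      rw [RM.smul_g, RM.mk_g, RM.mk_g]
      split_ifs
      · exact RM.smul_g _ _ _
      · rw [mul_zero]
    · intro x y
      exact RM.ext fun i => rfl
    · intro x y
      exact RM.ext fun i => rfl
    · ext x
      exact RM.ext fun i => dif_pos i.2
  · intro h
    by_contra hpq
    let f' : RM k (sP (P := P)) tP (fun _ : Unit => Sum.inr q) ⟶ QP k q :=
      mkH (fun f => RM.mk fun j => if j.1 = q then RM.g f () else 0)
        (fun x y => RM.ext fun i => by
          rw [RM.add_g, RM.mk_g, RM.add_g, RM.mk_g, RM.mk_g]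
          split_ifs
          · rfl
          · rw [add_zero])
        (fun x y => RM.ext fun i => by
          rw [RM.smul_g, RM.mk_g, RM.smul_g, RM.mk_g]
          split_ifs with hi
          · rw [hi]
          · rw [mul_zero])
    have : Injective (QP k p) := inferInstanceAs (Injective (RM k sP tP _))
    refine subcat_not_le (Q := QP k p) (Q' := QP k q)
      (M := RM k (sP (P := P)) tP (fun _ : Unit => Sum.inr q)) ?_ f' ?_ h
    · intro f
      ext x
      refine RM.ext fun i => ?_
      have e1 : x = (ea (Sum.inr q) : QA k (sP (P := P)) tP) • x := RM.ext fun i => by simp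
      have hi : i.1 ≠ q := fun hi => hpq (hi ▸ i.2)
      rw [e1, map_smul]
      refine (RM.smul_g _ _ _).trans ?_
      rw [ea_a, if_neg (fun h => hi (Sum.inr.inj h)), zero_mul]
      rfl
    · intro h0
      have := congrArg (fun z : RM k (sP (P := P)) tP (fun _ : Unit => Sum.inr q) ⟶ QP k q =>
        RM.g (z.hom (RM.mk 1)) ⟨q, le_rfl⟩) h0
      exact one_ne_zero (α := k) ((if_pos rfl).symm.trans this)

end PartO

theorem statement_10 (k : Type) [Field k] [IsAlgClosed k]
    (P : Type) [Fintype P] [PartialOrder P] :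
    ∃ Λ : AlgebraSetup k,
      IsHereditaryAlg Λ.carrier ∧
      ∃ g : P → Set (DerivedCategory (ModuleCat.{0} Λ.carrier)),
        (∀ p : P, g p ∈ dSpherelikePosetAlg k Λ 1) ∧
        (∀ p q : P, p ≤ q ↔ g p ⊆ g q) := by
  classical
  letI : HasDerivedCategory.{1} (ModuleCat.{0} (QA k (sP (P := P)) tP)) :=
    HasDerivedCategory.standard _
  refine ⟨{ carrier := QA k (sP (P := P)) tP, lin := inferInstance }, QA_hereditary,
    fun p => sphericalSubcatOn (BB (QA k (sP (P := P)) tP)) (S0.obj (QP k p)), fun p => QP_mem p,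
    fun p q => QP_le p q⟩

end SpherePaper

end
end
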